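/- (BMO pairing with Jacobians) If f ∈ W^{1,n-1}(ℝ^n, ℝ^n) with |D^♯f| ∈ L^{n/(n-1)}(ℝ^n), then for every φ ∈ BMO(ℝ^n), |∫_{ℝ^n} φ(x) J(x,f) dx| ≤ C(n) ‖φ‖_{BMO} ∫_{ℝ^n} |D^♯f(x)|^{n/(n-1)} dx. -/

import Mathlib

open MeasureTheory Metric ENNReal Matrix
noncomputable section

variable {n : ℕ}

/-- The matrix of the differential `Df(y)` in the standard basis of `ℝ^n`. -/
def diffMatrix (f : EuclideanSpace ℝ (Fin n) → EuclideanSpace ℝ (Fin n))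
    (y : EuclideanSpace ℝ (Fin n)) : Matrix (Fin n) (Fin n) ℝ :=
  fun i j => fderiv ℝ f y (EuclideanSpace.single j 1) i

/-- The Jacobian determinant `J(y,f) = det Df(y)`. -/
def jacDet (f : EuclideanSpace ℝ (Fin n) → EuclideanSpace ℝ (Fin n))
    (y : EuclideanSpace ℝ (Fin n)) : ℝ :=
  (diffMatrix f y).det

/-- The (Hilbert–Schmidt) norm of the cofactor matrix `D^♯f(y)`. -/
def cofNorm (f : EuclideanSpace ℝ (Fin n) → EuclideanSpace ℝ (Fin n))
    (y : EuclideanSpace ℝ (Fin n)) : ℝ :=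
  Real.sqrt (∑ i, ∑ j, ((Matrix.adjugate (diffMatrix f y))ᵀ i j) ^ 2)


abbrev EE (n : ℕ) := EuclideanSpace ℝ (Fin n)

/-- volume of the unit ball -/
def vb (n : ℕ) : ℝ := (volume (ball (0 : EE n) 1)).toReal

lemma vb_pos : 0 < vb n := by
  unfold vb
  exact ENNReal.toReal_pos (measure_ball_pos _ _ one_pos).ne' measure_ball_lt_top.ne

lemma vol_ball (x : EE n) {r : ℝ} (hr : 0 < r) :
    volume (ball x r) = ENNReal.ofReal (r ^ n * vb n) := by
  rw [Measure.addHaar_ball_of_pos _ _ hr, finrank_euclideanSpace_fin,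
    ENNReal.ofReal_mul (by positivity), vb, ENNReal.ofReal_toReal measure_ball_lt_top.ne]

lemma vol_closedBall (x : EE n) {r : ℝ} (hr : 0 < r) :
    volume (closedBall x r) = ENNReal.ofReal (r ^ n * vb n) := by
  rw [Measure.addHaar_closedBall _ _ hr.le, finrank_euclideanSpace_fin,
    ENNReal.ofReal_mul (by positivity), vb, ENNReal.ofReal_toReal measure_ball_lt_top.ne]

/-- superlevel set of the maximal function -/
def mxSet (h : EE n → ℝ≥0∞) (l : ℝ) : Set (EE n) :=
  {x | ∃ r : ℝ, 0 < r ∧ ENNReal.ofReal (l * r ^ n) < ∫⁻ y in closedBall x r, h y}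

lemma isOpen_mxSet (h : EE n → ℝ≥0∞) (l : ℝ) : IsOpen (mxSet h l) := by
  rw [Metric.isOpen_iff]
  rintro x ⟨r, hr, hlt⟩
  have hc : Filter.Tendsto (fun t : ℝ => ENNReal.ofReal (l * (r + t) ^ n)) (nhds 0)
      (nhds (ENNReal.ofReal (l * (r + 0) ^ n))) := by
    apply ENNReal.tendsto_ofReal
    apply Continuous.tendsto
    fun_prop
  rw [add_zero] at hc
  have := hc.eventually (gt_mem_nhds hlt)
  rw [Metric.eventually_nhds_iff] at this
  obtain ⟨e, he, H⟩ := this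
  refine ⟨e, he, fun y hy => ⟨r + dist y x, by positivity, ?_⟩⟩
  refine lt_of_lt_of_le (H (y := dist y x) ?_) ?_
  · simpa using hy
  · apply lintegral_mono_set
    intro z hz
    rw [mem_closedBall] at *
    linarith [dist_triangle z x y, dist_comm x y]

lemma mxSet_anti (h : EE n → ℝ≥0∞) {l l' : ℝ} (hl : l ≤ l') : mxSet h l' ⊆ mxSet h l := by
  rintro x ⟨r, hr, hlt⟩
  refine ⟨r, hr, lt_of_le_of_lt ?_ hlt⟩
  gcongr

lemma notMem_mxSet {h : EE n → ℝ≥0∞} {l : ℝ} {x : EE n} (hx : x ∉ mxSet h l) {r : ℝ}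
    (hr : 0 < r) : ∫⁻ y in closedBall x r, h y ≤ ENNReal.ofReal (l * r ^ n) := by
  by_contra hcon
  exact hx ⟨r, hr, not_le.1 hcon⟩

lemma mxSet_weak (hn : 1 ≤ n) {h : EE n → ℝ≥0∞} (hm : Measurable h) (hf : ∫⁻ x, h x ≠ ∞)
    {l : ℝ} (hl : 0 < l) :
    volume (mxSet h l) ≤ ENNReal.ofReal (2 * 5 ^ n * vb n / l) *
      ∫⁻ x in {x | ENNReal.ofReal (l / (2 * vb n)) < h x}, h x := by
  have hv := vb_pos (n := n)
  choose! r hr hlt using fun x (hx : x ∈ mxSet h l) => hx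
  have hbd : ∀ x ∈ mxSet h l, r x ≤ max 1 ((∫⁻ x, h x).toReal / l) := by
    intro x hx
    by_contra hcon
    push Not at hcon
    have h1 : 1 < r x := lt_of_le_of_lt (le_max_left _ _) hcon
    have h2 := lt_of_le_of_lt (le_max_right _ _) hcon
    have h3 : ENNReal.ofReal (l * r x ^ n) < ∫⁻ y, h y :=
      lt_of_lt_of_le (hlt x hx) (setLIntegral_le_lintegral _ _)
    rw [ENNReal.ofReal_lt_iff_lt_toReal (by have := hr x hx; positivity) hf] at h3
    have h4 : r x ≤ r x ^ n := le_self_pow₀ h1.le (by omega)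
    rw [div_lt_iff₀ hl] at h2
    nlinarith
  obtain ⟨u, hu, hdis, hcov⟩ := Vitali.exists_disjoint_subfamily_covering_enlargement_closedBall
    (mxSet h l) (fun x => x) r _ hbd 5 (by norm_num)
  have hcount : u.Countable := by
    apply hdis.countable_of_nonempty_interior
    intro a ha
    refine ⟨a, ?_⟩
    exact ball_subset_interior_closedBall (mem_ball_self (hr a (hu ha)))
  set S := {x | ENNReal.ofReal (l / (2 * vb n)) < h x} with hS
  have hSm : MeasurableSet S := measurableSet_lt measurable_const hm
  have key : ∀ a ∈ u, volume (closedBall a (5 * r a)) ≤ ENNReal.ofReal (2 * 5 ^ n * vb n / l) *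
      ∫⁻ x in closedBall a (r a) ∩ S, h x := by
    intro a ha
    have hra := hr a (hu ha)
    have h1 := hlt a (hu ha)
    have h2 : ∫⁻ y in closedBall a (r a), h y ≤ ENNReal.ofReal (l * r a ^ n / 2) +
        ∫⁻ x in closedBall a (r a) ∩ S, h x := by
      rw [← lintegral_inter_add_sdiff h _ hSm, add_comm]
      gcongr
      calc ∫⁻ x in closedBall a (r a) \ S, h x
          ≤ ∫⁻ x in closedBall a (r a) \ S, ENNReal.ofReal (l / (2 * vb n)) := by
            apply setLIntegral_mono' (measurableSet_closedBall.diff hSm)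
            intro x hx
            exact not_lt.1 hx.2
        _ ≤ ∫⁻ x in closedBall a (r a), ENNReal.ofReal (l / (2 * vb n)) :=
            lintegral_mono_set Set.sdiff_subset
        _ = ENNReal.ofReal (l * r a ^ n / 2) := by
            rw [setLIntegral_const, vol_closedBall _ hra, ← ENNReal.ofReal_mul (by positivity)]
            congr 1
            field_simp
    have h3 : ENNReal.ofReal (l * r a ^ n / 2) ≤ ∫⁻ x in closedBall a (r a) ∩ S, h x := by
      have h4 : ENNReal.ofReal (l * r a ^ n) = ENNReal.ofReal (l * r a ^ n / 2) +
        ENNReal.ofReal (l * r a ^ n / 2) := by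
        rw [← ENNReal.ofReal_add (by positivity) (by positivity)]; congr 1; ring
      rw [h4] at h1
      have := (h1.trans_le h2).le
      rwa [ENNReal.add_le_add_iff_left ENNReal.ofReal_ne_top] at this
    rw [vol_closedBall _ (by positivity)]
    calc ENNReal.ofReal ((5 * r a) ^ n * vb n)
        = ENNReal.ofReal (2 * 5 ^ n * vb n / l) * ENNReal.ofReal (l * r a ^ n / 2) := by
          rw [← ENNReal.ofReal_mul (by positivity)]
          congr 1
          field_simp
          rw [mul_pow]
      _ ≤ _ := by gcongr
  calc volume (mxSet h l) ≤ volume (⋃ a ∈ u, closedBall a (5 * r a)) := by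
        apply measure_mono
        intro x hx
        obtain ⟨b, hb, hsub⟩ := hcov x hx
        exact Set.mem_biUnion hb (hsub (mem_closedBall_self (hr x hx).le))
    _ ≤ ∑' a : u, volume (closedBall (a : EE n) (5 * r a)) := measure_biUnion_le _ hcount _
    _ ≤ ∑' a : u, ENNReal.ofReal (2 * 5 ^ n * vb n / l) *
          ∫⁻ x in closedBall (a : EE n) (r a) ∩ S, h x :=
        ENNReal.tsum_le_tsum fun a => key a a.2
    _ = ENNReal.ofReal (2 * 5 ^ n * vb n / l) *
          ∑' a : u, ∫⁻ x in closedBall (a : EE n) (r a) ∩ S, h x := ENNReal.tsum_mul_left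
    _ ≤ _ := by
        gcongr
        have : ∑' a : u, ∫⁻ x in closedBall (a : EE n) (r a) ∩ S, h x =
            ∫⁻ x in ⋃ a ∈ u, closedBall (a : EE n) (r a) ∩ S, h x := by
          rw [lintegral_biUnion hcount (fun a _ => measurableSet_closedBall.inter hSm)]
          intro a ha b hb hab
          exact (hdis ha hb hab).mono Set.inter_subset_left Set.inter_subset_left
        rw [this]
        apply lintegral_mono_set
        intro x hx
        simp only [Set.mem_iUnion] at hx
        obtain ⟨a, _, hx⟩ := hx
        exact hx.2

lemma mxSet_vol_lt_top (hn : 1 ≤ n) {h : EE n → ℝ≥0∞} (hm : Measurable h)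
    (hf : ∫⁻ x, h x ≠ ∞) {l : ℝ} (hl : 0 < l) :
    volume (mxSet h l) ≤ ENNReal.ofReal (2 * 5 ^ n * vb n / l) * ∫⁻ x, h x := by
  refine (mxSet_weak hn hm hf hl).trans ?_
  gcongr
  exact Measure.restrict_le_self

lemma ae_le_of_notMem_mxSet {h : EE n → ℝ≥0∞} (hm : Measurable h)
    (hf : ∫⁻ x, h x ≠ ∞) :
    ∀ᵐ x : EE n, ∀ l : ℝ, x ∉ mxSet h l → h x ≤ ENNReal.ofReal (l / vb n) := by
  have hv := vb_pos (n := n)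
  filter_upwards [(Besicovitch.vitaliFamily (volume : Measure (EE n))).ae_tendsto_lintegral_div'
    hm hf] with x hx l hxl
  have h1 := hx.comp (Besicovitch.tendsto_filterAt volume x)
  refine le_of_tendsto h1 ?_
  filter_upwards [self_mem_nhdsWithin] with r hr
  have hr : 0 < r := hr
  simp only [Function.comp]
  rw [vol_closedBall _ hr]
  apply ENNReal.div_le_of_le_mul
  refine (notMem_mxSet hxl hr).trans ?_
  rw [← ENNReal.ofReal_mul' (by positivity)]
  apply le_of_eq
  congr 1
  field_simp

lemma geom_dyadic {σ : ℝ} (hσ : 0 < σ) {a : ℝ} (ha : 0 < a) (t : ℝ) (ht : 0 ≤ t) (m : ℕ) :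
    ∑ j ∈ Finset.range m, (if a * 2 ^ j < t then (a * 2 ^ j) ^ σ else 0) ≤
      (1 - (2 : ℝ) ^ (-σ))⁻¹ * t ^ σ := by
  have h2 : (2 : ℝ) ^ (-σ) < 1 := Real.rpow_lt_one_of_one_lt_of_neg (by norm_num) (by linarith)
  have hc : 0 < (1 - (2 : ℝ) ^ (-σ))⁻¹ := by rw [inv_pos]; linarith
  set c := (1 - (2 : ℝ) ^ (-σ))⁻¹ with hcdef
  have hceq : c * (2 : ℝ) ^ (-σ) + 1 = c := by
    have : c * (1 - (2 : ℝ) ^ (-σ)) = 1 := inv_mul_cancel₀ (by linarith)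
    linarith
  have key : ∀ m : ℕ, ∑ j ∈ Finset.range m, (if a * 2 ^ j < t then (a * 2 ^ j) ^ σ else 0) ≤
      c * t ^ σ ∧ ∑ j ∈ Finset.range m, (if a * 2 ^ j < t then (a * 2 ^ j) ^ σ else 0) ≤
      c * (2 : ℝ) ^ (-σ) * (a * 2 ^ m) ^ σ := by
    intro m
    induction m with
    | zero =>
      simp only [Finset.range_zero, Finset.sum_empty]
      constructor <;> positivity
    | succ m ih =>
      rw [Finset.sum_range_succ]
      have e : (2 : ℝ) ^ (-σ) * (a * 2 ^ (m + 1)) ^ σ = (a * 2 ^ m) ^ σ := by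
        rw [pow_succ, ← mul_assoc, Real.mul_rpow (by positivity) (by norm_num), mul_comm, mul_assoc,
          ← Real.rpow_add (by norm_num)]
        simp
      split_ifs with hlt
      · have h3 : (a * 2 ^ m) ^ σ ≤ t ^ σ := Real.rpow_le_rpow (by positivity) hlt.le hσ.le
        have h4 : c * (2 : ℝ) ^ (-σ) * (a * 2 ^ m) ^ σ + (a * 2 ^ m) ^ σ = c * (a * 2 ^ m) ^ σ := by
          rw [← hceq]; rw [hceq]; linear_combination (a * 2 ^ m) ^ σ * hceq
        constructor
        · have := ih.2
          nlinarith
        · rw [mul_assoc, e]; linarith [ih.2]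
      · rw [add_zero]
        refine ⟨ih.1, ih.2.trans ?_⟩
        gcongr
        · norm_num
        · omega
  exact (key m).1

lemma geom_dyadic_ennreal {σ : ℝ} (hσ : 0 < σ) {a : ℝ} (ha : 0 < a) (t : ℝ≥0∞) (m : ℕ) :
    ∑ j ∈ Finset.range m, (if ENNReal.ofReal (a * 2 ^ j) < t
      then ENNReal.ofReal ((a * 2 ^ j) ^ σ) else 0) ≤
      ENNReal.ofReal ((1 - (2 : ℝ) ^ (-σ))⁻¹) * t ^ σ := by
  have h2 : (2 : ℝ) ^ (-σ) < 1 := Real.rpow_lt_one_of_one_lt_of_neg (by norm_num) (by linarith)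
  have hc : 0 < (1 - (2 : ℝ) ^ (-σ))⁻¹ := by rw [inv_pos]; linarith
  by_cases ht : t = ∞
  · rw [ht, ENNReal.top_rpow_of_pos hσ, ENNReal.mul_top]
    · exact le_top
    · simpa using hc
  · lift t to NNReal using ht
    have := geom_dyadic hσ ha (t : ℝ) t.2 m
    have h3 := ENNReal.ofReal_le_ofReal this
    rw [ENNReal.ofReal_sum_of_nonneg, ENNReal.ofReal_mul hc.le,
      ← ENNReal.ofReal_rpow_of_nonneg t.coe_nonneg hσ.le, ENNReal.ofReal_coe_nnreal] at h3
    · refine le_trans (le_of_eq ?_) h3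
      apply Finset.sum_congr rfl
      intro j _
      have : ENNReal.ofReal (a * 2 ^ j) < t ↔ a * 2 ^ j < (t : ℝ) := by
        rw [ENNReal.ofReal_lt_iff_lt_toReal (by positivity) ENNReal.coe_ne_top]; simp
      simp only [this]
      split_ifs <;> simp
    · intro j _
      split_ifs <;> positivity

lemma mxSet_sum (hn : 1 ≤ n) {τ : ℝ} (hτ : 1 < τ) : ∃ C : ℝ, 0 < C ∧
    ∀ {h : EE n → ℝ≥0∞} (_ : Measurable h) (_ : ∫⁻ x, h x ≠ ∞) (a : ℝ) (_ : 0 < a) (m : ℕ),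
    ∑ j ∈ Finset.range m, ENNReal.ofReal ((a * 2 ^ j) ^ τ) * volume (mxSet h (a * 2 ^ j)) ≤
      ENNReal.ofReal C * ∫⁻ x, h x ^ τ := by
  have hv := vb_pos (n := n)
  have hσ : 0 < τ - 1 := by linarith
  have h2 : (2 : ℝ) ^ (-(τ - 1)) < 1 :=
    Real.rpow_lt_one_of_one_lt_of_neg (by norm_num) (by linarith)
  have hc : 0 < (1 - (2 : ℝ) ^ (-(τ - 1)))⁻¹ := by rw [inv_pos]; linarith
  refine ⟨2 * 5 ^ n * vb n * ((2 * vb n) ^ (τ - 1) * (1 - (2 : ℝ) ^ (-(τ - 1)))⁻¹), by positivity,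
    fun {h} hm hf a ha m => ?_⟩
  have step : ∀ j, ENNReal.ofReal ((a * 2 ^ j) ^ τ) * volume (mxSet h (a * 2 ^ j)) ≤
      ∫⁻ x, ENNReal.ofReal (2 * 5 ^ n * vb n * (2 * vb n) ^ (τ - 1)) *
        ((if ENNReal.ofReal (a / (2 * vb n) * 2 ^ j) < h x
      then ENNReal.ofReal ((a / (2 * vb n) * 2 ^ j) ^ (τ - 1)) else 0) * h x) := by
    intro j
    have hl : 0 < a * 2 ^ j := by positivity
    calc ENNReal.ofReal ((a * 2 ^ j) ^ τ) * volume (mxSet h (a * 2 ^ j))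
        ≤ ENNReal.ofReal ((a * 2 ^ j) ^ τ) * (ENNReal.ofReal (2 * 5 ^ n * vb n / (a * 2 ^ j)) *
      ∫⁻ x in {x | ENNReal.ofReal ((a * 2 ^ j) / (2 * vb n)) < h x}, h x) := by
          gcongr; exact mxSet_weak hn hm hf hl
      _ = ENNReal.ofReal (2 * 5 ^ n * vb n * (2 * vb n) ^ (τ - 1)) *
        (ENNReal.ofReal ((a / (2 * vb n) * 2 ^ j) ^ (τ - 1)) *
      ∫⁻ x in {x | ENNReal.ofReal ((a * 2 ^ j) / (2 * vb n)) < h x}, h x) := by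
          rw [← mul_assoc, ← mul_assoc, ← ENNReal.ofReal_mul (by positivity),
            ← ENNReal.ofReal_mul (by positivity)]
          congr 2
          have e1 : (a * 2 ^ j) ^ τ = (a * 2 ^ j) ^ (τ - 1) * (a * 2 ^ j) := by
            rw [← Real.rpow_add_one hl.ne']; congr 1; ring
          have e2 : (a * 2 ^ j) = (2 * vb n) * (a / (2 * vb n) * 2 ^ j) := by field_simp
          rw [e1, div_eq_mul_inv]
          have e3 : (a * 2 ^ j) ^ (τ - 1) =
              (2 * vb n) ^ (τ - 1) * (a / (2 * vb n) * 2 ^ j) ^ (τ - 1) := by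
            rw [← Real.mul_rpow (by positivity) (by positivity), ← e2]
          rw [e3]
          field_simp
      _ = _ := by
          rw [← lintegral_const_mul _ hm, ← lintegral_indicator, ← lintegral_const_mul]
          · congr 1
            ext x
            congr 1
            have : a * 2 ^ j / (2 * vb n) = a / (2 * vb n) * 2 ^ j := by ring
            simp only [Set.indicator, Set.mem_ofPred_eq, this]
            split_ifs <;> simp
          · apply Measurable.indicator
            · fun_prop
            · exact measurableSet_lt measurable_const hm
          · exact measurableSet_lt measurable_const hm
  calc _ ≤ ∑ j ∈ Finset.range m, ∫⁻ x, ENNReal.ofReal (2 * 5 ^ n * vb n * (2 * vb n) ^ (τ - 1)) *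
        ((if ENNReal.ofReal (a / (2 * vb n) * 2 ^ j) < h x
      then ENNReal.ofReal ((a / (2 * vb n) * 2 ^ j) ^ (τ - 1)) else 0) * h x) :=
        Finset.sum_le_sum fun j _ => step j
    _ = ∫⁻ x, ∑ j ∈ Finset.range m, ENNReal.ofReal (2 * 5 ^ n * vb n * (2 * vb n) ^ (τ - 1)) *
        ((if ENNReal.ofReal (a / (2 * vb n) * 2 ^ j) < h x
      then ENNReal.ofReal ((a / (2 * vb n) * 2 ^ j) ^ (τ - 1)) else 0) * h x) := by
        rw [lintegral_finsetSum]
        intro j _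
        refine Measurable.const_mul (Measurable.mul (Measurable.ite ?_ ?_ ?_) hm) _
        · exact measurableSet_lt measurable_const hm
        · exact measurable_const
        · exact measurable_const
    _ ≤ ∫⁻ x, ENNReal.ofReal (2 * 5 ^ n * vb n * ((2 * vb n) ^ (τ - 1) *
          (1 - (2 : ℝ) ^ (-(τ - 1)))⁻¹)) * h x ^ τ := by
        apply lintegral_mono
        intro x
        simp only
        rw [← Finset.mul_sum, ← Finset.sum_mul]
        have e : h x ^ τ = h x ^ (τ - 1) * h x := by
          conv_rhs => rw [← ENNReal.rpow_one (h x), ← ENNReal.rpow_mul, one_mul]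
          rw [← ENNReal.rpow_add_of_nonneg _ _ hσ.le zero_le_one]
          congr 1; ring
        have e2 : ENNReal.ofReal (2 * 5 ^ n * vb n * ((2 * vb n) ^ (τ - 1) *
            (1 - (2 : ℝ) ^ (-(τ - 1)))⁻¹)) * h x ^ τ =
            ENNReal.ofReal (2 * 5 ^ n * vb n * (2 * vb n) ^ (τ - 1)) *
            ((ENNReal.ofReal ((1 - (2 : ℝ) ^ (-(τ - 1)))⁻¹) * h x ^ (τ - 1)) * h x) := by
          rw [e, ← mul_assoc (2 * 5 ^ n * vb n : ℝ), ENNReal.ofReal_mul (by positivity)]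
          ring
        rw [e2]
        gcongr
        exact geom_dyadic_ennreal hσ (by positivity) _ _
    _ = _ := by
        rw [lintegral_const_mul _ (by fun_prop)]

/-- distance to the complement, scaled -/
def dd (Ω : Set (EE n)) (x : EE n) : ℝ := infDist x Ωᶜ / 20

/-- normalizing constant -/
def ck (n : ℕ) : ℝ := ∫ z : EE n, max 0 (1 - ‖z‖)

/-- averaging kernel -/
def kap (Ω : Set (EE n)) (x y : EE n) : ℝ :=
  (ck n * dd Ω x ^ (n + 1))⁻¹ * max 0 (dd Ω x - ‖x - y‖)

lemma ck_pos : 0 < ck n := by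
  unfold ck
  have hc : Continuous (fun z : EE n => max 0 (1 - ‖z‖)) := by fun_prop
  have hs : HasCompactSupport (fun z : EE n => max 0 (1 - ‖z‖)) := by
    apply HasCompactSupport.of_support_subset_isCompact (isCompact_closedBall (0 : EE n) 1)
    intro z hz
    by_contra hcon
    apply hz
    simp at hcon ⊢
    linarith
  rw [integral_pos_iff_support_of_nonneg (f := fun z : EE n => max 0 (1 - ‖z‖))
    (fun z => le_max_left _ _) (hc.integrable_of_hasCompactSupport hs)]
  refine lt_of_lt_of_le (measure_ball_pos volume (0 : EE n) one_pos) (measure_mono ?_)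
  intro z hz
  simp at hz ⊢
  linarith

lemma int_tent (x : EE n) {d : ℝ} (hd : 0 < d) :
    ∫ y : EE n, max 0 (d - ‖x - y‖) = ck n * d ^ (n + 1) := by
  rw [integral_sub_left_eq_self (fun y : EE n => max 0 (d - ‖y‖)) volume x]
  have : (fun y : EE n => max 0 (d - ‖y‖)) = fun y => d * (fun z : EE n => max 0 (1 - ‖z‖)) (d⁻¹ • y) := by
    ext y
    simp only [norm_smul, norm_inv, Real.norm_eq_abs, abs_of_pos hd]
    rw [mul_max_of_nonneg _ _ hd.le, mul_zero]
    congr 1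
    field_simp
  rw [this, integral_const_mul,
    Measure.integral_comp_inv_smul volume (fun z : EE n => max 0 (1 - ‖z‖)) d, finrank_euclideanSpace_fin,
    abs_of_pos (by positivity), smul_eq_mul, ck]
  ring

section
variable {Ω : Set (EE n)}

lemma dd_nonneg (x : EE n) : 0 ≤ dd Ω x := div_nonneg infDist_nonneg (by norm_num)

lemma dd_pos (hΩ : IsOpen Ω) (hne : Ωᶜ.Nonempty) {x : EE n} (hx : x ∈ Ω) : 0 < dd Ω x := by
  have := (hΩ.isClosed_compl.notMem_iff_infDist_pos hne (x := x)).1 (by simpa using hx)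
  exact div_pos this (by norm_num)

lemma dd_zero {x : EE n} (hx : x ∉ Ω) : dd Ω x = 0 := by
  rw [dd, infDist_zero_of_mem hx, zero_div]

lemma dd_lip (x y : EE n) : |dd Ω x - dd Ω y| ≤ ‖x - y‖ / 20 := by
  have h := (lipschitz_infDist_pt Ωᶜ).dist_le_mul x y
  rw [NNReal.coe_one, one_mul, Real.dist_eq, dist_eq_norm] at h
  rw [dd, dd, ← sub_div, abs_div, abs_of_pos (by norm_num : (0:ℝ) < 20)]
  gcongr

lemma continuous_dd : Continuous (dd Ω) := (continuous_infDist_pt Ωᶜ).div_const 20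

lemma dd_cmp {x c : EE n} (hx : ‖x - c‖ ≤ 2 * dd Ω c) :
    0.9 * dd Ω c ≤ dd Ω x ∧ dd Ω x ≤ 1.1 * dd Ω c := by
  have := abs_le.1 (dd_lip (Ω := Ω) x c)
  constructor <;> linarith

lemma mem_of_dd_pos {x : EE n} (hx : 0 < dd Ω x) : x ∈ Ω := by
  by_contra h
  rw [dd_zero h] at hx
  exact lt_irrefl _ hx

lemma kap_nonneg (x y : EE n) : 0 ≤ kap Ω x y := by
  have := ck_pos (n := n)
  have := dd_nonneg (Ω := Ω) x
  unfold kap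
  positivity

lemma kap_supp {x y : EE n} (h : kap Ω x y ≠ 0) : ‖x - y‖ < dd Ω x := by
  by_contra hcon
  apply h
  rw [kap, max_eq_left (by linarith), mul_zero]

lemma kap_supp' {x c : EE n} (h : kap Ω x c ≠ 0) :
    0 < dd Ω x ∧ 0 < dd Ω c ∧ ‖x - c‖ < 1.2 * dd Ω c := by
  have h1 := kap_supp h
  have h2 := abs_le.1 (dd_lip (Ω := Ω) x c)
  have h3 := norm_nonneg (x - c)
  refine ⟨by linarith, by linarith, by linarith⟩

lemma kap_int {x : EE n} (hx : 0 < dd Ω x) : ∫ y, kap Ω x y = 1 := by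
  unfold kap
  rw [integral_const_mul, int_tent x hx, inv_mul_cancel₀]
  have := ck_pos (n := n)
  positivity

lemma measurable_kap : Measurable (fun p : EE n × EE n => kap Ω p.1 p.2) := by
  unfold kap
  have := continuous_dd (Ω := Ω)
  apply Measurable.mul
  · apply Measurable.inv
    exact (by fun_prop : Continuous fun p : EE n × EE n => ck n * dd Ω p.1 ^ (n+1)).measurable
  · exact (by fun_prop : Continuous fun p : EE n × EE n => max 0 (dd Ω p.1 - ‖p.1 - p.2‖)).measurable

lemma continuous_kap (x : EE n) : Continuous (fun y => kap Ω x y) := by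
  unfold kap; fun_prop

lemma integrable_kap (x : EE n) : Integrable (fun y => kap Ω x y) := by
  apply (continuous_kap x).integrable_of_hasCompactSupport
  apply HasCompactSupport.of_support_subset_isCompact (isCompact_closedBall x (dd Ω x))
  intro y hy
  have := kap_supp hy
  rw [mem_closedBall, dist_comm, dist_eq_norm]; exact this.le

/-- constants -/
def K1 (n : ℕ) : ℝ := (ck n)⁻¹ * 2 ^ (n + 2)
def K2 (n : ℕ) : ℝ := (ck n)⁻¹ * (2 * 2 ^ (n + 1) + (n + 1) * 8 ^ (n + 1))
lemma K1_pos : 0 < K1 n := by have := ck_pos (n := n); unfold K1; positivity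
lemma K2_pos : 0 < K2 n := by have := ck_pos (n := n); unfold K2; positivity

lemma kap_le {x c : EE n} (hc : 0 < dd Ω c) (hx : ‖x - c‖ ≤ 2 * dd Ω c) (y : EE n) :
    kap Ω x y ≤ K1 n / dd Ω c ^ n := by
  have h0 := ck_pos (n := n)
  obtain ⟨h1, h2⟩ := dd_cmp hx
  have h3 : (dd Ω x ^ (n+1))⁻¹ ≤ ((dd Ω c / 2) ^ (n+1))⁻¹ := by
    gcongr; linarith
  have h4 : max 0 (dd Ω x - ‖x - y‖) ≤ 2 * dd Ω c := by
    apply max_le (by linarith)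
    have := norm_nonneg (x - y)
    linarith
  unfold kap K1
  rw [mul_inv, mul_assoc]
  calc (ck n)⁻¹ * ((dd Ω x ^ (n+1))⁻¹ * max 0 (dd Ω x - ‖x - y‖))
      ≤ (ck n)⁻¹ * (((dd Ω c / 2) ^ (n+1))⁻¹ * (2 * dd Ω c)) := by gcongr
    _ = _ := by
      simp only [div_pow, pow_succ]
      field_simp

lemma kap_lip {x x' c : EE n} (hc : 0 < dd Ω c) (hx : ‖x - c‖ ≤ 2 * dd Ω c)
    (hx' : ‖x' - c‖ ≤ 2 * dd Ω c) (y : EE n) :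
    |kap Ω x y - kap Ω x' y| ≤ K2 n / dd Ω c ^ (n + 1) * ‖x - x'‖ := by
  have h0 := ck_pos (n := n)
  obtain ⟨h1, h2⟩ := dd_cmp hx
  obtain ⟨h1', h2'⟩ := dd_cmp hx'
  have hd := dd_lip (Ω := Ω) x x'
  have hm : |max 0 (dd Ω x - ‖x - y‖) - max 0 (dd Ω x' - ‖x' - y‖)| ≤ 2 * ‖x - x'‖ := by
    rw [max_comm, max_comm 0]
    refine (abs_max_sub_max_le_abs _ _ 0).trans ?_
    have e : dd Ω x - ‖x - y‖ - (dd Ω x' - ‖x' - y‖) =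
      (dd Ω x - dd Ω x') - (‖x - y‖ - ‖x' - y‖) := by ring
    rw [e]
    refine (abs_sub _ _).trans ?_
    have : |‖x - y‖ - ‖x' - y‖| ≤ ‖x - x'‖ := by
      refine (abs_norm_sub_norm_le _ _).trans (le_of_eq ?_)
      congr 1; abel
    have := norm_nonneg (x - x')
    linarith
  have hm' : max 0 (dd Ω x' - ‖x' - y‖) ≤ 2 * dd Ω c := by
    apply max_le (by linarith)
    have := norm_nonneg (x' - y)
    linarith
  have hm0 : 0 ≤ max 0 (dd Ω x' - ‖x' - y‖) := le_max_left _ _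
  unfold kap K2
  set a := dd Ω x
  set b := dd Ω x'
  set d := dd Ω c
  set δ := ‖x - x'‖
  set m := max 0 (a - ‖x - y‖)
  set m' := max 0 (b - ‖x' - y‖)
  have hδ : 0 ≤ δ := norm_nonneg _
  have ha : 0 < a := by linarith
  have hb : 0 < b := by linarith
  have ia : (a ^ (n+1))⁻¹ ≤ ((d / 2) ^ (n+1))⁻¹ := by gcongr; linarith
  have ib : (b ^ (n+1))⁻¹ ≤ ((d / 2) ^ (n+1))⁻¹ := by gcongr; linarith
  have hp : |b ^ (n+1) - a ^ (n+1)| ≤ δ * (n+1) * (2 * d) ^ n := by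
    refine (abs_pow_sub_pow_le _ _ _).trans ?_
    rw [abs_of_pos ha, abs_of_pos hb, abs_sub_comm]
    push_cast
    gcongr
    · linarith
    · apply max_le <;> linarith
  have e : (ck n * a ^ (n+1))⁻¹ * m - (ck n * b ^ (n+1))⁻¹ * m' =
      (ck n)⁻¹ * ((a ^ (n+1))⁻¹ * (m - m') +
        m' * ((b ^ (n+1) - a ^ (n+1)) * ((a ^ (n+1))⁻¹ * (b ^ (n+1))⁻¹))) := by
    field_simp; ring
  rw [e, abs_mul, abs_of_pos (inv_pos.2 h0), mul_div_assoc, mul_assoc]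
  gcongr
  refine (abs_add_le _ _).trans ?_
  rw [abs_mul, abs_mul m', abs_mul (b ^ (n+1) - _), abs_of_pos (by positivity : 0 < (a ^ (n+1))⁻¹),
    abs_of_nonneg hm0, abs_of_pos (by positivity : 0 < (a ^ (n+1))⁻¹ * (b ^ (n+1))⁻¹)]
  calc (a ^ (n+1))⁻¹ * |m - m'| + m' * (|b ^ (n+1) - a ^ (n+1)| * ((a ^ (n+1))⁻¹ * (b ^ (n+1))⁻¹))
      ≤ ((d / 2) ^ (n+1))⁻¹ * (2 * δ) + (2 * d) * ((δ * (n+1) * (2 * d) ^ n) *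
        (((d / 2) ^ (n+1))⁻¹ * ((d / 2) ^ (n+1))⁻¹)) := by gcongr
    _ = _ := by
      have : (8:ℝ) ^ (n+1) = 2 ^ (n+1) * 2 ^ (n+1) * 2 ^ (n+1) := by
        rw [← mul_pow, ← mul_pow]; norm_num
      rw [this]
      simp only [div_pow, mul_pow, pow_succ]
      field_simp
end

/-- BMO bound in integrated form -/
def BMOle (φ : EE n → ℝ) (M : ℝ) : Prop :=
  ∀ x r, 0 < r → ∫ y in ball x r, |φ y - ⨍ z in ball x r, φ z| ≤ M * (r ^ n * vb n)

lemma BMOle.nonneg {φ : EE n → ℝ} {M : ℝ} (h : BMOle φ M) : 0 ≤ M := by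
  have h1 := h 0 1 one_pos
  have h2 : 0 ≤ ∫ y in ball (0 : EE n) 1, |φ y - ⨍ z in ball (0 : EE n) 1, φ z| :=
    integral_nonneg fun _ => abs_nonneg _
  have h3 := vb_pos (n := n)
  rw [one_pow, one_mul] at h1
  exact nonneg_of_mul_nonneg_left (h2.trans h1) h3

/-- averaging operator -/
def TT (Ω : Set (EE n)) (φ : EE n → ℝ) (x : EE n) : ℝ := ∫ y, kap Ω x y * φ y

section
variable {Ω : Set (EE n)} {φ : EE n → ℝ} {M N : ℝ}

lemma integrable_bdd_ball (hφ : Measurable φ) (hN : ∀ x, |φ x| ≤ N) (c : EE n) (R : ℝ) :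
    IntegrableOn φ (ball c R) := by
  apply Measure.integrableOn_of_bounded (M := N) measure_ball_lt_top.ne hφ.aestronglyMeasurable
  exact Filter.Eventually.of_forall hN

lemma osc_bound (hφ : Measurable φ) (hN : ∀ x, |φ x| ≤ N) (hM : BMOle φ M)
    {c : EE n} {R : ℝ} (hR : 0 < R) {w : EE n → ℝ} {W : ℝ}
    (hW : ∀ y, |w y| ≤ W) (hw0 : ∀ y, y ∉ ball c R → w y = 0) :
    |∫ y, w y * (φ y - ⨍ z in ball c R, φ z)| ≤ W * (M * (R ^ n * vb n)) := by
  set m := ⨍ z in ball c R, φ z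
  have hInt : IntegrableOn (fun y => |φ y - m|) (ball c R) := by
    apply Integrable.abs
    exact (integrable_bdd_ball hφ hN c R).sub (integrableOn_const measure_ball_lt_top.ne)
  have hW0 : 0 ≤ W := (abs_nonneg _).trans (hW c)
  rw [← setIntegral_eq_integral_of_forall_compl_eq_zero (s := ball c R)
    (fun y hy => by rw [hw0 y hy, zero_mul])]
  calc |∫ y in ball c R, w y * (φ y - m)| ≤ ∫ y in ball c R, W * |φ y - m| := by
        rw [← Real.norm_eq_abs]
        apply norm_integral_le_of_norm_le (hInt.const_mul W)
        refine Filter.Eventually.of_forall fun y => ?_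
        rw [Real.norm_eq_abs, abs_mul]
        gcongr
        exact hW y
    _ = W * ∫ y in ball c R, |φ y - m| := integral_const_mul _ _
    _ ≤ _ := by gcongr; exact hM c R hR

lemma integrable_kap_mul (hφ : Measurable φ) (hN : ∀ x, |φ x| ≤ N) (x : EE n) :
    Integrable (fun y => kap Ω x y * φ y) := by
  apply (integrable_kap x).mul_bdd (c := N) hφ.aestronglyMeasurable
  exact Filter.Eventually.of_forall hN

lemma TT_sub (hφ : Measurable φ) (hN : ∀ x, |φ x| ≤ N) {x : EE n} (hx : 0 < dd Ω x) (m : ℝ) :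
    TT Ω φ x - m = ∫ y, kap Ω x y * (φ y - m) := by
  simp only [mul_sub]
  rw [integral_sub (integrable_kap_mul hφ hN x) ((integrable_kap x).mul_const m),
    integral_mul_const, kap_int hx, one_mul, TT]

lemma kap_zero_off {x c : EE n} (hx : ‖x - c‖ ≤ 2 * dd Ω c) {y : EE n}
    (hy : y ∉ ball c (4 * dd Ω c)) : kap Ω x y = 0 := by
  by_contra hcon
  have h1 := kap_supp hcon
  obtain ⟨h2, h3⟩ := dd_cmp hx
  apply hy
  rw [mem_ball, dist_eq_norm]
  have : ‖y - c‖ ≤ ‖x - y‖ + ‖x - c‖ := by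
    rw [norm_sub_rev x y]
    exact norm_sub_le_norm_sub_add_norm_sub _ _ _
  have := norm_nonneg (x - y)
  have := norm_nonneg (x - c)
  have : 0 ≤ dd Ω c := dd_nonneg c
  linarith

/-- constant -/
def K3 (n : ℕ) : ℝ := K1 n * 4 ^ n * vb n
lemma K3_pos : 0 < K3 n := by
  have := K1_pos (n := n); have := vb_pos (n := n); unfold K3; positivity

lemma TT_avg (hφ : Measurable φ) (hN : ∀ x, |φ x| ≤ N) (hM : BMOle φ M)
    {x c : EE n} (hc : 0 < dd Ω c) (hx : ‖x - c‖ ≤ 2 * dd Ω c) :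
    |TT Ω φ x - ⨍ z in ball c (4 * dd Ω c), φ z| ≤ K3 n * M := by
  have h1 : 0 < dd Ω x := by have := dd_cmp hx; linarith
  rw [TT_sub hφ hN h1]
  refine (osc_bound hφ hN hM (by linarith) (W := K1 n / dd Ω c ^ n) ?_ ?_).trans (le_of_eq ?_)
  · intro y
    rw [abs_of_nonneg (kap_nonneg _ _)]
    exact kap_le hc hx y
  · exact fun y hy => kap_zero_off hx hy
  · unfold K3; rw [mul_pow]; field_simp

/-- constant -/
def K4 (n : ℕ) : ℝ := K2 n * 4 ^ n * vb n
lemma K4_pos : 0 < K4 n := by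
  have := K2_pos (n := n); have := vb_pos (n := n); unfold K4; positivity

lemma TT_lip (hφ : Measurable φ) (hN : ∀ x, |φ x| ≤ N) (hM : BMOle φ M)
    {x x' c : EE n} (hc : 0 < dd Ω c) (hx : ‖x - c‖ ≤ 2 * dd Ω c) (hx' : ‖x' - c‖ ≤ 2 * dd Ω c) :
    |TT Ω φ x - TT Ω φ x'| ≤ K4 n * M / dd Ω c * ‖x - x'‖ := by
  have h1 : 0 < dd Ω x := by have := dd_cmp hx; linarith
  have h1' : 0 < dd Ω x' := by have := dd_cmp hx'; linarith
  set m := ⨍ z in ball c (4 * dd Ω c), φ z with hm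
  have e : TT Ω φ x - TT Ω φ x' = ∫ y, (kap Ω x y - kap Ω x' y) * (φ y - m) := by
    have : TT Ω φ x - TT Ω φ x' = (TT Ω φ x - m) - (TT Ω φ x' - m) := by ring
    rw [this, TT_sub hφ hN h1, TT_sub hφ hN h1', ← integral_sub]
    · congr 1; ext y; ring
    · simp only [mul_sub]
      exact (integrable_kap_mul hφ hN x).sub ((integrable_kap x).mul_const m)
    · simp only [mul_sub]
      exact (integrable_kap_mul hφ hN x').sub ((integrable_kap x').mul_const m)
  rw [e]
  refine (osc_bound hφ hN hM (by linarith)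
    (W := K2 n / dd Ω c ^ (n + 1) * ‖x - x'‖) ?_ ?_).trans (le_of_eq ?_)
  · exact fun y => kap_lip hc hx hx' y
  · intro y hy
    rw [kap_zero_off hx hy, kap_zero_off hx' hy, sub_zero]
  · unfold K4; rw [mul_pow, pow_succ]; field_simp

lemma TT_bdd (hφ : Measurable φ) (hN : ∀ x, |φ x| ≤ N) (x : EE n) : |TT Ω φ x| ≤ N := by
  have hN0 : 0 ≤ N := (abs_nonneg _).trans (hN 0)
  by_cases hx : 0 < dd Ω x
  · calc |TT Ω φ x| ≤ ∫ y, kap Ω x y * N := by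
          rw [← Real.norm_eq_abs]
          apply norm_integral_le_of_norm_le ((integrable_kap x).mul_const N)
          refine Filter.Eventually.of_forall fun y => ?_
          rw [Real.norm_eq_abs, abs_mul, abs_of_nonneg (kap_nonneg _ _)]
          gcongr
          · exact kap_nonneg _ _
          · exact hN y
      _ = N := by rw [integral_mul_const, kap_int hx, one_mul]
  · have : ∀ y, kap Ω x y = 0 := by
      intro y
      by_contra h
      exact hx (kap_supp' h).1
    simp [TT, this, hN0]

lemma measurable_TT (hφ : Measurable φ) : Measurable (TT Ω φ) := by
  have : Measurable (fun p : EE n × EE n => kap Ω p.1 p.2 * φ p.2) :=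
    measurable_kap.mul (hφ.comp measurable_snd)
  exact (this.stronglyMeasurable.integral_prod_right).measurable

/-- constant -/
def K5 (n : ℕ) : ℝ := K3 n * (1 + K3 n)
lemma K5_pos : 0 < K5 n := by
  have := K3_pos (n := n); unfold K5; positivity

lemma lint_kap {x : EE n} (hx : 0 < dd Ω x) : ∫⁻ c, ENNReal.ofReal (kap Ω x c) = 1 := by
  rw [← ofReal_integral_eq_lintegral_ofReal (integrable_kap x)
    (Filter.Eventually.of_forall fun y => kap_nonneg _ _), kap_int hx, ENNReal.ofReal_one]

lemma TT_int (hΩ : IsOpen Ω) (hne : Ωᶜ.Nonempty)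
    (hφ : Measurable φ) (hN : ∀ x, |φ x| ≤ N) (hM : BMOle φ M) :
    ∫⁻ x in Ω, ENNReal.ofReal |φ x - TT Ω φ x| ≤ ENNReal.ofReal (K5 n * M) * volume Ω := by
  have hM0 := hM.nonneg
  have hK3 := K3_pos (n := n)
  have hmeas : Measurable (fun x => ENNReal.ofReal |φ x - TT Ω φ x|) := by
    have := measurable_TT (Ω := Ω) hφ
    fun_prop
  calc ∫⁻ x in Ω, ENNReal.ofReal |φ x - TT Ω φ x|
      = ∫⁻ x in Ω, ∫⁻ c, ENNReal.ofReal (kap Ω x c) * ENNReal.ofReal |φ x - TT Ω φ x| := by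
        apply setLIntegral_congr_fun hΩ.measurableSet
        intro x hx
        simp only
        rw [lintegral_mul_const _ (continuous_kap x).measurable.ennreal_ofReal,
          lint_kap (dd_pos hΩ hne hx), one_mul]
    _ = ∫⁻ c, ∫⁻ x in Ω, ENNReal.ofReal (kap Ω x c) * ENNReal.ofReal |φ x - TT Ω φ x| := by
        apply lintegral_lintegral_swap
        apply Measurable.aemeasurable
        exact (measurable_kap.ennreal_ofReal).mul (hmeas.comp measurable_fst)
    _ ≤ ∫⁻ c, Ω.indicator (fun _ => ENNReal.ofReal (K5 n * M)) c := by
        apply lintegral_mono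
        intro c
        simp only
        by_cases hc : c ∈ Ω
        swap
        · have : ∀ x, kap Ω x c = 0 := by
            intro x
            by_contra h
            have := (kap_supp' h).2.1
            rw [dd_zero hc] at this
            exact lt_irrefl _ this
          simp [this]
        rw [Set.indicator_of_mem hc]
        have hd := dd_pos hΩ hne hc
        set m := ⨍ z in ball c (4 * dd Ω c), φ z with hm
        have hInt : IntegrableOn (fun y => |φ y - m|) (ball c (4 * dd Ω c)) := by
          apply Integrable.abs
          exact (integrable_bdd_ball hφ hN c _).sub (integrableOn_const measure_ball_lt_top.ne)
        have hcon : IntegrableOn (fun y => K3 n * M) (ball c (4 * dd Ω c)) :=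
          integrableOn_const measure_ball_lt_top.ne
        calc ∫⁻ x in Ω, ENNReal.ofReal (kap Ω x c) * ENNReal.ofReal |φ x - TT Ω φ x|
            ≤ ∫⁻ x, ENNReal.ofReal (kap Ω x c) * ENNReal.ofReal |φ x - TT Ω φ x| :=
              lintegral_mono' Measure.restrict_le_self le_rfl
          _ ≤ ∫⁻ x, (ball c (4 * dd Ω c)).indicator
              (fun x => ENNReal.ofReal (K1 n / dd Ω c ^ n * (|φ x - m| + K3 n * M))) x := by
              apply lintegral_mono
              intro x
              simp only
              by_cases hk : kap Ω x c = 0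
              · simp [hk]
              obtain ⟨h1, h2, h3⟩ := kap_supp' hk
              rw [Set.indicator_of_mem (by rw [mem_ball, dist_eq_norm]; linarith),
                ← ENNReal.ofReal_mul (kap_nonneg _ _)]
              apply ENNReal.ofReal_le_ofReal
              have hx : ‖x - c‖ ≤ 2 * dd Ω c := by linarith
              have ha := TT_avg hφ hN hM hd hx
              rw [← hm] at ha
              gcongr
              · have := K1_pos (n := n); positivity
              · exact kap_le hd hx c
              · have : φ x - TT Ω φ x = (φ x - m) - (TT Ω φ x - m) := by ring
                rw [this]
                refine (abs_sub _ _).trans ?_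
                gcongr
          _ = ENNReal.ofReal (∫ x in ball c (4 * dd Ω c),
                K1 n / dd Ω c ^ n * (|φ x - m| + K3 n * M)) := by
              rw [lintegral_indicator measurableSet_ball, ofReal_integral_eq_lintegral_ofReal]
              · exact (hInt.add hcon).const_mul _
              · refine Filter.Eventually.of_forall fun y => ?_
                have := K1_pos (n := n)
                positivity
          _ ≤ _ := by
              apply ENNReal.ofReal_le_ofReal
              rw [integral_const_mul, integral_add hInt hcon, setIntegral_const, Measure.real,
                vol_ball _ (by linarith), ENNReal.toReal_ofReal (by have := vb_pos (n := n); positivity),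
                smul_eq_mul]
              have h1 := hM c (4 * dd Ω c) (by linarith)
              calc _ ≤ K1 n / dd Ω c ^ n * (M * ((4 * dd Ω c) ^ n * vb n) +
                    (4 * dd Ω c) ^ n * vb n * (K3 n * M)) := by
                    have := K1_pos (n := n)
                    gcongr
                _ = K5 n * M := by
                    unfold K5; nth_rewrite 2 [K3]
                    rw [mul_pow]; field_simp
    _ = _ := by
        rw [lintegral_indicator hΩ.measurableSet, setLIntegral_const]
end

/-- estimate of `J` on Lipschitz test functions -/
def LocEst (J : EE n → ℝ) (h : EE n → ℝ≥0∞) (τ C0 : ℝ) : Prop :=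
  ∀ (x : EE n) (r L l : ℝ) (θ : EE n → ℝ), 0 < r → 0 ≤ L → 0 < l →
    (∀ y z, |θ y - θ z| ≤ L * ‖y - z‖) → (∀ y, y ∉ ball x r → θ y = 0) →
    ∫⁻ y in closedBall x (10 * r), h y ≤ ENNReal.ofReal (l * r ^ n) →
    |∫ y, θ y * J y| ≤ C0 * L * r ^ (n + 1) * l ^ τ

/-- constant -/
def K6 (n : ℕ) (τ : ℝ) : ℝ := (4 * K1 n + 2 * K2 n) * 2 ^ (n + 1) * (20 ^ n) ^ τ
lemma K6_pos {τ : ℝ} : 0 < K6 n τ := by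
  have := K1_pos (n := n); have := K2_pos (n := n); unfold K6; positivity

section
variable {Ω : Set (EE n)} {J F : EE n → ℝ} {h : EE n → ℝ≥0∞} {τ C0 l A N : ℝ}

lemma lemmaQ_pt (hΩ : IsOpen Ω) (hne : Ωᶜ.Nonempty) (hloc : LocEst J h τ C0) (hl : 0 < l)
    (hmx : ∀ ξ, ξ ∉ Ω → ξ ∉ mxSet h l) (hA : 0 ≤ A)
    (hF : ∀ c, 0 < dd Ω c → ∀ x x', ‖x - c‖ ≤ 2 * dd Ω c → ‖x' - c‖ ≤ 2 * dd Ω c →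
      |F x - F x'| ≤ A / dd Ω c * ‖x - x'‖) {c : EE n} (hc : c ∈ Ω) :
    |∫ x, F x * kap Ω x c * J x| ≤ C0 * K6 n τ * l ^ τ * (A + |F c|) := by
  have hd := dd_pos hΩ hne hc
  set d := dd Ω c with hdd
  have hK1 := K1_pos (n := n)
  have hK2 := K2_pos (n := n)
  -- bound on F
  have hFb : ∀ x, ‖x - c‖ ≤ 2 * d → |F x| ≤ |F c| + 2 * A := by
    intro x hx
    have h1 := hF c hd x c hx (by simpa using hd.le)
    have h2 : A / d * ‖x - c‖ ≤ A / d * (2 * d) := by gcongr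
    have h3 : A / d * (2 * d) = 2 * A := by field_simp
    have h4 := abs_sub_abs_le_abs_sub (F x) (F c)
    rw [← hdd] at h1
    linarith
  have hsup : ∀ x, |F x * kap Ω x c| ≤ (|F c| + 2 * A) * (K1 n / d ^ n) := by
    intro x
    by_cases hk : kap Ω x c = 0
    · rw [hk, mul_zero, abs_zero]; positivity
    · have h3 := (kap_supp' hk).2.2
      rw [← hdd] at h3
      have hx : ‖x - c‖ ≤ 2 * d := by linarith
      rw [abs_mul, abs_of_nonneg (kap_nonneg _ _)]
      gcongr
      · exact kap_nonneg _ _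
      · exact hFb x hx
      · exact kap_le hd hx c
  set L := (4 * K1 n + 2 * K2 n) * (A + |F c|) / d ^ (n + 1) with hL
  have hzero : ∀ x, ¬ ‖x - c‖ < 1.2 * d → kap Ω x c = 0 := by
    intro x hx
    by_contra hk
    exact hx (kap_supp' hk).2.2
  have hout : ∀ x x', ‖x - c‖ ≤ 2 * d → ¬ ‖x' - c‖ ≤ 2 * d →
      |F x * kap Ω x c - F x' * kap Ω x' c| ≤ L * ‖x - x'‖ := by
    intro x x' hx hx'
    rw [hzero x' (by intro h; apply hx'; linarith), mul_zero, sub_zero]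
    by_cases hx2 : ‖x - c‖ < 1.2 * d
    swap
    · rw [hzero x hx2, mul_zero, abs_zero]; positivity
    have h1 : 0.5 * d ≤ ‖x - x'‖ := by
      have : ‖x' - c‖ ≤ ‖x - x'‖ + ‖x - c‖ := by
        rw [norm_sub_rev x x']; exact norm_sub_le_norm_sub_add_norm_sub _ _ _
      push Not at hx'
      linarith
    calc |F x * kap Ω x c| ≤ (|F c| + 2 * A) * (K1 n / d ^ n) := hsup x
      _ ≤ (2 * (A + |F c|)) * (K1 n / d ^ n) := by
          gcongr; linarith [abs_nonneg (F c)]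
      _ = (4 * K1 n) * (A + |F c|) / d ^ (n + 1) * (0.5 * d) := by
          rw [pow_succ]; field_simp; ring
      _ ≤ L * ‖x - x'‖ := by
          rw [hL]; gcongr; linarith
  have hlip : ∀ x x', |F x * kap Ω x c - F x' * kap Ω x' c| ≤ L * ‖x - x'‖ := by
    intro x x'
    by_cases hx : ‖x - c‖ ≤ 2 * d <;> by_cases hx' : ‖x' - c‖ ≤ 2 * d
    · have e : F x * kap Ω x c - F x' * kap Ω x' c =
        (F x - F x') * kap Ω x c + F x' * (kap Ω x c - kap Ω x' c) := by ring
      rw [e]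
      refine (abs_add_le _ _).trans ?_
      rw [abs_mul, abs_mul, abs_of_nonneg (kap_nonneg _ _)]
      have h1 := hF c hd x x' hx hx'
      have h2 := kap_le hd hx c
      have h3 := hFb x' hx'
      have h4 := kap_lip hd hx hx' c
      rw [← hdd] at h1 h2 h4
      calc _ ≤ A / d * ‖x - x'‖ * (K1 n / d ^ n) +
            (|F c| + 2 * A) * (K2 n / d ^ (n+1) * ‖x - x'‖) := by
            gcongr
            exact kap_nonneg _ _
        _ = (K1 n * A + K2 n * (|F c| + 2 * A)) / d ^ (n+1) * ‖x - x'‖ := by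
            rw [pow_succ]; field_simp
        _ ≤ _ := by
            rw [hL]; gcongr
            nlinarith [abs_nonneg (F c), mul_nonneg hK1.le (abs_nonneg (F c)),
              mul_nonneg hK2.le (abs_nonneg (F c)), mul_nonneg hK1.le hA]
    · exact hout x x' hx hx'
    · rw [abs_sub_comm, norm_sub_rev]; exact hout x' x hx' hx
    · rw [hzero x (by intro h; apply hx; linarith), hzero x' (by intro h; apply hx'; linarith)]
      simp; positivity
  obtain ⟨ξ, hξ, hξd⟩ := hΩ.isClosed_compl.exists_infDist_eq_dist hne c
  have hdξ : dist c ξ = 20 * d := by rw [← hξd, hdd, dd]; ring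
  have hlam : ∫⁻ y in closedBall c (10 * (2 * d)), h y ≤
      ENNReal.ofReal (20 ^ n * l * (2 * d) ^ n) := by
    calc _ ≤ ∫⁻ y in closedBall ξ (40 * d), h y := by
          apply lintegral_mono_set
          apply closedBall_subset_closedBall'
          linarith
      _ ≤ ENNReal.ofReal (l * (40 * d) ^ n) := notMem_mxSet (hmx ξ hξ) (by positivity)
      _ = _ := by
          congr 1
          have : 40 * d = 20 * (2 * d) := by ring
          rw [this, mul_pow]; ring
  have := hloc c (2 * d) L (20 ^ n * l) (fun x => F x * kap Ω x c) (by positivity) (by positivity)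
    (by positivity) hlip ?_ hlam
  · refine this.trans (le_of_eq ?_)
    rw [Real.mul_rpow (by positivity) hl.le, hL, mul_pow]
    unfold K6
    field_simp
  · intro y hy
    rw [hzero y, mul_zero]
    intro h
    apply hy
    rw [mem_ball, dist_eq_norm]
    linarith

lemma lemmaQ (hΩ : IsOpen Ω) (hne : Ωᶜ.Nonempty) (hloc : LocEst J h τ C0) (hl : 0 < l)
    (hmx : ∀ ξ, ξ ∉ Ω → ξ ∉ mxSet h l) (hA : 0 ≤ A) (hJ : Integrable J)
    (hvol : volume Ω ≠ ∞) (hFm : Measurable F) (hFN : ∀ x, |F x| ≤ N)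
    (hF : ∀ c, 0 < dd Ω c → ∀ x x', ‖x - c‖ ≤ 2 * dd Ω c → ‖x' - c‖ ≤ 2 * dd Ω c →
      |F x - F x'| ≤ A / dd Ω c * ‖x - x'‖) :
    |∫ x in Ω, F x * J x| ≤ C0 * K6 n τ * l ^ τ * ∫ x in Ω, (A + |F x|) := by
  have hFJ : IntegrableOn (fun x => F x * J x) Ω := by
    apply (hJ.integrableOn).bdd_mul (c := N) hFm.aestronglyMeasurable
    exact Filter.Eventually.of_forall hFN
  have hprod : Integrable (Function.uncurry fun x c => F x * kap Ω x c * J x)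
      ((volume.restrict Ω).prod volume) := by
    have hm : AEStronglyMeasurable (Function.uncurry fun x c => F x * kap Ω x c * J x)
      ((volume.restrict Ω).prod volume) := by
      apply AEStronglyMeasurable.mul
      · exact ((hFm.comp measurable_fst).mul measurable_kap).aestronglyMeasurable
      · exact (hJ.integrableOn.aestronglyMeasurable).comp_fst
    rw [integrable_prod_iff hm]
    constructor
    · refine Filter.Eventually.of_forall fun x => ?_
      simp only [Function.uncurry]
      exact ((integrable_kap x).const_mul _).mul_const _
    · refine hFJ.norm.congr ?_
      filter_upwards [ae_restrict_mem hΩ.measurableSet] with x hx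
      simp only [Function.uncurry, norm_mul]
      rw [integral_mul_const, integral_const_mul]
      have : ∀ c, ‖kap Ω x c‖ = kap Ω x c := fun c => by
        rw [Real.norm_eq_abs, abs_of_nonneg (kap_nonneg _ _)]
      simp only [this]
      rw [kap_int (dd_pos hΩ hne hx), mul_one]
  have e : ∫ x in Ω, F x * J x = ∫ c, ∫ x, F x * kap Ω x c * J x := by
    calc ∫ x in Ω, F x * J x = ∫ x in Ω, ∫ c, F x * kap Ω x c * J x := by
          apply setIntegral_congr_fun hΩ.measurableSet
          intro x hx
          simp only
          rw [integral_mul_const, integral_const_mul, kap_int (dd_pos hΩ hne hx), mul_one]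
      _ = ∫ c, ∫ x in Ω, F x * kap Ω x c * J x := integral_integral_swap hprod
      _ = _ := by
          congr 1; ext c
          apply setIntegral_eq_integral_of_forall_compl_eq_zero
          intro x hx
          have : kap Ω x c = 0 := by
            by_contra hk
            exact hx (mem_of_dd_pos (kap_supp' hk).1)
          rw [this, mul_zero, zero_mul]
  rw [e, ← integral_const_mul, ← integral_indicator hΩ.measurableSet, ← Real.norm_eq_abs]
  apply norm_integral_le_of_norm_le
  · rw [integrable_indicator_iff hΩ.measurableSet]
    apply Integrable.const_mul
    apply Measure.integrableOn_of_bounded (M := A + N) hvol (by fun_prop)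
    refine Filter.Eventually.of_forall fun x => ?_
    rw [Real.norm_eq_abs, abs_of_nonneg (by positivity)]
    linarith [hFN x]
  · refine Filter.Eventually.of_forall fun c => ?_
    by_cases hc : c ∈ Ω
    · rw [Set.indicator_of_mem hc, Real.norm_eq_abs]
      exact lemmaQ_pt hΩ hne hloc hl hmx hA hF hc
    · rw [Set.indicator_of_notMem hc]
      have : ∀ x, kap Ω x c = 0 := by
        intro x
        by_contra hk
        exact hc (mem_of_dd_pos (kap_supp' hk).2.1)
      simp [this]
end

open Classical in
/-- good part of `φ` at level `l` -/
def GG (h : EE n → ℝ≥0∞) (φ : EE n → ℝ) (l : ℝ) (x : EE n) : ℝ :=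
  if x ∈ mxSet h l then TT (mxSet h l) φ x else φ x

/-- constant -/
def K7 (n : ℕ) (τ : ℝ) : ℝ :=
  2 ^ τ * (K6 n τ * (2 * K4 n + 2 * K5 n) + K5 n / (vb n) ^ τ)
lemma K7_pos {τ : ℝ} : 0 < K7 n τ := by
  have := K4_pos (n := n); have := K5_pos (n := n); have := K6_pos (n := n) (τ := τ)
  have := vb_pos (n := n)
  unfold K7; positivity

section
variable {J φ : EE n → ℝ} {h : EE n → ℝ≥0∞} {τ C0 l M N : ℝ}

lemma compl_nonempty (hn : 1 ≤ n) {Ω : Set (EE n)} (hv : volume Ω ≠ ∞) : Ωᶜ.Nonempty := by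
  rw [Set.nonempty_compl]
  rintro rfl
  apply hv
  have : Nontrivial (EE n) := by
    have : Nonempty (Fin n) := ⟨⟨0, hn⟩⟩
    infer_instance
  exact measure_univ_of_isAddLeftInvariant _

lemma measurable_GG (hφ : Measurable φ) : Measurable (GG h φ l) := by
  unfold GG
  exact Measurable.ite (isOpen_mxSet h l).measurableSet (measurable_TT hφ) hφ

lemma GG_bdd (hφ : Measurable φ) (hN : ∀ x, |φ x| ≤ N) (x : EE n) : |GG h φ l x| ≤ N := by
  unfold GG
  split_ifs
  · exact TT_bdd hφ hN x
  · exact hN x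

lemma TT_int_real {Ω : Set (EE n)} (hΩ : IsOpen Ω) (hne : Ωᶜ.Nonempty) (hv : volume Ω ≠ ∞)
    (hφ : Measurable φ) (hN : ∀ x, |φ x| ≤ N) (hM : BMOle φ M) :
    IntegrableOn (fun x => |φ x - TT Ω φ x|) Ω ∧
    ∫ x in Ω, |φ x - TT Ω φ x| ≤ K5 n * M * (volume Ω).toReal := by
  have hK := K5_pos (n := n)
  have hM0 := hM.nonneg
  have hi : IntegrableOn (fun x => |φ x - TT Ω φ x|) Ω := by
    have := measurable_TT (Ω := Ω) hφ
    apply Measure.integrableOn_of_bounded (M := N + N) hv (by fun_prop)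
    refine Filter.Eventually.of_forall fun x => ?_
    rw [Real.norm_eq_abs, abs_abs]
    refine (abs_sub _ _).trans ?_
    gcongr
    · exact hN x
    · exact TT_bdd hφ hN x
  refine ⟨hi, ?_⟩
  rw [integral_eq_lintegral_of_nonneg_ae (Filter.Eventually.of_forall fun _ => abs_nonneg _)
    hi.aestronglyMeasurable]
  have := ENNReal.toReal_mono (ENNReal.mul_ne_top ENNReal.ofReal_ne_top hv) (TT_int hΩ hne hφ hN hM)
  rwa [ENNReal.toReal_mul, ENNReal.toReal_ofReal (by positivity)] at this

lemma dd_mono {Ω Ω' : Set (EE n)} (hsub : Ω' ⊆ Ω) (hne : Ωᶜ.Nonempty) (x : EE n) :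
    dd Ω' x ≤ dd Ω x := by
  unfold dd
  gcongr
  exact infDist_le_infDist_of_subset (Set.compl_subset_compl.2 hsub) hne

lemma step_bound (hn : 1 ≤ n) (hm : Measurable h) (hf : ∫⁻ x, h x ≠ ∞) (hτ : 1 < τ)
    (hC0 : 0 ≤ C0) (hJ : Integrable J)
    (hJh : ∀ᵐ x, ENNReal.ofReal |J x| ≤ ENNReal.ofReal C0 * h x ^ τ)
    (hloc : LocEst J h τ C0) (hφ : Measurable φ) (hN : ∀ x, |φ x| ≤ N) (hM : BMOle φ M)
    (hl : 0 < l) :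
    |(∫ x, GG h φ (2 * l) x * J x) - ∫ x, GG h φ l x * J x| ≤
      C0 * K7 n τ * M * (l ^ τ * (volume (mxSet h l)).toReal) := by
  have hM0 := hM.nonneg
  have hK4 := K4_pos (n := n)
  have hK5 := K5_pos (n := n)
  have hK6 := K6_pos (n := n) (τ := τ)
  have hvb := vb_pos (n := n)
  have hvt : ∀ l, 0 < l → volume (mxSet h l) ≠ ∞ := fun l hl =>
    ne_top_of_le_ne_top (ENNReal.mul_ne_top ENNReal.ofReal_ne_top hf) (mxSet_vol_lt_top hn hm hf hl)
  have hl2 : 0 < 2 * l := by linarith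
  set Ω := mxSet h l with hΩdef
  set Ω' := mxSet h (2 * l) with hΩ'def
  have hsub : Ω' ⊆ Ω := mxSet_anti h (by linarith)
  have hΩ : IsOpen Ω := isOpen_mxSet h l
  have hΩ' : IsOpen Ω' := isOpen_mxSet h _
  have hv : volume Ω ≠ ∞ := hvt l hl
  have hv' : volume Ω' ≠ ∞ := hvt _ hl2
  have hne := compl_nonempty hn hv
  have hne' := compl_nonempty hn hv'
  have hTm := measurable_TT (Ω := Ω) hφ
  have hTm' := measurable_TT (Ω := Ω') hφ
  have hintb : ∀ g : EE n → ℝ, Measurable g → (∀ x, |g x| ≤ N + N) →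
      Integrable (fun x => g x * J x) := by
    intro g hg hgN
    exact hJ.bdd_mul (c := N + N) hg.aestronglyMeasurable (Filter.Eventually.of_forall hgN)
  have hN0 : 0 ≤ N := (abs_nonneg _).trans (hN 0)
  have b1 : ∀ x, |TT Ω' φ x - TT Ω φ x| ≤ N + N := fun x =>
    (abs_sub _ _).trans (add_le_add (TT_bdd hφ hN x) (TT_bdd hφ hN x))
  have b2 : ∀ x, |φ x - TT Ω φ x| ≤ N + N := fun x =>
    (abs_sub _ _).trans (add_le_add (hN x) (TT_bdd hφ hN x))
  have e : (∫ x, GG h φ (2 * l) x * J x) - ∫ x, GG h φ l x * J x =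
      (∫ x in Ω', (TT Ω' φ x - TT Ω φ x) * J x) + ∫ x in Ω \ Ω', (φ x - TT Ω φ x) * J x := by
    rw [← integral_sub, ← integral_indicator hΩ'.measurableSet,
      ← integral_indicator (hΩ.measurableSet.diff hΩ'.measurableSet), ← integral_add]
    · congr 1
      ext x
      unfold GG
      rw [← hΩdef, ← hΩ'def]
      by_cases hx' : x ∈ Ω'
      · have hx := hsub hx'
        simp [hx, hx']; ring
      · by_cases hx : x ∈ Ω
        · simp [hx, hx']; ring
        · simp [hx, hx']
    · exact (hintb _ (by fun_prop) b1).indicator hΩ'.measurableSet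
    · exact (hintb _ (by fun_prop) b2).indicator (hΩ.measurableSet.diff hΩ'.measurableSet)
    · exact hintb _ (measurable_GG hφ) fun x => (GG_bdd hφ hN x).trans (by linarith)
    · exact hintb _ (measurable_GG hφ) fun x => (GG_bdd hφ hN x).trans (by linarith)
  obtain ⟨i1, I1⟩ := TT_int_real hΩ hne hv hφ hN hM
  obtain ⟨i2, I2⟩ := TT_int_real hΩ' hne' hv' hφ hN hM
  have hvle : (volume Ω').toReal ≤ (volume Ω).toReal := ENNReal.toReal_mono hv (measure_mono hsub)
  have F1 : |∫ x in Ω', (TT Ω' φ x - TT Ω φ x) * J x| ≤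
      C0 * K6 n τ * (2 * l) ^ τ * ((2 * K4 n + 2 * K5 n) * M * (volume Ω).toReal) := by
    refine (lemmaQ (F := fun x => TT Ω' φ x - TT Ω φ x) (A := 2 * K4 n * M)
      hΩ' hne' hloc hl2 (fun ξ hξ => hξ) (by positivity) hJ hv' (by fun_prop) b1 ?_).trans ?_
    · intro c hc x x' hx hx'
      have hmono := dd_mono hsub hne c
      have t1 := TT_lip hφ hN hM hc hx hx'
      have t2 := TT_lip (Ω := Ω) hφ hN hM (lt_of_lt_of_le hc hmono) (hx.trans (by linarith))
        (hx'.trans (by linarith))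
      have t3 : K4 n * M / dd Ω c * ‖x - x'‖ ≤ K4 n * M / dd Ω' c * ‖x - x'‖ := by gcongr
      have e : TT Ω' φ x - TT Ω φ x - (TT Ω' φ x' - TT Ω φ x') =
        (TT Ω' φ x - TT Ω' φ x') - (TT Ω φ x - TT Ω φ x') := by ring
      rw [e]
      refine (abs_sub _ _).trans ?_
      have : 2 * K4 n * M / dd Ω' c * ‖x - x'‖ = K4 n * M / dd Ω' c * ‖x - x'‖ +
        K4 n * M / dd Ω' c * ‖x - x'‖ := by ring
      linarith
    · gcongr
      have hc : IntegrableOn (fun _ : EE n => 2 * K4 n * M) Ω' := integrableOn_const hv'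
      have i1' := i1.mono_set hsub
      calc ∫ x in Ω', (2 * K4 n * M + |TT Ω' φ x - TT Ω φ x|)
          ≤ ∫ x in Ω', (2 * K4 n * M + (|φ x - TT Ω' φ x| + |φ x - TT Ω φ x|)) := by
            apply integral_mono_of_nonneg
            · refine Filter.Eventually.of_forall fun x => ?_
              simp only [Pi.zero_apply]; positivity
            · exact hc.add (i2.add i1')
            · refine Filter.Eventually.of_forall fun x => ?_
              simp only
              have : TT Ω' φ x - TT Ω φ x = (φ x - TT Ω φ x) - (φ x - TT Ω' φ x) := by ring
              rw [this]
              have := abs_sub (φ x - TT Ω φ x) (φ x - TT Ω' φ x)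
              linarith
        _ = 2 * K4 n * M * (volume Ω').toReal +
            ((∫ x in Ω', |φ x - TT Ω' φ x|) + ∫ x in Ω', |φ x - TT Ω φ x|) := by
            have i3 : IntegrableOn (fun x => |φ x - TT Ω' φ x| + |φ x - TT Ω φ x|) Ω' := i2.add i1'
            rw [integral_add hc i3, integral_add i2 i1', setIntegral_const, smul_eq_mul]
            rw [Measure.real]; ring
        _ ≤ 2 * K4 n * M * (volume Ω).toReal +
            (K5 n * M * (volume Ω).toReal + K5 n * M * (volume Ω).toReal) := by
            gcongr
            · exact I2.trans (by gcongr)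
            · refine le_trans ?_ I1
              exact setIntegral_mono_set i1 (Filter.Eventually.of_forall fun _ => abs_nonneg _)
                (Filter.Eventually.of_forall hsub)
        _ = _ := by ring
  have F2 : |∫ x in Ω \ Ω', (φ x - TT Ω φ x) * J x| ≤
      C0 * ((2 * l) / vb n) ^ τ * (K5 n * M * (volume Ω).toReal) := by
    calc |∫ x in Ω \ Ω', (φ x - TT Ω φ x) * J x|
        ≤ ∫ x in Ω \ Ω', (C0 * ((2 * l) / vb n) ^ τ) * |φ x - TT Ω φ x| := by
          rw [← Real.norm_eq_abs]
          apply norm_integral_le_of_norm_le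
          · exact (i1.mono_set Set.sdiff_subset).const_mul _
          · have hae : ∀ᵐ x : EE n, x ∉ Ω' → |J x| ≤ C0 * ((2 * l) / vb n) ^ τ := by
              filter_upwards [hJh, ae_le_of_notMem_mxSet hm hf] with x hx1 hx2 hx3
              have := hx2 (2 * l) hx3
              have h4 : ENNReal.ofReal |J x| ≤ ENNReal.ofReal (C0 * ((2 * l) / vb n) ^ τ) := by
                refine hx1.trans ?_
                rw [ENNReal.ofReal_mul hC0, ← ENNReal.ofReal_rpow_of_nonneg (by positivity)
                  (by linarith)]
                gcongr
              exact (ENNReal.ofReal_le_ofReal_iff (by positivity)).1 h4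
            rw [ae_restrict_iff' (hΩ.measurableSet.diff hΩ'.measurableSet)]
            filter_upwards [hae] with x hx hx'
            rw [norm_mul, mul_comm, Real.norm_eq_abs, Real.norm_eq_abs]
            gcongr
            exact hx hx'.2
      _ = C0 * ((2 * l) / vb n) ^ τ * ∫ x in Ω \ Ω', |φ x - TT Ω φ x| := integral_const_mul _ _
      _ ≤ _ := by
          gcongr
          refine le_trans ?_ I1
          exact setIntegral_mono_set i1 (Filter.Eventually.of_forall fun _ => abs_nonneg _)
                (Filter.Eventually.of_forall Set.sdiff_subset)
  rw [e]
  refine (abs_add_le _ _).trans ((add_le_add F1 F2).trans (le_of_eq ?_))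
  rw [Real.div_rpow (by positivity) hvb.le, Real.mul_rpow (by norm_num) hl.le]
  unfold K7
  field_simp
end

section
variable {J φ : EE n → ℝ} {h : EE n → ℝ≥0∞} {τ C0 l M N : ℝ}

lemma bottom_bound (hn : 1 ≤ n) (hm : Measurable h) (hf : ∫⁻ x, h x ≠ ∞) (hτ : 1 < τ)
    (hC0 : 0 ≤ C0) (hJ : Integrable J)
    (hJh : ∀ᵐ x, ENNReal.ofReal |J x| ≤ ENNReal.ofReal C0 * h x ^ τ)
    (hloc : LocEst J h τ C0) (hφ : Measurable φ) (hN : ∀ x, |φ x| ≤ N) (hM : BMOle φ M) :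
    ∃ D : ℝ, ∀ l, 0 < l → |∫ x, GG h φ l x * J x| ≤ D * l ^ (τ - 1) := by
  have hM0 := hM.nonneg
  have hK4 := K4_pos (n := n)
  have hK6 := K6_pos (n := n) (τ := τ)
  have hvb := vb_pos (n := n)
  have hN0 : 0 ≤ N := (abs_nonneg _).trans (hN 0)
  set H := (∫⁻ x, h x).toReal with hH
  have hH0 : 0 ≤ H := ENNReal.toReal_nonneg
  refine ⟨C0 * K6 n τ * ((K4 n * M + N) * (2 * 5 ^ n * vb n * H)) +
    N * (C0 * ((vb n)⁻¹) ^ (τ - 1) * H), fun l hl => ?_⟩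
  have hΩ : IsOpen (mxSet h l) := isOpen_mxSet h l
  have hvle := mxSet_vol_lt_top hn hm hf hl
  have htop := ENNReal.mul_ne_top (ENNReal.ofReal_ne_top (r := 2 * 5 ^ n * vb n / l)) hf
  have hv : volume (mxSet h l) ≠ ∞ := ne_top_of_le_ne_top htop hvle
  have hvr : (volume (mxSet h l)).toReal ≤ 2 * 5 ^ n * vb n / l * H := by
    have := ENNReal.toReal_mono htop hvle
    rwa [ENNReal.toReal_mul, ENNReal.toReal_ofReal (by positivity)] at this
  have hne := compl_nonempty hn hv
  have hG : Integrable (fun x => GG h φ l x * J x) :=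
    hJ.bdd_mul (c := N) (measurable_GG hφ).aestronglyMeasurable
      (Filter.Eventually.of_forall (GG_bdd hφ hN))
  rw [← integral_add_compl hΩ.measurableSet hG]
  have F1 : |∫ x in mxSet h l, GG h φ l x * J x| ≤
      C0 * K6 n τ * l ^ τ * ((K4 n * M + N) * (volume (mxSet h l)).toReal) := by
    have : ∫ x in mxSet h l, GG h φ l x * J x = ∫ x in mxSet h l, TT (mxSet h l) φ x * J x := by
      apply setIntegral_congr_fun hΩ.measurableSet
      intro x hx
      simp [GG, hx]
    rw [this]
    refine (lemmaQ (A := K4 n * M) hΩ hne hloc hl (fun ξ hξ => hξ) (by positivity) hJ hv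
      (measurable_TT hφ) (TT_bdd hφ hN) ?_).trans ?_
    · intro c hc x x' hx hx'
      exact TT_lip hφ hN hM hc hx hx'
    · gcongr
      calc ∫ x in mxSet h l, (K4 n * M + |TT (mxSet h l) φ x|)
          ≤ ∫ x in mxSet h l, (K4 n * M + N) := by
            apply integral_mono_of_nonneg
            · refine Filter.Eventually.of_forall fun x => ?_
              simp only [Pi.zero_apply]; positivity
            · exact integrableOn_const hv
            · refine Filter.Eventually.of_forall fun x => ?_
              simp only
              gcongr
              exact TT_bdd hφ hN x
        _ = _ := by rw [setIntegral_const, smul_eq_mul, Measure.real]; ring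
  have hInt : Integrable (fun x => (h x).toReal) :=
    integrable_toReal_of_lintegral_ne_top hm.aemeasurable hf
  have F2 : |∫ x in (mxSet h l)ᶜ, GG h φ l x * J x| ≤
      N * (C0 * (l / vb n) ^ (τ - 1) * H) := by
    calc |∫ x in (mxSet h l)ᶜ, GG h φ l x * J x|
        ≤ ∫ x in (mxSet h l)ᶜ, N * (C0 * (l / vb n) ^ (τ - 1) * (h x).toReal) := by
          rw [← Real.norm_eq_abs]
          apply norm_integral_le_of_norm_le
          · exact ((hInt.const_mul _).const_mul _).integrableOn
          · rw [ae_restrict_iff' hΩ.measurableSet.compl]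
            filter_upwards [hJh, ae_le_of_notMem_mxSet hm hf, ae_lt_top hm hf] with x hx1 hx2 hx4 hx3
            have h5 := hx2 l hx3
            have h4 : ENNReal.ofReal |J x| ≤ ENNReal.ofReal (C0 * (l / vb n) ^ (τ - 1)) * h x := by
              refine hx1.trans ?_
              have e : h x ^ τ = h x ^ (τ - 1) * h x := by
                conv_rhs => rw [← ENNReal.rpow_one (h x), ← ENNReal.rpow_mul, one_mul]
                rw [← ENNReal.rpow_add_of_nonneg _ _ (by linarith) zero_le_one]
                congr 1; ring
              rw [ENNReal.ofReal_mul hC0, ← ENNReal.ofReal_rpow_of_nonneg (by positivity)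
                (by linarith), e, mul_assoc]
              gcongr
            have h6 := ENNReal.toReal_mono (ENNReal.mul_ne_top ENNReal.ofReal_ne_top hx4.ne) h4
            rw [ENNReal.toReal_ofReal (abs_nonneg _), ENNReal.toReal_mul,
              ENNReal.toReal_ofReal (by positivity)] at h6
            rw [norm_mul]
            gcongr
            · exact GG_bdd hφ hN x
            · exact h6
      _ = N * (C0 * (l / vb n) ^ (τ - 1) * ∫ x in (mxSet h l)ᶜ, (h x).toReal) := by
          rw [integral_const_mul, integral_const_mul]
      _ ≤ _ := by
          gcongr
          rw [hH, ← integral_toReal hm.aemeasurable (ae_lt_top hm hf)]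
          exact setIntegral_le_integral hInt (Filter.Eventually.of_forall fun _ => ENNReal.toReal_nonneg)
  refine (abs_add_le _ _).trans ((add_le_add F1 F2).trans ?_)
  have e1 : l ^ τ = l ^ (τ - 1) * l := by
    rw [← Real.rpow_add_one hl.ne']; congr 1; ring
  calc C0 * K6 n τ * l ^ τ * ((K4 n * M + N) * (volume (mxSet h l)).toReal) +
      N * (C0 * (l / vb n) ^ (τ - 1) * H) ≤
      C0 * K6 n τ * l ^ τ * ((K4 n * M + N) * (2 * 5 ^ n * vb n / l * H)) +
      N * (C0 * (l / vb n) ^ (τ - 1) * H) := by gcongr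
    _ = _ := by
      rw [e1, div_eq_mul_inv l, Real.mul_rpow hl.le (by positivity)]
      field_simp

lemma top_lim (hn : 1 ≤ n) (hm : Measurable h) (hf : ∫⁻ x, h x ≠ ∞) (hJ : Integrable J)
    (hφ : Measurable φ) (hN : ∀ x, |φ x| ≤ N) {a : ℝ} (ha : 0 < a) :
    Filter.Tendsto (fun m : ℕ => ∫ x, GG h φ (a * 2 ^ m) x * J x) Filter.atTop
      (nhds (∫ x, φ x * J x)) := by
  have hN0 : 0 ≤ N := (abs_nonneg _).trans (hN 0)
  have hvol : Filter.Tendsto (volume ∘ fun m : ℕ => mxSet h (a * 2 ^ m)) Filter.atTop (nhds 0) := by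
    refine tendsto_of_tendsto_of_tendsto_of_le_of_le tendsto_const_nhds ?_ (fun _ => bot_le)
      (fun m => mxSet_vol_lt_top hn hm hf (by positivity))
    rw [← zero_mul (∫⁻ x, h x)]
    apply ENNReal.Tendsto.mul_const _ (Or.inr hf)
    rw [← ENNReal.ofReal_zero]
    apply ENNReal.tendsto_ofReal
    apply Filter.Tendsto.const_div_atTop
    exact (tendsto_pow_atTop_atTop_of_one_lt (by norm_num : (1:ℝ) < 2)).const_mul_atTop ha
  have h1 := hJ.abs.tendsto_setIntegral_nhds_zero hvol
  have h2 : Filter.Tendsto (fun m : ℕ => 2 * N * ∫ x in mxSet h (a * 2 ^ m), |J x|) Filter.atTop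
      (nhds 0) := by simpa using h1.const_mul (2 * N)
  rw [tendsto_iff_norm_sub_tendsto_zero]
  refine squeeze_zero (fun _ => norm_nonneg _) (fun m => ?_) h2
  have hG : Integrable (fun x => GG h φ (a * 2 ^ m) x * J x) :=
    hJ.bdd_mul (c := N) (measurable_GG hφ).aestronglyMeasurable
      (Filter.Eventually.of_forall (GG_bdd hφ hN))
  have hG' : Integrable (fun x => φ x * J x) :=
    hJ.bdd_mul (c := N) hφ.aestronglyMeasurable (Filter.Eventually.of_forall hN)
  rw [← integral_sub hG hG', ← integral_const_mul,
    ← integral_indicator (isOpen_mxSet h _).measurableSet]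
  apply norm_integral_le_of_norm_le
  · exact (hJ.abs.const_mul _).indicator (isOpen_mxSet h _).measurableSet
  · refine Filter.Eventually.of_forall fun x => ?_
    by_cases hx : x ∈ mxSet h (a * 2 ^ m)
    · rw [Set.indicator_of_mem hx, ← sub_mul, norm_mul]
      have : ‖GG h φ (a * 2 ^ m) x - φ x‖ ≤ 2 * N := by
        refine (abs_sub _ _).trans ?_
        linarith [GG_bdd (h := h) (l := a * 2 ^ m) hφ hN x, hN x]
      gcongr
      exact le_rfl
    · rw [Set.indicator_of_notMem hx]
      simp [GG, hx]
end

/-- abstract duality, bounded `φ` -/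
lemma duality_bdd (hn : 1 ≤ n) {τ : ℝ} (hτ : 1 < τ) : ∃ C : ℝ, 0 < C ∧
    ∀ (J : EE n → ℝ) (h : EE n → ℝ≥0∞) (C0 : ℝ), Measurable h → ∫⁻ x, h x ≠ ∞ →
    ∫⁻ x, h x ^ τ ≠ ∞ → 0 ≤ C0 → Integrable J →
    (∀ᵐ x, ENNReal.ofReal |J x| ≤ ENNReal.ofReal C0 * h x ^ τ) → LocEst J h τ C0 →
    ∀ (φ : EE n → ℝ) (M N : ℝ), Measurable φ → (∀ x, |φ x| ≤ N) → BMOle φ M →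
    |∫ x, φ x * J x| ≤ C * C0 * M * (∫⁻ x, h x ^ τ).toReal := by
  obtain ⟨C2, hC2, hsum⟩ := mxSet_sum hn hτ
  have hK7 := K7_pos (n := n) (τ := τ)
  refine ⟨K7 n τ * C2, by positivity, ?_⟩
  intro J h C0 hm hf hfτ hC0 hJ hJh hloc φ M N hφ hN hM
  have hM0 := hM.nonneg
  obtain ⟨D, hD⟩ := bottom_bound hn hm hf hτ hC0 hJ hJh hloc hφ hN hM
  have key : ∀ a : ℝ, 0 < a → |∫ x, φ x * J x| ≤ D * a ^ (τ - 1) +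
      K7 n τ * C2 * C0 * M * (∫⁻ x, h x ^ τ).toReal := by
    intro a ha
    have hk : ∀ m : ℕ, |∫ x, GG h φ (a * 2 ^ m) x * J x| ≤ D * a ^ (τ - 1) +
        ∑ j ∈ Finset.range m, C0 * K7 n τ * M * ((a * 2 ^ j) ^ τ *
          (volume (mxSet h (a * 2 ^ j))).toReal) := by
      intro m
      induction m with
      | zero => simpa using hD a ha
      | succ m ih =>
        have := step_bound (l := a * 2 ^ m) hn hm hf hτ hC0 hJ hJh hloc hφ hN hM (by positivity)
        have e : a * 2 ^ (m + 1) = 2 * (a * 2 ^ m) := by ring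
        rw [Finset.sum_range_succ, e]
        have h2 := abs_sub_abs_le_abs_sub (∫ x, GG h φ (2 * (a * 2 ^ m)) x * J x)
          (∫ x, GG h φ (a * 2 ^ m) x * J x)
        linarith
    have hs : ∀ m : ℕ, ∑ j ∈ Finset.range m, C0 * K7 n τ * M * ((a * 2 ^ j) ^ τ *
          (volume (mxSet h (a * 2 ^ j))).toReal) ≤ K7 n τ * C2 * C0 * M * (∫⁻ x, h x ^ τ).toReal := by
      intro m
      have h1 := ENNReal.toReal_mono (ENNReal.mul_ne_top ENNReal.ofReal_ne_top hfτ)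
        (hsum hm hf a ha m)
      rw [ENNReal.toReal_sum, ENNReal.toReal_mul, ENNReal.toReal_ofReal hC2.le] at h1
      · have h2 : ∑ j ∈ Finset.range m, (ENNReal.ofReal ((a * 2 ^ j) ^ τ) *
            volume (mxSet h (a * 2 ^ j))).toReal = ∑ j ∈ Finset.range m, ((a * 2 ^ j) ^ τ *
            (volume (mxSet h (a * 2 ^ j))).toReal) := by
          apply Finset.sum_congr rfl
          intro j _
          rw [ENNReal.toReal_mul, ENNReal.toReal_ofReal (by positivity)]
        rw [h2] at h1
        rw [← Finset.mul_sum]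
        calc _ ≤ C0 * K7 n τ * M * (C2 * (∫⁻ x, h x ^ τ).toReal) := by gcongr
          _ = _ := by ring
      · intro j _
        exact ENNReal.mul_ne_top ENNReal.ofReal_ne_top (ne_top_of_le_ne_top
          (ENNReal.mul_ne_top ENNReal.ofReal_ne_top hf) (mxSet_vol_lt_top hn hm hf (by positivity)))
    refine le_of_tendsto (top_lim hn hm hf hJ hφ hN ha).abs (Filter.Eventually.of_forall fun m => ?_)
    have := hk m; have := hs m
    linarith
  have hlim : Filter.Tendsto (fun a : ℝ => D * a ^ (τ - 1) +
      K7 n τ * C2 * C0 * M * (∫⁻ x, h x ^ τ).toReal) (nhdsWithin 0 (Set.Ioi 0))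
      (nhds (D * 0 ^ (τ - 1) + K7 n τ * C2 * C0 * M * (∫⁻ x, h x ^ τ).toReal)) := by
    apply Filter.Tendsto.add_const
    apply Filter.Tendsto.const_mul
    exact ((Real.continuousAt_rpow_const 0 (τ - 1) (Or.inr (by linarith))).tendsto).mono_left
      nhdsWithin_le_nhds
  rw [Real.zero_rpow (by linarith), mul_zero, zero_add] at hlim
  refine ge_of_tendsto hlim ?_
  filter_upwards [self_mem_nhdsWithin] with a ha
  exact key a ha

/-- truncation -/
def trunc (N t : ℝ) : ℝ := max (min t N) (-N)

lemma trunc_bdd {N : ℝ} (hN : 0 ≤ N) (t : ℝ) : |trunc N t| ≤ N := by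
  unfold trunc
  rw [abs_le]
  exact ⟨le_max_right _ _, max_le (min_le_right _ _) (by linarith)⟩

lemma trunc_lip (N s t : ℝ) : |trunc N s - trunc N t| ≤ |s - t| := by
  unfold trunc
  refine (abs_max_sub_max_le_abs _ _ _).trans ?_
  exact abs_min_sub_min_le_max _ _ _ _ |>.trans (by simp)

lemma trunc_abs_le {N : ℝ} (hN : 0 ≤ N) (t : ℝ) : |trunc N t| ≤ |t| := by
  have := trunc_lip N t 0
  have h0 : trunc N 0 = 0 := by unfold trunc; simp [hN]
  simpa [h0] using this

lemma trunc_eq {N t : ℝ} (h : |t| ≤ N) : trunc N t = t := by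
  have := abs_le.1 h
  unfold trunc
  rw [min_eq_left this.2, max_eq_left this.1]

lemma duality (hn : 1 ≤ n) {τ : ℝ} (hτ : 1 < τ) : ∃ C : ℝ, 0 < C ∧
    ∀ (J : EE n → ℝ) (h : EE n → ℝ≥0∞) (C0 : ℝ), Measurable h → ∫⁻ x, h x ≠ ∞ →
    ∫⁻ x, h x ^ τ ≠ ∞ → 0 ≤ C0 → Integrable J →
    (∀ᵐ x, ENNReal.ofReal |J x| ≤ ENNReal.ofReal C0 * h x ^ τ) → LocEst J h τ C0 →
    ∀ (φ : EE n → ℝ) (M : ℝ), LocallyIntegrable φ volume →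
    (∀ (x : EE n) (r : ℝ), 0 < r →
      ⨍ y in ball x r, |φ y - ⨍ z in ball x r, φ z| ≤ M) →
    Integrable (fun x => φ x * J x) →
    |∫ x, φ x * J x| ≤ C * C0 * M * (∫⁻ x, h x ^ τ).toReal := by
  obtain ⟨C, hC, hmain⟩ := duality_bdd hn hτ
  refine ⟨C * 2, by positivity, ?_⟩
  intro J h C0 hm hf hfτ hC0 hJ hJh hloc φ M hφ hM hφJ
  have hvb := vb_pos (n := n)
  set ψ := hφ.aestronglyMeasurable.mk φ with hψ
  have hψm : Measurable ψ := hφ.aestronglyMeasurable.stronglyMeasurable_mk.measurable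
  have hae : φ =ᵐ[volume] ψ := hφ.aestronglyMeasurable.ae_eq_mk
  have htm : ∀ N, Measurable (trunc N) := fun N => by unfold trunc; fun_prop
  have hbmo : ∀ N : ℝ, 0 ≤ N → BMOle (fun x => trunc N (ψ x)) (2 * M) := by
    intro N hN x r hr
    set m := ⨍ z in ball x r, φ z with hmdef
    have hmeas0 : volume (ball x r) ≠ 0 := (measure_ball_pos volume x hr).ne'
    have hreal : volume.real (ball x r) = r ^ n * vb n := by
      rw [Measure.real, vol_ball x hr, ENNReal.toReal_ofReal (by positivity)]
    have hφi : IntegrableOn φ (ball x r) := hφ.integrableOn_isCompact (isCompact_closedBall x r)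
      |>.mono_set ball_subset_closedBall
    have hosc : ∫ y in ball x r, |φ y - m| ≤ M * (r ^ n * vb n) := by
      have := hM x r hr
      rw [setAverage_eq, hreal, smul_eq_mul, inv_mul_le_iff₀ (by positivity)] at this
      linarith
    have hti : IntegrableOn (fun y => trunc N (ψ y)) (ball x r) := by
      apply integrable_bdd_ball ((htm N).comp hψm) (fun y => trunc_bdd hN _)
    have hci : ∀ c : ℝ, Integrable (fun _ : EE n => c) (volume.restrict (ball x r)) :=
      fun c => integrableOn_const measure_ball_lt_top.ne
    have hdi : IntegrableOn (fun y => |φ y - m|) (ball x r) :=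
      (hφi.sub (integrableOn_const measure_ball_lt_top.ne)).abs
    have hdi2 : IntegrableOn (fun y => |trunc N (ψ y) - trunc N m|) (ball x r) :=
      (hti.sub (integrableOn_const measure_ball_lt_top.ne)).abs
    have h1 : ∫ y in ball x r, |trunc N (ψ y) - trunc N m| ≤ M * (r ^ n * vb n) := by
      refine le_trans (integral_mono_ae hdi2 hdi ?_) hosc
      filter_upwards [ae_restrict_of_ae hae] with y hy
      rw [← hy]
      exact trunc_lip _ _ _
    set m' := ⨍ z in ball x r, trunc N (ψ z) with hm'
    have h2 : |trunc N m - m'| * (r ^ n * vb n) ≤ M * (r ^ n * vb n) := by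
      refine le_trans ?_ h1
      have : (trunc N m - m') * (r ^ n * vb n) = ∫ y in ball x r, (trunc N m - trunc N (ψ y)) := by
        rw [integral_sub (hci _) hti, setIntegral_const, hreal,
          hm', setAverage_eq, hreal, smul_eq_mul, smul_eq_mul]
        field_simp
      rw [← abs_of_pos (by positivity : 0 < r ^ n * vb n), ← abs_mul, this]
      refine (abs_integral_le_integral_abs).trans (le_of_eq ?_)
      congr 1; ext y; rw [abs_sub_comm]
    calc ∫ y in ball x r, |trunc N (ψ y) - m'|
        ≤ ∫ y in ball x r, (|trunc N (ψ y) - trunc N m| + |trunc N m - m'|) := by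
          apply integral_mono_of_nonneg (Filter.Eventually.of_forall fun _ => abs_nonneg _)
          · exact hdi2.add (integrableOn_const measure_ball_lt_top.ne)
          · exact Filter.Eventually.of_forall fun y => abs_sub_le _ _ _
      _ = (∫ y in ball x r, |trunc N (ψ y) - trunc N m|) + |trunc N m - m'| * (r ^ n * vb n) := by
          rw [integral_add hdi2 (hci _), setIntegral_const, hreal,
            smul_eq_mul, mul_comm |_|]
      _ ≤ _ := by linarith
  have hb : ∀ N : ℕ, |∫ x, trunc N (ψ x) * J x| ≤ C * 2 * C0 * M * (∫⁻ x, h x ^ τ).toReal := by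
    intro N
    have := hmain J h C0 hm hf hfτ hC0 hJ hJh hloc (fun x => trunc N (ψ x)) (2 * M) N
      ((htm N).comp hψm) (fun y => trunc_bdd (Nat.cast_nonneg N) _) (hbmo N (Nat.cast_nonneg N))
    refine this.trans (le_of_eq (by ring))
  have hψJ : Integrable (fun x => ψ x * J x) := by
    refine hφJ.congr ?_
    filter_upwards [hae] with x hx
    rw [hx]
  have hlim : Filter.Tendsto (fun N : ℕ => ∫ x, trunc N (ψ x) * J x) Filter.atTop
      (nhds (∫ x, ψ x * J x)) := by
    apply tendsto_integral_of_dominated_convergence (fun x => ‖ψ x * J x‖)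
    · intro N
      exact ((htm N).comp hψm).aestronglyMeasurable.mul hJ.aestronglyMeasurable
    · exact hψJ.norm
    · intro N
      refine Filter.Eventually.of_forall fun x => ?_
      rw [norm_mul, norm_mul]
      gcongr
      exact trunc_abs_le (Nat.cast_nonneg N) _
    · refine Filter.Eventually.of_forall fun x => ?_
      apply tendsto_const_nhds.congr'
      filter_upwards [Filter.eventually_ge_atTop ⌈|ψ x|⌉₊] with N hN
      rw [trunc_eq]
      exact (Nat.le_ceil _).trans (by exact_mod_cast hN)
  have e : ∫ x, φ x * J x = ∫ x, ψ x * J x := by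
    apply integral_congr_ae
    filter_upwards [hae] with x hx
    rw [hx]
  rw [e]
  exact le_of_tendsto hlim.abs (Filter.Eventually.of_forall hb)

/-- matrix of a continuous linear endomorphism -/
def clmMat (A : EE n →L[ℝ] EE n) : Matrix (Fin n) (Fin n) ℝ :=
  fun i j => A (EuclideanSpace.single j 1) i

lemma clmMat_add (A B : EE n →L[ℝ] EE n) : clmMat (A + B) = clmMat A + clmMat B := by
  ext i j; simp [clmMat]

lemma clmMat_smul (c : ℝ) (A : EE n →L[ℝ] EE n) : clmMat (c • A) = c • clmMat A := by
  ext i j; simp [clmMat]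

lemma clmMat_one : clmMat (ContinuousLinearMap.id ℝ (EE n)) = 1 := by
  ext i j; simp [clmMat, Matrix.one_apply]

lemma det_clmMat (A : EE n →L[ℝ] EE n) : A.det = (clmMat A).det := by
  rw [ContinuousLinearMap.det, ← LinearMap.det_toMatrix (EuclideanSpace.basisFun (Fin n) ℝ).toBasis]
  congr 1

lemma continuous_det_clm : Continuous (fun A : EE n →L[ℝ] EE n => A.det) := by
  simp_rw [det_clmMat]
  apply Continuous.matrix_det
  refine continuous_pi fun i => continuous_pi fun j => ?_
  simp only [clmMat]
  have : Continuous (fun A : EE n →L[ℝ] EE n => A (EuclideanSpace.single j 1)) := by fun_prop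
  fun_prop

lemma jacDet_eq (f : EE n → EE n) (x : EE n) : jacDet f x = (fderiv ℝ f x).det := by
  rw [det_clmMat]; rfl

lemma det_lagrange (t0 : ℝ) (ht0 : 0 < t0) : ∃ (w t : ℕ → ℝ), (∀ k, 0 < t k ∧ t k ≤ t0) ∧
    ∀ A : Matrix (Fin n) (Fin n) ℝ, A.det = ∑ k ∈ Finset.range (n+1), w k * (1 + t k • A).det := by
  have hinj : Function.Injective (fun k : ℕ => t0 / ((k:ℝ) + 1)) := by
    intro a b hab
    simp only at hab
    have h1 : (a:ℝ) + 1 ≠ 0 := by positivity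
    have h2 : (b:ℝ) + 1 ≠ 0 := by positivity
    field_simp at hab
    exact_mod_cast (by linarith : (a:ℝ) = b)
  set t : ℕ → ℝ := fun k => t0 / ((k:ℝ) + 1) with ht
  refine ⟨fun k => (∏ j ∈ (Finset.range (n+1)).erase k, (t k - t j))⁻¹, t, fun k => ⟨by simp only [ht]; positivity, ?_⟩, fun A => ?_⟩
  · simp only [ht]
    exact div_le_self ht0.le (by linarith [Nat.cast_nonneg (α := ℝ) k])
  · have h1 := Polynomial.natDegree_det_X_add_C_le A (1 : Matrix (Fin n) (Fin n) ℝ)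
    have h2 := Polynomial.coeff_det_X_add_C_card A (1 : Matrix (Fin n) (Fin n) ℝ)
    rw [Fintype.card_fin] at h1 h2
    set P := ((Polynomial.X : Polynomial ℝ) • A.map Polynomial.C + (1 : Matrix (Fin n) (Fin n) ℝ).map Polynomial.C).det with hP
    have h3 := Lagrange.coeff_eq_sum (s := Finset.range (n+1)) (v := t) (hinj.injOn) (P := P) (by
      rw [Finset.card_range]
      refine lt_of_le_of_lt Polynomial.degree_le_natDegree ?_
      exact_mod_cast Nat.lt_succ_of_le h1)
    rw [Finset.card_range, Nat.add_sub_cancel, h2] at h3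
    rw [h3]
    refine Finset.sum_congr rfl fun k _ => ?_
    have : P.eval (t k) = (1 + t k • A).det := by
      rw [hP, ← Polynomial.coe_evalRingHom, RingHom.map_det]
      congr 1
      ext i j
      simp [Matrix.one_apply]
      split_ifs <;> simp <;> ring
    rw [this]; ring

lemma null_lagr (hn : 1 ≤ n) {H : EE n → EE n} (hH : ContDiff ℝ 1 H) (hc : HasCompactSupport H) :
    ∫ x, (fderiv ℝ H x).det = 0 := by
  have hDc : Continuous (fderiv ℝ H) := hH.continuous_fderiv (by norm_num)
  have hDs : HasCompactSupport (fderiv ℝ H) := hc.fderiv ℝ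
  obtain ⟨K, hK⟩ := hDs.exists_bound_of_continuous hDc
  have hHd : Differentiable ℝ H := hH.differentiable (by norm_num)
  have hK0 : 0 ≤ K := (norm_nonneg _).trans (hK 0)
  have hlip : ∀ x y, ‖H x - H y‖ ≤ K * ‖x - y‖ := fun x y =>
    Convex.norm_image_sub_le_of_norm_fderiv_le (fun z _ => hHd z) (fun z _ => hK z) convex_univ (Set.mem_univ _) (Set.mem_univ _)
  -- determinant positivity
  have hdet1 : ∃ ε > 0, ∀ A : EE n →L[ℝ] EE n, ‖A‖ < ε → 0 < (ContinuousLinearMap.id ℝ (EE n) + A).det := by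
    have hcont : Continuous (fun A : EE n →L[ℝ] EE n => (ContinuousLinearMap.id ℝ (EE n) + A).det) :=
      continuous_det_clm.comp (continuous_const.add continuous_id)
    have h0 : (0:ℝ) < (ContinuousLinearMap.id ℝ (EE n) + 0).det := by
      rw [add_zero, det_clmMat, clmMat_one, Matrix.det_one]; norm_num
    have := (hcont.tendsto 0).eventually (lt_mem_nhds h0)
    obtain ⟨ε, hε, h⟩ := Metric.eventually_nhds_iff.1 this
    exact ⟨ε, hε, fun A hA => h (by simpa [dist_zero_right] using hA)⟩
  obtain ⟨ε, hε, hdet⟩ := hdet1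
  obtain ⟨R, hR0, hR⟩ := hc.isCompact.isBounded.subset_ball_lt 0 0
  set B : Set (EE n) := ball 0 R with hB
  have hout : ∀ x, x ∉ B → H x = 0 := fun x hx => by
    by_contra h
    exact hx (hR (subset_tsupport _ h))
  have hnt : Nontrivial (EE n) := by
    have : Nonempty (Fin n) := ⟨⟨0, hn⟩⟩
    infer_instance
  -- volume preservation
  have key : ∀ t : ℝ, 0 < t → t * K < 1/2 → t * K < ε →
      ∫ x in B, (ContinuousLinearMap.id ℝ (EE n) + t • fderiv ℝ H x).det = volume.real B := by
    intro t ht h1 h2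
    set Φ : EE n → EE n := fun x => x + t • H x with hΦ
    have hd : ∀ x, HasFDerivAt Φ (ContinuousLinearMap.id ℝ (EE n) + t • fderiv ℝ H x) x := fun x =>
      (hasFDerivAt_id x).add ((hHd x).hasFDerivAt.const_smul t)
    have happ : ApproximatesLinearOn Φ ((ContinuousLinearEquiv.refl ℝ (EE n) : EE n ≃L[ℝ] EE n) : EE n →L[ℝ] EE n) Set.univ (1/2) := by
      intro x _ y _
      have : Φ x - Φ y - ((ContinuousLinearEquiv.refl ℝ (EE n) : EE n ≃L[ℝ] EE n) : EE n →L[ℝ] EE n) (x - y) = t • (H x - H y) := by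
        simp [hΦ, smul_sub]; abel
      rw [this, norm_smul, Real.norm_eq_abs, abs_of_pos ht]
      calc t * ‖H x - H y‖ ≤ t * (K * ‖x - y‖) := by gcongr; exact hlip x y
        _ = (t*K) * ‖x-y‖ := by ring
        _ ≤ (1/2) * ‖x-y‖ := by gcongr
        _ = _ := by norm_num
    have hN : Subsingleton (EE n) ∨ (1/2 : NNReal) < ‖((ContinuousLinearEquiv.refl ℝ (EE n)).symm : EE n →L[ℝ] EE n)‖₊⁻¹ := by
      right
      have : ‖((ContinuousLinearEquiv.refl ℝ (EE n)).symm : EE n →L[ℝ] EE n)‖₊ = 1 := by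
        have : ((ContinuousLinearEquiv.refl ℝ (EE n)).symm : EE n →L[ℝ] EE n) = ContinuousLinearMap.id ℝ (EE n) := by
          ext; simp
        rw [this]; ext; exact ContinuousLinearMap.norm_id
      rw [this, inv_one]
      rw [← NNReal.coe_lt_coe]; norm_num
    have hinj : Function.Injective Φ := Set.injOn_univ.1 (happ.injOn hN)
    have hsurj : Function.Surjective Φ := happ.surjective hN
    have hfix : ∀ x, x ∉ B → Φ x = x := fun x hx => by simp [hΦ, hout x hx]
    have himg : Φ '' B = B := by
      apply Set.Subset.antisymm
      · rintro _ ⟨x, hx, rfl⟩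
        by_contra h
        have : Φ (Φ x) = Φ x := hfix _ h
        exact h (by rw [hinj this]; exact hx)
      · intro y hy
        obtain ⟨x, rfl⟩ := hsurj y
        refine ⟨x, ?_, rfl⟩
        by_contra h
        rw [hfix x h] at hy
        exact h hy
    have := integral_image_eq_integral_abs_det_fderiv_smul (volume : Measure (EE n)) (s := B) measurableSet_ball
      (fun x _ => (hd x).hasFDerivWithinAt) hinj.injOn (fun _ => (1:ℝ))
    rw [himg] at this
    simp only [smul_eq_mul, mul_one, integral_const, measureReal_restrict_apply_univ] at this
    rw [this]
    refine integral_congr_ae (Filter.Eventually.of_forall fun x => ?_)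
    simp only
    rw [abs_of_pos]
    apply hdet
    rw [norm_smul, Real.norm_eq_abs, abs_of_pos ht]
    exact lt_of_le_of_lt (by gcongr; exact hK x) h2
  obtain ⟨t0, ht0, ht1, ht2⟩ : ∃ t0 : ℝ, 0 < t0 ∧ t0 * K < 1/2 ∧ t0 * K < ε := by
    refine ⟨min (1/2) ε / (2 * (K+1)), by positivity, ?_, ?_⟩
    · rw [div_mul_eq_mul_div, div_lt_iff₀ (by positivity)]
      have : min (1/2) ε ≤ 1/2 := min_le_left _ _
      nlinarith
    · rw [div_mul_eq_mul_div, div_lt_iff₀ (by positivity)]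
      have : min (1/2) ε ≤ ε := min_le_right _ _
      nlinarith
  obtain ⟨w, t, htk, hw⟩ := det_lagrange (n := n) t0 ht0
  have hw0 : ∑ k ∈ Finset.range (n+1), w k = 0 := by
    have h00 := hw 0
    have : Nonempty (Fin n) := ⟨⟨0, hn⟩⟩
    simpa using h00.symm
  have hkey : ∀ k, ∫ x in B, (ContinuousLinearMap.id ℝ (EE n) + t k • fderiv ℝ H x).det = volume.real B := fun k =>
    key _ (htk k).1 (lt_of_le_of_lt (by gcongr; exact (htk k).2) ht1) (lt_of_le_of_lt (by gcongr; exact (htk k).2) ht2)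
  have hsupp : ∫ x, (fderiv ℝ H x).det = ∫ x in B, (fderiv ℝ H x).det := by
    rw [setIntegral_eq_integral_of_forall_compl_eq_zero]
    intro x hx
    have hz : fderiv ℝ H x = 0 := by
      by_contra h
      exact hx (hR (tsupport_fderiv_subset ℝ (subset_tsupport _ h)))
    rw [hz, det_clmMat]
    have : Nonempty (Fin n) := ⟨⟨0, hn⟩⟩
    have : clmMat (0 : EE n →L[ℝ] EE n) = 0 := by ext; simp [clmMat]
    rw [this, Matrix.det_zero]
  rw [hsupp]
  have hpt : ∀ x, (fderiv ℝ H x).det = ∑ k ∈ Finset.range (n+1), w k * (ContinuousLinearMap.id ℝ (EE n) + t k • fderiv ℝ H x).det := by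
    intro x
    simp_rw [det_clmMat, clmMat_add, clmMat_smul, clmMat_one]
    exact hw _
  simp_rw [hpt]
  rw [integral_finsetSum]
  · simp_rw [integral_const_mul, hkey]
    rw [← Finset.sum_mul, hw0, zero_mul]
  · intro k _
    apply Integrable.const_mul
    have : Continuous (fun x => (ContinuousLinearMap.id ℝ (EE n) + t k • fderiv ℝ H x).det) :=
      continuous_det_clm.comp (continuous_const.add (show Continuous fun x => t k • fderiv ℝ H x from hDc.const_smul (t k)))
    exact (this.continuousOn.integrableOn_compact (isCompact_closedBall 0 R)).mono_set ball_subset_closedBall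

/-- the `i`-th row of the cofactor matrix, as a vector field -/
def Cf (f : EE n → EE n) (i : Fin n) (x : EE n) : EE n :=
  WithLp.toLp 2 (fun j => adjugate (diffMatrix f x) j i)

lemma clm_expand (L : EE n →L[ℝ] ℝ) (v : EE n) : L v = ∑ j, v j * L (EuclideanSpace.single j 1) := by
  have : v = ∑ j, v j • EuclideanSpace.single j (1:ℝ) := by
    ext k
    simp [Pi.single_apply]
  conv_lhs => rw [this]
  simp only [map_sum, map_smul, smul_eq_mul]

lemma fderiv_coord {f : EE n → EE n} {x : EE n} (hf : DifferentiableAt ℝ f x) (v : EE n) (l : Fin n) :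
    fderiv ℝ f x v l = fderiv ℝ (fun y => f y l) x v := by
  have := ((EuclideanSpace.proj l : EE n →L[ℝ] ℝ).hasFDerivAt (x := f x)).comp x hf.hasFDerivAt
  have h2 : fderiv ℝ (fun y => f y l) x = (EuclideanSpace.proj l : EE n →L[ℝ] ℝ).comp (fderiv ℝ f x) := this.fderiv
  rw [h2]
  simp

lemma det_updateRow_adj (A : Matrix (Fin n) (Fin n) ℝ) (i : Fin n) (b : Fin n → ℝ) :
    (A.updateRow i b).det = ∑ j, A.adjugate j i * b j := by
  rw [← Matrix.cramer_transpose_apply, Matrix.cramer_eq_adjugate_mulVec, ← Matrix.adjugate_transpose]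
  rfl

lemma fderiv_Cf_eq (f : EE n → EE n) (η : EE n → ℝ) (i : Fin n) (x : EE n) :
    fderiv ℝ η x (Cf f i x) = ((diffMatrix f x).updateRow i (fun j => fderiv ℝ η x (EuclideanSpace.single j 1))).det := by
  rw [det_updateRow_adj, clm_expand]
  rfl

lemma smooth_divfree (hn : 1 ≤ n) {F : EE n → EE n} (hF : ContDiff ℝ 1 F) {η : EE n → ℝ}
    (hη : ContDiff ℝ 1 η) (hc : HasCompactSupport η) (i : Fin n) :
    ∫ x, fderiv ℝ η x (Cf F i x) = 0 := by
  obtain ⟨R, hR0, hR⟩ := hc.isCompact.isBounded.subset_ball_lt 0 0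
  let χ : ContDiffBump (0 : EE n) := ⟨R, R+1, hR0, by linarith⟩
  set H : EE n → EE n := fun x => WithLp.toLp 2 (fun l => if l = i then η x else χ x * F x l) with hH
  have hFl : ∀ l, ContDiff ℝ 1 (fun x => F x l) := fun l => contDiff_euclidean.1 hF l
  have hHl : ∀ l, ContDiff ℝ 1 (fun x => H x l) := by
    intro l
    by_cases h : l = i
    · simpa [hH, h] using hη
    · simp only [hH, h, if_false]
      exact (χ.contDiff).mul (hFl l)
  have hHd : ContDiff ℝ 1 H := contDiff_euclidean.2 hHl
  have hHc : HasCompactSupport H := by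
    refine HasCompactSupport.of_support_subset_isCompact (K := closedBall 0 (R+1)) (isCompact_closedBall _ _) ?_
    intro x hx
    by_contra hxx
    apply hx
    ext l
    by_cases h : l = i
    · have : η x = 0 := by
        by_contra h0
        have := hR (subset_tsupport _ h0)
        exact hxx (ball_subset_closedBall (ball_subset_ball (by linarith) this))
      simp [hH, h, this]
    · have : χ x = 0 := by
        apply χ.zero_of_le_dist
        simp only [mem_closedBall, not_le] at hxx
        exact hxx.le
      simp [hH, h, this]
  rw [← null_lagr hn hHd hHc]
  refine integral_congr_ae (Filter.Eventually.of_forall fun x => ?_)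
  simp only
  rw [fderiv_Cf_eq, det_clmMat]
  have hrow : ∀ j, fderiv ℝ H x (EuclideanSpace.single j 1) i = fderiv ℝ η x (EuclideanSpace.single j 1) := by
    intro j
    rw [fderiv_coord (hHd.differentiable (by norm_num) x)]
    simp [hH]
  by_cases hx : x ∈ tsupport η
  · congr 1
    ext l j
    by_cases h : l = i
    · subst h
      simp [clmMat, hrow]
    · rw [Matrix.updateRow_ne h, clmMat, diffMatrix, fderiv_coord (hHd.differentiable (by norm_num) x),
        fderiv_coord (hF.differentiable (by norm_num) x)]
      have : (fun y => H y l) =ᶠ[nhds x] fun y => F y l := by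
        filter_upwards [isOpen_ball.mem_nhds (hR hx)] with y hy
        simp [hH, h, χ.one_of_mem_closedBall (ball_subset_closedBall hy)]
      rw [this.fderiv_eq]
  · have h0 : fderiv ℝ η x = 0 := by
      by_contra h
      exact hx (tsupport_fderiv_subset ℝ (subset_tsupport _ h))
    rw [Matrix.det_eq_zero_of_row_eq_zero i (by simp [h0]), Matrix.det_eq_zero_of_row_eq_zero i (by
      intro j; simp only [clmMat]; rw [hrow, h0]; simp)]

lemma cofNorm_nonneg (f : EE n → EE n) (x : EE n) : 0 ≤ cofNorm f x := Real.sqrt_nonneg _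

lemma adj_le_cofNorm (f : EE n → EE n) (x : EE n) (i j : Fin n) :
    |adjugate (diffMatrix f x) j i| ≤ cofNorm f x := by
  rw [cofNorm]
  apply Real.abs_le_sqrt
  calc (adjugate (diffMatrix f x) j i)^2 = ((adjugate (diffMatrix f x))ᵀ i j)^2 := rfl
    _ ≤ ∑ j, ((adjugate (diffMatrix f x))ᵀ i j)^2 :=
      Finset.single_le_sum (f := fun j => ((adjugate (diffMatrix f x))ᵀ i j)^2) (fun _ _ => sq_nonneg _) (Finset.mem_univ j)
    _ ≤ _ := Finset.single_le_sum (f := fun i => ∑ j, ((adjugate (diffMatrix f x))ᵀ i j)^2)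
        (fun _ _ => Finset.sum_nonneg fun _ _ => sq_nonneg _) (Finset.mem_univ i)

lemma norm_Cf_le (f : EE n → EE n) (x : EE n) (i : Fin n) : ‖Cf f i x‖ ≤ cofNorm f x := by
  rw [EuclideanSpace.norm_eq, cofNorm]
  apply Real.sqrt_le_sqrt
  calc ∑ j, ‖Cf f i x j‖^2 = ∑ j, ((adjugate (diffMatrix f x))ᵀ i j)^2 := by
        refine Finset.sum_congr rfl fun j _ => ?_
        rw [Real.norm_eq_abs, sq_abs]; rfl
    _ ≤ _ := Finset.single_le_sum (f := fun i => ∑ j, ((adjugate (diffMatrix f x))ᵀ i j)^2)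
        (fun _ _ => Finset.sum_nonneg fun _ _ => sq_nonneg _) (Finset.mem_univ i)

lemma abs_diffMatrix_le (f : EE n → EE n) (x : EE n) (i j : Fin n) : |diffMatrix f x i j| ≤ ‖fderiv ℝ f x‖ := by
  have h1 : |diffMatrix f x i j| ≤ ‖fderiv ℝ f x (EuclideanSpace.single j 1)‖ := by
    have := PiLp.norm_apply_le (fderiv ℝ f x (EuclideanSpace.single j 1)) i
    rwa [Real.norm_eq_abs] at this
  refine h1.trans (((fderiv ℝ f x).le_opNorm _).trans ?_)
  simp

lemma cofNorm_le (hn : 1 ≤ n) : ∃ c > 0, ∀ (f : EE n → EE n) (x : EE n), cofNorm f x ≤ c * ‖fderiv ℝ f x‖^(n-1) := by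
  obtain ⟨m, rfl⟩ : ∃ m, n = m + 1 := ⟨n-1, by omega⟩
  refine ⟨(m+1) * (m.factorial : ℝ), by positivity, fun f x => ?_⟩
  rw [cofNorm]
  apply Real.sqrt_le_iff.2
  refine ⟨by positivity, ?_⟩
  have he : ∀ i j, ((adjugate (diffMatrix f x))ᵀ i j)^2 ≤ ((m.factorial : ℝ) * ‖fderiv ℝ f x‖^m)^2 := by
    intro i j
    apply sq_le_sq'
    all_goals
      have h1 : |(adjugate (diffMatrix f x))ᵀ i j| ≤ (m.factorial : ℝ) * ‖fderiv ℝ f x‖^m := by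
        rw [Matrix.transpose_apply, Matrix.adjugate_fin_succ_eq_det_submatrix, abs_mul, abs_pow, abs_neg, abs_one, one_pow, one_mul]
        have := Matrix.det_le (A := (diffMatrix f x).submatrix i.succAbove j.succAbove) (abv := AbsoluteValue.abs) (x := ‖fderiv ℝ f x‖)
          (fun a b => abs_diffMatrix_le f x _ _)
        simpa [nsmul_eq_mul] using this
      have := abs_le.1 h1
      first | exact this.1 | exact this.2
  calc ∑ i, ∑ j, ((adjugate (diffMatrix f x))ᵀ i j)^2 ≤ ∑ i : Fin (m+1), ∑ j : Fin (m+1), ((m.factorial : ℝ) * ‖fderiv ℝ f x‖^m)^2 :=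
        Finset.sum_le_sum fun i _ => Finset.sum_le_sum fun j _ => he i j
    _ = _ := by simp; ring

lemma abs_jacDet_le (hn : 2 ≤ n) (f : EE n → EE n) (x : EE n) :
    |jacDet f x| ≤ (n.factorial : ℝ) * cofNorm f x ^ ((n:ℝ)/(n-1)) := by
  have h1 : |(adjugate (diffMatrix f x)).det| ≤ (n.factorial : ℝ) * cofNorm f x ^ n := by
    have := Matrix.det_le (A := adjugate (diffMatrix f x)) (abv := AbsoluteValue.abs) (x := cofNorm f x)
          (fun a b => adj_le_cofNorm f x _ _)
    simpa [nsmul_eq_mul] using this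
  rw [Matrix.det_adjugate, Fintype.card_fin, abs_pow] at h1
  have hg := cofNorm_nonneg f x
  have hn1 : (0:ℝ) < (n:ℝ) - 1 := by
    have : (2:ℝ) ≤ n := by exact_mod_cast hn
    linarith
  have hnn : ((n-1 : ℕ):ℝ) = (n:ℝ) - 1 := by rw [Nat.cast_sub (by omega)]; simp
  have hf1 : (1:ℝ) ≤ n.factorial := by exact_mod_cast Nat.factorial_pos n
  have h2 : |(diffMatrix f x).det| ^ (n-1) ≤ ((n.factorial : ℝ) * cofNorm f x ^ ((n:ℝ)/(n-1)))^(n-1) := by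
    refine h1.trans ?_
    rw [mul_pow, ← Real.rpow_natCast (cofNorm f x ^ ((n:ℝ)/(n-1))), ← Real.rpow_mul hg, hnn, div_mul_cancel₀ _ hn1.ne', Real.rpow_natCast]
    gcongr
    exact le_self_pow₀ hf1 (by omega)
  exact le_of_pow_le_pow_left₀ (by omega) (by positivity) h2

lemma measurable_diffMatrix (f : EE n → EE n) (i j : Fin n) : Measurable (fun x => diffMatrix f x i j) := by
  have h1 : Measurable (fun x => fderiv ℝ f x (EuclideanSpace.single j 1)) := measurable_fderiv_apply_const ℝ f _
  have h2 : Continuous (fun v : EE n => v i) := by fun_prop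
  exact h2.measurable.comp h1

lemma measurable_poly_diffMatrix (f : EE n → EE n) (Φ : Matrix (Fin n) (Fin n) ℝ → ℝ) (hΦ : Continuous Φ) :
    Measurable (fun x => Φ (diffMatrix f x)) := by
  have h1 : Measurable (fun x => (fun i j => diffMatrix f x i j : Fin n → Fin n → ℝ)) :=
    measurable_pi_lambda _ fun i => measurable_pi_lambda _ fun j => measurable_diffMatrix f i j
  have h2 : Continuous (fun M : Fin n → Fin n → ℝ => Φ (Matrix.of M)) := hΦ
  exact h2.measurable.comp h1

lemma measurable_jacDet (f : EE n → EE n) : Measurable (jacDet f) :=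
  measurable_poly_diffMatrix f _ (Continuous.matrix_det continuous_id)

lemma measurable_cofNorm (f : EE n → EE n) : Measurable (cofNorm f) := by
  have : Continuous (fun A : Matrix (Fin n) (Fin n) ℝ => Real.sqrt (∑ i, ∑ j, ((Matrix.adjugate A)ᵀ i j) ^ 2)) := by
    apply Real.continuous_sqrt.comp
    refine continuous_finsetSum _ fun i _ => continuous_finsetSum _ fun j _ => ?_
    refine Continuous.pow ?_ 2
    exact (Continuous.matrix_adjugate continuous_id).matrix_elem j i
  exact measurable_poly_diffMatrix f _ this

lemma measurable_Cf (f : EE n → EE n) (i : Fin n) : Measurable (Cf f i) := by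
  have : Measurable (fun x => (fun j => adjugate (diffMatrix f x) j i)) := by
    refine measurable_pi_lambda _ fun j => ?_
    exact measurable_poly_diffMatrix f (fun A => adjugate A j i) ((Continuous.matrix_adjugate continuous_id).matrix_elem j i)
  exact (PiLp.continuous_toLp 2 _).measurable.comp this

lemma continuous_Cf {f : EE n → EE n} (hf : ContDiff ℝ 1 f) (i : Fin n) : Continuous (Cf f i) := by
  refine (PiLp.continuous_toLp 2 _).comp ?_
  refine continuous_pi fun j => ?_
  have : Continuous (diffMatrix f) := by
    refine continuous_pi fun i => continuous_pi fun j => ?_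
    have h1 : Continuous (fderiv ℝ f) := hf.continuous_fderiv (by norm_num)
    have h2 : Continuous (fun x => fderiv ℝ f x (EuclideanSpace.single j 1)) := h1.clm_apply continuous_const
    simp only [diffMatrix]
    fun_prop
  exact (Continuous.matrix_adjugate this).matrix_elem j i

/-- smoothness exponent infinity -/
abbrev sm : WithTop ℕ∞ := ((⊤ : ℕ∞) : WithTop ℕ∞)

lemma one_le_sm : (1 : WithTop ℕ∞) ≤ sm := 
  WithTop.coe_le_coe.2 (le_top : (1 : ℕ∞) ≤ ⊤)

open scoped Convolution in
/-- mollification -/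
def mol {E : Type*} [NormedAddCommGroup E] [NormedSpace ℝ E] (ρ : EE n → ℝ) (f : EE n → E) : EE n → E :=
  fun x => ∫ t, ρ t • f (x - t)

open scoped Convolution in
lemma mol_eq {E : Type*} [NormedAddCommGroup E] [NormedSpace ℝ E] (ρ : EE n → ℝ) (f : EE n → E) :
    mol ρ f = (ρ ⋆[ContinuousLinearMap.lsmul ℝ ℝ, volume] f) := rfl

lemma mol_integrand {E : Type*} [NormedAddCommGroup E] [NormedSpace ℝ E] {ρ : EE n → ℝ} (hρ : Continuous ρ) (hc : HasCompactSupport ρ)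
    {f : EE n → E} (hf : LocallyIntegrable f volume) (x : EE n) : Integrable (fun t => ρ t • f (x - t)) :=
  hc.convolutionExists_left (ContinuousLinearMap.lsmul ℝ ℝ) hρ hf x

lemma mol_fderiv {ρ : EE n → ℝ} (hρ : ContDiff ℝ sm ρ) (hc : HasCompactSupport ρ)
    {f : EE n → EE n} (hf : Differentiable ℝ f) (hfi : LocallyIntegrable (fderiv ℝ f) volume) (x : EE n) :
    fderiv ℝ (mol ρ f) x = mol ρ (fderiv ℝ f) x := by
  have hfl : LocallyIntegrable f volume := hf.continuous.locallyIntegrable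
  have h1 := hc.hasFDerivAt_convolution_left (ContinuousLinearMap.lsmul ℝ ℝ) (μ := volume) (hρ.of_le one_le_sm) hfl x
  rw [← mol_eq] at h1
  rw [h1.fderiv]
  have hρ1 : ContDiff ℝ 1 ρ := hρ.of_le one_le_sm
  have hDρ : Continuous (fderiv ℝ ρ) := hρ1.continuous_fderiv (by norm_num)
  ext v l
  have hI1 : Integrable (fun t => ((ContinuousLinearMap.lsmul ℝ ℝ).precompL (EE n) (fderiv ℝ ρ t) (f (x - t)) : EE n →L[ℝ] EE n)) :=
    (hc.fderiv ℝ).convolutionExists_left _ hDρ hfl x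
  have hI2 : Integrable (fun t => ρ t • fderiv ℝ f (x - t)) := mol_integrand hρ.continuous hc hfi x
  have e1 : ((∫ t, ((ContinuousLinearMap.lsmul ℝ ℝ).precompL (EE n) (fderiv ℝ ρ t) (f (x - t)) : EE n →L[ℝ] EE n)) v) l
      = ∫ t, fderiv ℝ ρ t v * f (x - t) l := by
    rw [ContinuousLinearMap.integral_apply hI1]
    have := (EuclideanSpace.proj l : EE n →L[ℝ] ℝ).integral_comp_comm (hI1.apply_continuousLinearMap v)
    refine this.symm.trans ?_
    rfl
  have e2 : (mol ρ (fderiv ℝ f) x v) l = ∫ t, ρ t * fderiv ℝ f (x - t) v l := by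
    rw [mol, ContinuousLinearMap.integral_apply hI2]
    have := (EuclideanSpace.proj l : EE n →L[ℝ] ℝ).integral_comp_comm (hI2.apply_continuousLinearMap v)
    refine this.symm.trans ?_
    rfl
  refine (e1.trans ?_).trans e2.symm
  set G : EE n → ℝ := fun t => f (x - t) l with hG
  have hGd : ∀ t, HasFDerivAt G (-((EuclideanSpace.proj l : EE n →L[ℝ] ℝ).comp (fderiv ℝ f (x - t)))) t := by
    intro t
    have a1 : HasFDerivAt (fun t => x - t) (-(ContinuousLinearMap.id ℝ (EE n))) t := (hasFDerivAt_id t).const_sub x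
    have a2 := ((EuclideanSpace.proj l : EE n →L[ℝ] ℝ).hasFDerivAt (x := f (x-t))).comp t (((hf (x - t)).hasFDerivAt).comp t a1)
    have a3 : -((EuclideanSpace.proj l : EE n →L[ℝ] ℝ).comp (fderiv ℝ f (x - t))) =
        (EuclideanSpace.proj l : EE n →L[ℝ] ℝ).comp ((fderiv ℝ f (x - t)).comp (-(ContinuousLinearMap.id ℝ (EE n)))) := by
      ext; simp
    rw [a3]; exact a2
  have hGd' : ∀ t, fderiv ℝ G t v = - (fderiv ℝ f (x - t) v l) := by
    intro t; rw [(hGd t).fderiv]; simp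
  have hGc : Continuous G := by
    have : Differentiable ℝ G := fun t => (hGd t).differentiableAt
    exact this.continuous
  have hDρv : Continuous (fun t => fderiv ℝ ρ t v) := hDρ.clm_apply continuous_const
  have hib := integral_mul_fderiv_eq_neg_fderiv_mul_of_integrable (μ := (volume : Measure (EE n))) (f := ρ) (g := G) (v := v) ?_ ?_ ?_
    (fun t _ => hρ1.differentiable (by norm_num) t) (fun t _ => (hGd t).differentiableAt)
  · simp_rw [hGd', mul_neg, integral_neg] at hib
    simp only [hG] at hib ⊢
    linarith
  · exact Continuous.integrable_of_hasCompactSupport (hDρv.mul hGc) ((hc.fderiv_apply ℝ v).mul_right)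
  · simp_rw [hGd', mul_neg]
    apply Integrable.neg
    exact (EuclideanSpace.proj l : EE n →L[ℝ] ℝ).integrable_comp (hI2.apply_continuousLinearMap v)
  · exact Continuous.integrable_of_hasCompactSupport (hρ.continuous.mul hGc) (hc.mul_right)

lemma mol_contDiff {E : Type*} [NormedAddCommGroup E] [NormedSpace ℝ E] [CompleteSpace E] {ρ : EE n → ℝ} (hρ : ContDiff ℝ sm ρ) (hc : HasCompactSupport ρ)
    {f : EE n → E} (hf : LocallyIntegrable f volume) : ContDiff ℝ sm (mol ρ f) := by
  rw [mol_eq]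
  exact hc.contDiff_convolution_left _ hρ hf

lemma pratt {α : Type*} [MeasurableSpace α] {μ : Measure α} {a : ℕ → α → ℝ} {a0 : α → ℝ} {G : ℕ → α → ℝ} {G0 : α → ℝ} {c : ℝ}
    (ha : ∀ k, Integrable (a k) μ) (hG : ∀ k, Integrable (G k) μ) (ha0 : Integrable a0 μ) (hG0 : Integrable G0 μ)
    (hle : ∀ k, ∀ᵐ x ∂μ, |a k x| ≤ G k x) (hac : ∀ᵐ x ∂μ, Filter.Tendsto (fun k => a k x) Filter.atTop (nhds (a0 x)))
    (hGc : ∀ᵐ x ∂μ, Filter.Tendsto (fun k => G k x) Filter.atTop (nhds (G0 x)))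
    (hGi : ∀ k, ∫ x, G k x ∂μ = ∫ x, G0 x ∂μ) (hai : ∀ k, ∫ x, a k x ∂μ = c) : ∫ x, a0 x ∂μ ≤ c := by
  have hle0 : ∀ᵐ x ∂μ, 0 ≤ G0 x + a0 x := by
    have hall := ae_all_iff.2 hle
    filter_upwards [hall, hac, hGc] with x h1 h2 h3
    exact ge_of_tendsto' (h3.add h2) fun k => by
      have := (abs_le.1 (h1 k)).1
      linarith
  have h1 : ∫⁻ x, ENNReal.ofReal (G0 x + a0 x) ∂μ ≤ ENNReal.ofReal (∫ x, G0 x ∂μ + c) := by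
    calc ∫⁻ x, ENNReal.ofReal (G0 x + a0 x) ∂μ
        = ∫⁻ x, Filter.liminf (fun k => ENNReal.ofReal (G k x + a k x)) Filter.atTop ∂μ := by
          refine lintegral_congr_ae ?_
          filter_upwards [hac, hGc] with x h2 h3
          exact ((ENNReal.tendsto_ofReal (h3.add h2)).liminf_eq).symm
      _ ≤ Filter.liminf (fun k => ∫⁻ x, ENNReal.ofReal (G k x + a k x) ∂μ) Filter.atTop :=
          lintegral_liminf_le' fun k => ((hG k).add (ha k)).aestronglyMeasurable.aemeasurable.ennreal_ofReal
      _ = Filter.liminf (fun k : ℕ => ENNReal.ofReal (∫ x, G0 x ∂μ + c)) Filter.atTop := by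
          congr 1
          ext k
          rw [← ofReal_integral_eq_lintegral_ofReal (f := fun x => G k x + a k x) ((hG k).add (ha k)), integral_add (hG k) (ha k), hGi, hai]
          filter_upwards [hle k] with x h1
          have := (abs_le.1 h1).1
          simp only [Pi.zero_apply]
          linarith
      _ = _ := Filter.liminf_const _
  rw [← ofReal_integral_eq_lintegral_ofReal (f := fun x => G0 x + a0 x) (hG0.add ha0) hle0, integral_add hG0 ha0] at h1
  by_cases h0 : 0 ≤ ∫ x, G0 x ∂μ + c
  · have := (ENNReal.ofReal_le_ofReal_iff h0).1 h1
    linarith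
  · exfalso
    push Not at h0
    have : 0 ≤ ∫ x, G 0 x + a 0 x ∂μ := integral_nonneg_of_ae (by
      filter_upwards [hle 0] with x h1
      have := (abs_le.1 h1).1
      simp only [Pi.zero_apply]
      linarith)
    rw [integral_add (hG 0) (ha 0), hGi, hai] at this
    linarith

lemma pow_tangent (m : ℕ) (hm : 1 ≤ m) {a t : ℝ} (ha : 0 ≤ a) (ht : 0 ≤ t) :
    t^m + m * t^(m-1) * (a - t) ≤ a^m := by
  rcases ht.eq_or_lt with h | h
  · subst h
    rcases Nat.lt_or_ge 1 m with h1 | h1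
    · rw [zero_pow (by omega), zero_pow (by omega)]
      simp; positivity
    · have : m = 1 := by omega
      subst this; simp
  · have := one_add_mul_sub_le_pow (a := a/t) (by have : 0 ≤ a/t := by positivity
                                                  linarith) m
    have h2 : t^m * (1 + m * (a/t - 1)) ≤ t^m * (a/t)^m := by gcongr
    rw [← mul_pow, mul_div_cancel₀ _ h.ne'] at h2
    refine le_trans (le_of_eq ?_) h2
    obtain ⟨k, rfl⟩ : ∃ k, m = k + 1 := ⟨m-1, by omega⟩
    simp only [Nat.add_sub_cancel]
    field_simp
    ring

lemma jensen_mol {ρ : EE n → ℝ} (hρ : Continuous ρ) (hc : HasCompactSupport ρ) (h0 : ∀ x, 0 ≤ ρ x) (h1 : ∫ x, ρ x = 1)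
    {a : EE n → ℝ} (ha : ∀ x, 0 ≤ a x) (m : ℕ) (hm : 1 ≤ m) (hai : LocallyIntegrable a volume)
    (ham : LocallyIntegrable (fun x => a x ^ m) volume) (x : EE n) :
    (mol ρ a x)^m ≤ mol ρ (fun x => a x ^ m) x := by
  have i1 := mol_integrand hρ hc hai x
  have i2 := mol_integrand hρ hc ham x
  have i3 : Integrable ρ := hρ.integrable_of_hasCompactSupport hc
  set t := mol ρ a x with ht
  have ht0 : 0 ≤ t := integral_nonneg fun y => mul_nonneg (h0 _) (ha _)
  have i4 : Integrable (fun y => (t^m - m * t^(m-1) * t) * ρ y + m * t^(m-1) * (ρ y • a (x - y))) :=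
    (i3.const_mul _).add (i1.const_mul _)
  calc t^m = ∫ y, (t^m - m * t^(m-1) * t) * ρ y + m * t^(m-1) * (ρ y • a (x - y)) := by
        rw [integral_add (i3.const_mul _) (i1.const_mul _), integral_const_mul, integral_const_mul, h1]
        change _ = _ + _ * t
        ring
    _ ≤ ∫ y, ρ y • a (x - y)^m := by
        refine integral_mono i4 i2 fun y => ?_
        have := pow_tangent m hm (ha (x - y)) ht0
        have := mul_le_mul_of_nonneg_left this (h0 y)
        simp only [smul_eq_mul]
        linarith

/-- a standard mollifier -/
def bmp (n : ℕ) (k : ℕ) : ContDiffBump (0 : EE n) :=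
  ⟨1 / (2 * ((k:ℝ) + 1)), 1 / ((k:ℝ) + 1), by positivity, by
    apply one_div_lt_one_div_of_lt (by positivity); have : (0:ℝ) ≤ k := Nat.cast_nonneg k
    linarith⟩

/-- normalised standard mollifier -/
def rho (n : ℕ) (k : ℕ) : EE n → ℝ := (bmp n k).normed volume

lemma rho_contDiff (k : ℕ) : ContDiff ℝ sm (rho n k) := (bmp n k).contDiff_normed
lemma rho_cont (k : ℕ) : Continuous (rho n k) := (rho_contDiff k).continuous
lemma rho_cs (k : ℕ) : HasCompactSupport (rho n k) := (bmp n k).hasCompactSupport_normed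
lemma rho_nonneg (k : ℕ) (x : EE n) : 0 ≤ rho n k x := (bmp n k).nonneg_normed x
lemma rho_int (k : ℕ) : ∫ x, rho n k x = 1 := (bmp n k).integral_normed
lemma rho_zero (k : ℕ) (x : EE n) (hx : 1 / ((k:ℝ) + 1) ≤ ‖x‖) : rho n k x = 0 := by
  by_contra h
  have : x ∈ Function.support ((bmp n k).normed volume) := h
  rw [ContDiffBump.support_normed_eq] at this
  rw [mem_ball_zero_iff] at this
  exact absurd this (not_lt.2 hx)

lemma rho_tendsto {E : Type*} [NormedAddCommGroup E] [NormedSpace ℝ E] [CompleteSpace E] {g : EE n → E} (hg : LocallyIntegrable g volume) :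
    ∀ᵐ x, Filter.Tendsto (fun k => mol (rho n k) g x) Filter.atTop (nhds (g x)) := by
  refine ContDiffBump.ae_convolution_tendsto_right_of_locallyIntegrable (φ := bmp n) (K := 2) ?_ ?_ hg
  · exact tendsto_one_div_add_atTop_nhds_zero_nat
  · refine Filter.Eventually.of_forall fun k => ?_
    simp only [bmp]
    have : (0:ℝ) < k + 1 := by positivity
    apply le_of_eq; field_simp

lemma cont_Cf_clm (i : Fin n) : Continuous (fun A : EE n →L[ℝ] EE n => (WithLp.toLp 2 (fun j => adjugate (clmMat A) j i) : EE n)) := by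
  refine (PiLp.continuous_toLp 2 _).comp ?_
  refine continuous_pi fun j => ?_
  have : Continuous (fun A : EE n →L[ℝ] EE n => clmMat A) := by
    refine continuous_pi fun i => continuous_pi fun j => ?_
    have h2 : Continuous (fun A : EE n →L[ℝ] EE n => A (EuclideanSpace.single j 1)) := by fun_prop
    simp only [clmMat]
    fun_prop
  exact (Continuous.matrix_adjugate this).matrix_elem j i

lemma divfree (hn : 2 ≤ n) {f : EE n → EE n} (hf : Differentiable ℝ f)
    (hfi : Integrable (fun x => ‖fderiv ℝ f x‖^(n-1))) {η : EE n → ℝ} (hη : ContDiff ℝ 1 η) (hc : HasCompactSupport η) (i : Fin n) :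
    ∫ x, fderiv ℝ η x (Cf f i x) = 0 := by
  obtain ⟨c, hc0, hcb⟩ := cofNorm_le (n := n) (by omega)
  have hDη : Continuous (fderiv ℝ η) := hη.continuous_fderiv (by norm_num)
  obtain ⟨K, hK⟩ := (hc.fderiv ℝ).exists_bound_of_continuous hDη
  have hK0 : 0 ≤ K := (norm_nonneg _).trans (hK 0)
  have hm : StronglyMeasurable (fderiv ℝ f) := (measurable_fderiv ℝ f).stronglyMeasurable
  have hnl : LocallyIntegrable (fun x => ‖fderiv ℝ f x‖) volume := by
    have h1 : LocallyIntegrable (fun x => 1 + ‖fderiv ℝ f x‖^(n-1)) volume :=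
      (locallyIntegrable_const (1:ℝ)).add hfi.locallyIntegrable
    refine h1.mono hm.norm.aestronglyMeasurable (Filter.Eventually.of_forall fun x => ?_)
    rw [norm_norm, Real.norm_eq_abs, abs_of_nonneg (by positivity)]
    rcases le_total ‖fderiv ℝ f x‖ 1 with h | h
    · have : 0 ≤ ‖fderiv ℝ f x‖^(n-1) := by positivity
      linarith
    · have := le_self_pow₀ h (show n-1 ≠ 0 by omega)
      linarith
  have hDl : LocallyIntegrable (fderiv ℝ f) volume := by
    refine hnl.mono hm.aestronglyMeasurable (Filter.Eventually.of_forall fun x => ?_)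
    rw [norm_norm]
  set F : EE n → ℝ := fun x => ‖fderiv ℝ f x‖^(n-1) with hF
  have hfl : LocallyIntegrable f volume := hf.continuous.locallyIntegrable
  set fk : ℕ → EE n → EE n := fun k => mol (rho n k) f with hfk
  have hfks : ∀ k, ContDiff ℝ 1 (fk k) := fun k => (mol_contDiff (rho_contDiff k) (rho_cs k) hfl).of_le one_le_sm
  have hfkD : ∀ k x, fderiv ℝ (fk k) x = mol (rho n k) (fderiv ℝ f) x := fun k x => mol_fderiv (rho_contDiff k) (rho_cs k) hf hDl x
  have hbound : ∀ (g : EE n → EE n) x, |fderiv ℝ η x (Cf g i x)| ≤ (K * c) * ‖fderiv ℝ g x‖^(n-1) := by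
    intro g x
    calc |fderiv ℝ η x (Cf g i x)| ≤ ‖fderiv ℝ η x‖ * ‖Cf g i x‖ := (fderiv ℝ η x).le_opNorm _
      _ ≤ K * (c * ‖fderiv ℝ g x‖^(n-1)) := by
        gcongr
        · exact hK x
        · exact (norm_Cf_le g x i).trans (hcb g x)
      _ = _ := by ring
  have hmolF : ∀ k, Integrable (mol (rho n k) F) := fun k =>
    Integrable.integrable_convolution (ContinuousLinearMap.lsmul ℝ ℝ) ((rho_cont k).integrable_of_hasCompactSupport (rho_cs k)) hfi
  have hmolFi : ∀ k, ∫ x, mol (rho n k) F x = ∫ x, F x := fun k => by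
    have : ∫ x, mol (rho n k) F x = (ContinuousLinearMap.lsmul ℝ ℝ (∫ x, rho n k x)) (∫ x, F x) :=
      integral_convolution (μ := volume) (ν := volume) (ContinuousLinearMap.lsmul ℝ ℝ)
        ((rho_cont (n := n) k).integrable_of_hasCompactSupport (rho_cs k)) hfi
    rw [rho_int] at this
    rw [this]
    simp
  have hak : ∀ k, Integrable (fun x => fderiv ℝ η x (Cf (fk k) i x)) := fun k => by
    refine Continuous.integrable_of_hasCompactSupport (hDη.clm_apply (continuous_Cf (hfks k) i)) ?_
    refine (hc.fderiv ℝ).mono fun x hx => ?_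
    contrapose! hx
    simp only [Function.mem_support, not_not] at hx ⊢
    rw [hx]; simp
  have ha0 : Integrable (fun x => fderiv ℝ η x (Cf f i x)) := by
    refine (hfi.const_mul (K*c)).mono' ?_ (Filter.Eventually.of_forall fun x => hbound f x)
    have h1 : Measurable (fun p : (EE n →L[ℝ] ℝ) × EE n => p.1 p.2) := by
      have : Continuous (fun p : (EE n →L[ℝ] ℝ) × EE n => p.1 p.2) := by fun_prop
      exact this.measurable
    exact (h1.comp (hDη.measurable.prodMk (measurable_Cf f i))).aestronglyMeasurable
  have hlek : ∀ k, ∀ᵐ x, |fderiv ℝ η x (Cf (fk k) i x)| ≤ (K*c) * mol (rho n k) F x := fun k => by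
    refine Filter.Eventually.of_forall fun x => (hbound _ x).trans ?_
    gcongr
    calc ‖fderiv ℝ (fk k) x‖^(n-1) ≤ (mol (rho n k) (fun x => ‖fderiv ℝ f x‖) x)^(n-1) := by
          gcongr
          rw [hfkD]
          refine (norm_integral_le_integral_norm _).trans (le_of_eq ?_)
          refine integral_congr_ae (Filter.Eventually.of_forall fun y => ?_)
          simp only [norm_smul, Real.norm_eq_abs, abs_of_nonneg (rho_nonneg k y), smul_eq_mul]
      _ ≤ _ := jensen_mol (rho_cont k) (rho_cs k) (rho_nonneg k) (rho_int k) (fun x => norm_nonneg _) (n-1) (by omega) hnl hfi.locallyIntegrable x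
  have hconv : ∀ᵐ x, Filter.Tendsto (fun k => fderiv ℝ η x (Cf (fk k) i x)) Filter.atTop (nhds (fderiv ℝ η x (Cf f i x))) := by
    filter_upwards [rho_tendsto hDl] with x hx
    have h1 := ((cont_Cf_clm i).tendsto _).comp hx
    have h2 := ((fderiv ℝ η x).continuous.tendsto _).comp h1
    refine h2.congr fun k => ?_
    simp only [Function.comp_apply]
    rw [← hfkD]; rfl
  have hconvG : ∀ᵐ x, Filter.Tendsto (fun k => (K*c) * mol (rho n k) F x) Filter.atTop (nhds ((K*c) * F x)) := by
    filter_upwards [rho_tendsto hfi.locallyIntegrable] with x hx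
    exact hx.const_mul _
  have hInt : ∀ k, ∫ x, fderiv ℝ η x (Cf (fk k) i x) = 0 := fun k => smooth_divfree (by omega) (hfks k) hη hc i
  have hGi : ∀ k, ∫ x, (K*c) * mol (rho n k) F x = ∫ x, (K*c) * F x := fun k => by
    rw [integral_const_mul, integral_const_mul, hmolFi]
  apply le_antisymm
  · exact pratt hak (fun k => (hmolF k).const_mul _) ha0 (hfi.const_mul _) hlek hconv hconvG hGi hInt
  · have := pratt (a := fun k x => - fderiv ℝ η x (Cf (fk k) i x)) (a0 := fun x => - fderiv ℝ η x (Cf f i x)) (c := 0)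
      (fun k => (hak k).neg) (fun k => (hmolF k).const_mul _) ha0.neg (hfi.const_mul _)
      (fun k => by simpa only [abs_neg] using hlek k) (by filter_upwards [hconv] with x hx using hx.neg) hconvG hGi
      (fun k => by rw [integral_neg, hInt, neg_zero])
    rw [integral_neg] at this
    linarith

/-- data for the Gauss-Green lemma -/
structure GGd (v : EE n → ℝ) (C : EE n → EE n) : Prop where
  hv : Differentiable ℝ v
  hCm : Measurable C
  hCi : Integrable C
  hdiv : ∀ η : EE n → ℝ, ContDiff ℝ sm η → HasCompactSupport η → ∫ x, fderiv ℝ η x (C x) = 0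
  hwi : Integrable (fun x => fderiv ℝ v x (C x))

/-- Gauss-Green defect -/
def Sf (v : EE n → ℝ) (C : EE n → EE n) (η : EE n → ℝ) : ℝ :=
  ∫ x, (η x * fderiv ℝ v x (C x) + v x * fderiv ℝ η x (C x))

lemma int_bdd_clm {C : EE n → EE n} (hCi : Integrable C) {T : EE n → (EE n →L[ℝ] ℝ)} (hT : Continuous T) {K : ℝ} (hK : ∀ x, ‖T x‖ ≤ K) :
    Integrable (fun x => T x (C x)) := by
  refine (hCi.norm.const_mul K).mono' ?_ (Filter.Eventually.of_forall fun x => ?_)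
  · have h1 : Continuous (fun p : (EE n →L[ℝ] ℝ) × EE n => p.1 p.2) := by fun_prop
    exact h1.comp_aestronglyMeasurable (hT.aestronglyMeasurable.prodMk hCi.aestronglyMeasurable)
  · exact ((T x).le_opNorm _).trans (by gcongr; exact hK x)

lemma int_cs_clm {C : EE n → EE n} (hCi : Integrable C) {T : EE n → (EE n →L[ℝ] ℝ)} (hT : Continuous T) (hc : HasCompactSupport T) :
    Integrable (fun x => T x (C x)) := by
  obtain ⟨K, hK⟩ := hc.exists_bound_of_continuous hT
  exact int_bdd_clm hCi hT hK

lemma int_cs_smul {E : Type*} [NormedAddCommGroup E] [NormedSpace ℝ E] {w : EE n → E} (hw : Integrable w) {η : EE n → ℝ} (hη : Continuous η) (hc : HasCompactSupport η) :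
    Integrable (fun x => η x • w x) := by
  obtain ⟨K, hK⟩ := hc.exists_bound_of_continuous hη
  refine (hw.norm.const_mul K).mono' (hη.aestronglyMeasurable.smul hw.aestronglyMeasurable) (Filter.Eventually.of_forall fun x => ?_)
  rw [norm_smul]
  gcongr
  exact hK x

lemma cont_fd {η : EE n → ℝ} (hη : ContDiff ℝ sm η) : Continuous (fderiv ℝ η) := (hη.of_le one_le_sm).continuous_fderiv (by norm_num)

lemma GG_int1 {v : EE n → ℝ} {C : EE n → EE n} (D : GGd v C) {η : EE n → ℝ} (hη : ContDiff ℝ sm η) (hc : HasCompactSupport η) : Integrable (fun x => η x * fderiv ℝ v x (C x)) := int_cs_smul D.hwi hη.continuous hc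

lemma GG_int2 {v : EE n → ℝ} {C : EE n → EE n} (D : GGd v C) {η : EE n → ℝ} (hη : ContDiff ℝ sm η) (hc : HasCompactSupport η) {u : EE n → ℝ} (hu : Continuous u) : Integrable (fun x => u x * fderiv ℝ η x (C x)) := by
  have h0 := cont_fd hη
  have h1 : Continuous (fun x => u x • fderiv ℝ η x) := by fun_prop
  have h2 : HasCompactSupport (fun x => u x • fderiv ℝ η x) := by
    refine (hc.fderiv ℝ).mono fun x hx => ?_
    contrapose! hx
    simp only [Function.mem_support, not_not] at hx ⊢
    rw [hx, smul_zero]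
  exact int_cs_clm D.hCi h1 h2

/-- localised test function -/
def zet (η ρ : EE n → ℝ) (c : EE n) : EE n → ℝ := fun x => η x * ρ (x - c)

lemma zet_cd {η ρ : EE n → ℝ} (hη : ContDiff ℝ sm η) (hρ : ContDiff ℝ sm ρ) (c : EE n) : ContDiff ℝ sm (zet η ρ c) := hη.mul (hρ.comp (contDiff_id.sub contDiff_const))

lemma zet_cs {η ρ : EE n → ℝ} (hc : HasCompactSupport η) (c : EE n) : HasCompactSupport (zet η ρ c) := hc.mul_right

lemma zet_fderiv {η ρ : EE n → ℝ} (hη : ContDiff ℝ sm η) (hρ : ContDiff ℝ sm ρ) (c x : EE n) : fderiv ℝ (zet η ρ c) x = η x • fderiv ℝ ρ (x - c) + ρ (x - c) • fderiv ℝ η x := by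
  have h1 : HasFDerivAt η (fderiv ℝ η x) x := (hη.differentiable (by simp) x).hasFDerivAt
  have h2 : HasFDerivAt (fun y => ρ (y - c)) (fderiv ℝ ρ (x - c)) x := by
    have a := (hρ.differentiable (by simp) (x - c)).hasFDerivAt.comp x ((hasFDerivAt_id x).sub_const c)
    rw [ContinuousLinearMap.comp_id] at a
    exact a
  exact (h1.mul h2).fderiv

lemma fderiv_odd {ρ : EE n → ℝ} (hs : ∀ x, ρ (-x) = ρ x) (x : EE n) : fderiv ℝ ρ (-x) = - fderiv ℝ ρ x := by
  have h : (fun y => ρ (-y)) = ρ := funext hs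
  have h2 : fderiv ℝ (fun y => ρ (-y)) x = - fderiv ℝ ρ (-x) := by
    have := (ContinuousLinearEquiv.neg ℝ (M := EE n)).comp_right_fderiv (f := ρ) (x := x)
    refine this.trans ?_
    ext; simp
  rw [h] at h2
  rw [h2, neg_neg]

lemma mol_swap {E : Type*} [NormedAddCommGroup E] [NormedSpace ℝ E] {ρ : EE n → ℝ} (hs : ∀ x, ρ (-x) = ρ x) (A : EE n → E) (c : EE n) :
    mol ρ A c = ∫ x, ρ (x - c) • A x := by
  have : mol ρ A c = ∫ x, ρ (c - x) • A x := convolution_lsmul_swap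
  rw [this]
  congr 1; ext x; rw [← hs (c - x), neg_sub]

lemma integral_fderiv_zero {ρ : EE n → ℝ} (hρ : ContDiff ℝ sm ρ) (hρc : HasCompactSupport ρ) : ∫ x, fderiv ℝ ρ x = 0 := by
  have hcD : Continuous (fderiv ℝ ρ) := (hρ.of_le one_le_sm).continuous_fderiv (by norm_num)
  have hi : Integrable (fderiv ℝ ρ) := hcD.integrable_of_hasCompactSupport (hρc.fderiv ℝ)
  ext u
  rw [ContinuousLinearMap.integral_apply hi]
  have := integral_mul_fderiv_eq_neg_fderiv_mul_of_integrable (μ := (volume : Measure (EE n))) (f := fun _ => (1:ℝ)) (g := ρ) (v := u)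
    (by simp) (by simpa using hi.apply_continuousLinearMap u) (by simpa using hρ.continuous.integrable_of_hasCompactSupport hρc)
    (fun _ _ => differentiableAt_const _) (fun x _ => hρ.differentiable (by simp) x)
  simpa using this

lemma Sf_zet {v : EE n → ℝ} {C : EE n → EE n} (D : GGd v C) {η ρ : EE n → ℝ} (hη : ContDiff ℝ sm η) (hc : HasCompactSupport η)
    (hρ : ContDiff ℝ sm ρ) (hρc : HasCompactSupport ρ) (hs : ∀ x, ρ (-x) = ρ x) (c : EE n) : Sf v C (zet η ρ c) =
    mol ρ (fun x => η x * fderiv ℝ v x (C x) + v x * fderiv ℝ η x (C x)) c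
      - convolution (fderiv ℝ ρ) (fun x => (v x * η x) • C x) (ContinuousLinearMap.id ℝ (EE n →L[ℝ] ℝ)) volume c := by
  have hcD : Continuous (fderiv ℝ ρ) := (hρ.of_le one_le_sm).continuous_fderiv (by norm_num)
  have iA : Integrable (fun x => η x * fderiv ℝ v x (C x) + v x * fderiv ℝ η x (C x)) :=
    (GG_int1 D hη hc).add (GG_int2 D hη hc D.hv.continuous)
  have iB : Integrable (fun x => (v x * η x) • C x) := int_cs_smul D.hCi (D.hv.continuous.mul hη.continuous) hc.mul_left
  have e2 : convolution (fderiv ℝ ρ) (fun x => (v x * η x) • C x) (ContinuousLinearMap.id ℝ (EE n →L[ℝ] ℝ)) volume c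
      = ∫ x, fderiv ℝ ρ (c - x) ((v x * η x) • C x) := convolution_eq_swap _
  rw [mol_swap hs, e2, Sf, ← integral_sub]
  · refine integral_congr_ae (Filter.Eventually.of_forall fun x => ?_)
    simp only [zet_fderiv hη hρ, zet]
    rw [← neg_sub x c, fderiv_odd hs]
    simp
    ring
  · have := mol_integrand hρ.continuous hρc iA.locallyIntegrable c
    have h2 := this.comp_sub_left c
    refine h2.congr (Filter.Eventually.of_forall fun x => ?_)
    have e : c - (c - x) = x := by abel
    simp only
    rw [e, ← hs (c - x), neg_sub]
  · have := (hρc.fderiv ℝ).convolutionExists_left (ContinuousLinearMap.id ℝ (EE n →L[ℝ] ℝ)) (μ := volume) hcD iB.locallyIntegrable c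
    have h2 := Integrable.comp_sub_left this c
    refine h2.congr (Filter.Eventually.of_forall fun x => ?_)
    simp

lemma Sf_zet_int {v : EE n → ℝ} {C : EE n → EE n} (D : GGd v C) {η ρ : EE n → ℝ} (hη : ContDiff ℝ sm η) (hc : HasCompactSupport η)
    (hρ : ContDiff ℝ sm ρ) (hρc : HasCompactSupport ρ) (hs : ∀ x, ρ (-x) = ρ x) : Integrable (fun c => Sf v C (zet η ρ c)) := by
  have hcD : Continuous (fderiv ℝ ρ) := (hρ.of_le one_le_sm).continuous_fderiv (by norm_num)
  have iA : Integrable (fun x => η x * fderiv ℝ v x (C x) + v x * fderiv ℝ η x (C x)) :=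
    (GG_int1 D hη hc).add (GG_int2 D hη hc D.hv.continuous)
  have iB : Integrable (fun x => (v x * η x) • C x) := int_cs_smul D.hCi (D.hv.continuous.mul hη.continuous) hc.mul_left
  simp_rw [Sf_zet D hη hc hρ hρc hs]
  refine Integrable.sub ?_ ?_
  · exact Integrable.integrable_convolution (ContinuousLinearMap.lsmul ℝ ℝ) (hρ.continuous.integrable_of_hasCompactSupport hρc) iA
  · exact Integrable.integrable_convolution _ (hcD.integrable_of_hasCompactSupport (hρc.fderiv ℝ)) iB

lemma Sf_eq_integral {v : EE n → ℝ} {C : EE n → EE n} (D : GGd v C) {η ρ : EE n → ℝ} (hη : ContDiff ℝ sm η) (hc : HasCompactSupport η)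
    (hρ : ContDiff ℝ sm ρ) (hρc : HasCompactSupport ρ) (hs : ∀ x, ρ (-x) = ρ x) (h1 : ∫ x, ρ x = 1) : ∫ c, Sf v C (zet η ρ c) = Sf v C η := by
  have hcD : Continuous (fderiv ℝ ρ) := (hρ.of_le one_le_sm).continuous_fderiv (by norm_num)
  have iA : Integrable (fun x => η x * fderiv ℝ v x (C x) + v x * fderiv ℝ η x (C x)) :=
    (GG_int1 D hη hc).add (GG_int2 D hη hc D.hv.continuous)
  have iB : Integrable (fun x => (v x * η x) • C x) := int_cs_smul D.hCi (D.hv.continuous.mul hη.continuous) hc.mul_left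
  simp_rw [Sf_zet D hη hc hρ hρc hs]
  have hi1 := hρ.continuous.integrable_of_hasCompactSupport (μ := volume) hρc
  have hi2 := hcD.integrable_of_hasCompactSupport (μ := volume) (hρc.fderiv ℝ)
  rw [integral_sub]
  · have a1 : ∫ c, mol ρ (fun x => η x * fderiv ℝ v x (C x) + v x * fderiv ℝ η x (C x)) c =
        (ContinuousLinearMap.lsmul ℝ ℝ (∫ x, ρ x)) (∫ x, (η x * fderiv ℝ v x (C x) + v x * fderiv ℝ η x (C x))) :=
      integral_convolution (μ := volume) (ν := volume) (ContinuousLinearMap.lsmul ℝ ℝ) hi1 iA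
    rw [a1, integral_convolution (μ := volume) (ν := volume) _ hi2 iB, h1, integral_fderiv_zero hρ hρc]
    simp [Sf]
  · exact Integrable.integrable_convolution (ContinuousLinearMap.lsmul ℝ ℝ) hi1 iA
  · exact Integrable.integrable_convolution _ hi2 iB

lemma rho_symm (k : ℕ) (x : EE n) : rho n k (-x) = rho n k x := (bmp n k).normed_neg x

lemma tsupport_zet_right {η : EE n → ℝ} (k : ℕ) (c : EE n) : tsupport (zet η (rho n k) c) ⊆ closedBall c (1/((k:ℝ)+1)) := by
  refine closure_minimal ?_ isClosed_closedBall
  intro x hx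
  by_contra h
  apply hx
  rw [mem_closedBall, dist_eq_norm, not_le] at h
  simp [zet, rho_zero k (x - c) h.le]

lemma tsupport_zet_left {η ρ : EE n → ℝ} (c : EE n) : tsupport (zet η ρ c) ⊆ tsupport η := by
  refine closure_mono fun x hx h => hx ?_
  simp [zet, h]

lemma Sf_zero_fun (v : EE n → ℝ) (C : EE n → EE n) : Sf v C (fun _ => 0) = 0 := by
  simp [Sf]

/-- points near which the Gauss-Green defect vanishes -/
def Ogood (v : EE n → ℝ) (C : EE n → EE n) : Set (EE n) :=
  {x | ∃ r > 0, ∀ η : EE n → ℝ, ContDiff ℝ sm η → HasCompactSupport η → tsupport η ⊆ ball x r → Sf v C η = 0}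

lemma isOpen_Ogood (v : EE n → ℝ) (C : EE n → EE n) : IsOpen (Ogood v C) := by
  rw [Metric.isOpen_iff]
  rintro x ⟨r, hr, h⟩
  refine ⟨r/2, by positivity, fun y hy => ⟨r/2, by positivity, fun η h1 h2 h3 => h η h1 h2 (h3.trans ?_)⟩⟩
  apply ball_subset_ball'
  rw [mem_ball] at hy
  linarith

lemma Sf_zero_of_subset {v : EE n → ℝ} {C : EE n → EE n} (D : GGd v C) {η : EE n → ℝ} (hη : ContDiff ℝ sm η) (hc : HasCompactSupport η)
    (hsub : tsupport η ⊆ Ogood v C) : Sf v C η = 0 := by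
  have hch : ∀ x : Ogood v C, ∃ r > 0, ∀ η : EE n → ℝ, ContDiff ℝ sm η → HasCompactSupport η → tsupport η ⊆ ball (x : EE n) r → Sf v C η = 0 :=
    fun x => x.2
  choose r hr h using hch
  obtain ⟨δ, hδ, hL⟩ := lebesgue_number_lemma_of_metric (s := tsupport η) (c := fun x : Ogood v C => ball (x : EE n) (r x)) hc.isCompact
    (fun _ => isOpen_ball) (fun x hx => Set.mem_iUnion.2 ⟨⟨x, hsub hx⟩, mem_ball_self (hr _)⟩)
  obtain ⟨k, hk⟩ := exists_nat_one_div_lt (half_pos hδ)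
  rw [← Sf_eq_integral D hη hc (rho_contDiff k) (rho_cs k) (rho_symm k) (rho_int k)]
  refine integral_eq_zero_of_ae (Filter.Eventually.of_forall fun c => ?_)
  simp only [Pi.zero_apply]
  by_cases hne : (tsupport (zet η (rho n k) c)).Nonempty
  · obtain ⟨y, hy⟩ := hne
    obtain ⟨i, hi⟩ := hL y (tsupport_zet_left c hy)
    refine h i _ (zet_cd hη (rho_contDiff k) c) (zet_cs hc c) (Set.Subset.trans ?_ hi)
    refine (tsupport_zet_right k c).trans fun z hz => ?_
    have h1 := tsupport_zet_right k c hy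
    rw [mem_closedBall] at hz h1
    rw [mem_ball]
    have := dist_triangle_right z y c
    linarith
  · have : zet η (rho n k) c = fun _ => 0 := by
      ext x
      by_contra hx
      exact hne ⟨x, subset_tsupport _ hx⟩
    rw [this, Sf_zero_fun]

lemma bmp_scale (k : ℕ) (x : EE n) : bmp n k x = bmp n 0 (((k:ℝ)+1) • x) := by
  have hk : (0:ℝ) < k + 1 := by positivity
  rw [ContDiffBump.apply, ContDiffBump.apply]
  congr 1
  · simp only [bmp]; simp; field_simp
  · simp only [bmp, sub_zero, smul_smul]
    congr 1
    simp

lemma rho_scale (k : ℕ) (x : EE n) : rho n k x = ((k:ℝ)+1)^n * rho n 0 (((k:ℝ)+1) • x) := by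
  have hk : (0:ℝ) < k + 1 := by positivity
  have h1 : ∫ x, bmp n k x = (((k:ℝ)+1)^n)⁻¹ * ∫ x, bmp n 0 x := by
    simp_rw [bmp_scale (n := n) k]
    rw [Measure.integral_comp_smul]
    simp only [finrank_euclideanSpace, Fintype.card_fin, smul_eq_mul]
    rw [abs_of_pos (by positivity)]
  simp only [rho, ContDiffBump.normed_def]
  rw [h1, bmp_scale]
  have : (0:ℝ) < ∫ x, bmp n 0 x := (bmp n 0).integral_pos
  field_simp

lemma rho_bounds : ∃ K > 0, ∀ k (x : EE n), rho n k x ≤ K * ((k:ℝ)+1)^n ∧ ‖fderiv ℝ (rho n k) x‖ ≤ K * ((k:ℝ)+1)^(n+1) := by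
  obtain ⟨K1, hK1⟩ := (rho_cs (n := n) 0).exists_bound_of_continuous (rho_cont 0)
  obtain ⟨K2, hK2⟩ := ((rho_cs (n := n) 0).fderiv ℝ).exists_bound_of_continuous (cont_fd (rho_contDiff 0))
  refine ⟨max (max K1 K2) 1, by positivity, fun k x => ⟨?_, ?_⟩⟩
  · rw [rho_scale, mul_comm]
    gcongr
    exact ((Real.le_norm_self _).trans (hK1 _)).trans ((le_max_left _ _).trans (le_max_left _ _))
  · have h1 : rho n k = fun x => ((k:ℝ)+1)^n * rho n 0 (((k:ℝ)+1) • x) := funext (rho_scale k)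
    have hd : DifferentiableAt ℝ (rho n 0) (((k:ℝ)+1) • x) := (rho_contDiff 0).differentiable (by simp) _
    have h2 : HasFDerivAt (fun x => rho n 0 (((k:ℝ)+1) • x)) (((k:ℝ)+1) • fderiv ℝ (rho n 0) (((k:ℝ)+1) • x)) x := by
      have a1 : HasFDerivAt (fun x : EE n => ((k:ℝ)+1) • x) (((k:ℝ)+1) • ContinuousLinearMap.id ℝ (EE n)) x :=
        (((k:ℝ)+1) • ContinuousLinearMap.id ℝ (EE n)).hasFDerivAt
      have a2 := hd.hasFDerivAt.comp x a1
      rw [ContinuousLinearMap.comp_smul, ContinuousLinearMap.comp_id] at a2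
      exact a2
    have h3 : fderiv ℝ (rho n k) x = ((k:ℝ)+1)^n • (((k:ℝ)+1) • fderiv ℝ (rho n 0) (((k:ℝ)+1) • x)) := by
      rw [h1]; exact (h2.const_mul _).fderiv
    rw [h3, norm_smul, norm_smul, Real.norm_eq_abs, Real.norm_eq_abs, abs_of_pos (by positivity), abs_of_pos (by positivity)]
    calc _ ≤ ((k:ℝ)+1)^n * (((k:ℝ)+1) * max (max K1 K2) 1) := by
          gcongr
          exact (hK2 _).trans ((le_max_right _ _).trans (le_max_left _ _))
      _ = _ := by ring

lemma zet_bound {η : EE n → ℝ} (hη : ContDiff ℝ sm η) (hc : HasCompactSupport η) :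
    ∃ K > 0, ∀ k c x, ‖fderiv ℝ (zet η (rho n k) c) x‖ ≤ K * ((k:ℝ)+1)^(n+1) := by
  obtain ⟨K, hK, hb⟩ := rho_bounds (n := n)
  obtain ⟨K1, hK1⟩ := hc.exists_bound_of_continuous hη.continuous
  obtain ⟨K2, hK2⟩ := (hc.fderiv ℝ).exists_bound_of_continuous (cont_fd hη)
  have h10 := (norm_nonneg _).trans (hK1 0)
  have h20 := (norm_nonneg _).trans (hK2 0)
  refine ⟨K * (K1 + K2 + 1), by positivity, fun k c x => ?_⟩
  rw [zet_fderiv hη (rho_contDiff k)]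
  have hk : (1:ℝ) ≤ k + 1 := by have : (0:ℝ) ≤ k := Nat.cast_nonneg k
                                linarith
  calc _ ≤ ‖η x‖ * ‖fderiv ℝ (rho n k) (x - c)‖ + ‖rho n k (x - c)‖ * ‖fderiv ℝ η x‖ := by
        refine (norm_add_le _ _).trans ?_
        rw [norm_smul, norm_smul]
    _ ≤ K1 * (K * ((k:ℝ)+1)^(n+1)) + (K * ((k:ℝ)+1)^(n+1)) * K2 := by
        gcongr
        · exact hK1 x
        · exact (hb k _).2
        · rw [Real.norm_eq_abs, abs_of_nonneg (rho_nonneg k _)]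
          refine (hb k _).1.trans ?_
          gcongr
          omega
        · exact hK2 x
    _ ≤ _ := by
        have : 0 ≤ K * ((k:ℝ)+1)^(n+1) := by positivity
        nlinarith

lemma zet_est {C : EE n → EE n} (hCi : Integrable C) {η : EE n → ℝ} {K : ℝ}
    (hK : ∀ k c x, ‖fderiv ℝ (zet η (rho n k) c) x‖ ≤ K * ((k:ℝ)+1)^(n+1)) (hK0 : 0 < K)
    {u : EE n → ℝ} {b : ℝ} (hb : 0 ≤ b) (k : ℕ) (c : EE n) (hu : ∀ x ∈ closedBall c (1/((k:ℝ)+1)), |u x| ≤ b) {m : ℝ}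
    (hm : ∫ x in closedBall c (1/((k:ℝ)+1)), ‖C x‖ ≤ m * (1/((k:ℝ)+1))^n) :
    |∫ x, u x * fderiv ℝ (zet η (rho n k) c) x (C x)| ≤ b * K * ((k:ℝ)+1) * m := by
  have hk : (0:ℝ) < k + 1 := by positivity
  have hs : ∫ x, u x * fderiv ℝ (zet η (rho n k) c) x (C x) = ∫ x in closedBall c (1/((k:ℝ)+1)), u x * fderiv ℝ (zet η (rho n k) c) x (C x) := by
    rw [setIntegral_eq_integral_of_forall_compl_eq_zero]
    intro x hx
    have hz : fderiv ℝ (zet η (rho n k) c) x = 0 := by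
      by_contra h
      exact hx (tsupport_zet_right k c (tsupport_fderiv_subset ℝ (subset_tsupport _ h)))
    rw [hz]; simp
  rw [hs, ← Real.norm_eq_abs]
  calc _ ≤ ∫ x in closedBall c (1/((k:ℝ)+1)), b * (K * ((k:ℝ)+1)^(n+1)) * ‖C x‖ := by
        refine norm_integral_le_of_norm_le (hCi.norm.integrableOn.const_mul _) ?_
        refine (ae_restrict_iff' measurableSet_closedBall).2 (Filter.Eventually.of_forall fun x hx => ?_)
        rw [norm_mul, mul_assoc]
        gcongr
        · exact hu x hx
        · exact ((fderiv ℝ (zet η (rho n k) c) x).le_opNorm _).trans (by gcongr; exact hK k c x)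
    _ ≤ b * (K * ((k:ℝ)+1)^(n+1)) * (m * (1/((k:ℝ)+1))^n) := by
        rw [integral_const_mul]
        gcongr
    _ = _ := by
        rw [one_div, inv_pow, pow_succ]
        field_simp

lemma maximal_fn (hn : 1 ≤ n) {C : EE n → EE n} (hCm : Measurable C) (hCi : Integrable C) {τ : ℝ} (hτ : 1 < τ)
    (hCt : ∫⁻ x, (ENNReal.ofReal ‖C x‖)^τ ≠ ∞) :
    ∃ m : EE n → ℝ, LocallyIntegrable m volume ∧ (∀ x, 0 ≤ m x) ∧
      ∀ᵐ c, ∀ r, 0 < r → ∫ x in closedBall c r, ‖C x‖ ≤ m c * r^n := by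
  obtain ⟨B, hB, hsum⟩ := mxSet_sum hn hτ
  set h : EE n → ℝ≥0∞ := fun x => ENNReal.ofReal ‖C x‖ with hh
  have hmh : Measurable h := hCm.norm.ennreal_ofReal
  have hih : ∫⁻ x, h x ≠ ∞ := by
    have := hCi.norm.lintegral_lt_top
    exact this.ne
  set M : EE n → ℝ≥0∞ := fun x => 1 + ∑' j : ℕ, (mxSet h (2^j)).indicator (fun _ => ENNReal.ofReal (2^j)) x with hM
  have hMm : Measurable M := by
    refine measurable_const.add (Measurable.ennreal_tsum fun j => ?_)
    exact measurable_const.indicator (isOpen_mxSet _ _).measurableSet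
  have hfin : ∫⁻ x, ∑' j : ℕ, (mxSet h (2^j)).indicator (fun _ => ENNReal.ofReal (2^j)) x ≠ ∞ := by
    rw [lintegral_tsum fun j => (measurable_const.indicator (isOpen_mxSet _ _).measurableSet).aemeasurable]
    have hle : ∑' j : ℕ, ∫⁻ x, (mxSet h (2^j)).indicator (fun _ => ENNReal.ofReal (2^j)) x ≤ ENNReal.ofReal B * ∫⁻ x, h x^τ := by
      rw [ENNReal.tsum_eq_iSup_nat]
      refine iSup_le fun m => ?_
      refine le_trans (Finset.sum_le_sum fun j _ => ?_) (hsum hmh hih 1 one_pos m)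
      rw [lintegral_indicator_const (isOpen_mxSet _ _).measurableSet, one_mul]
      gcongr
      have : (1:ℝ) ≤ 2^j := one_le_pow₀ (by norm_num)
      exact Real.self_le_rpow_of_one_le this hτ.le
    exact ne_top_of_le_ne_top (ENNReal.mul_ne_top ENNReal.ofReal_ne_top hCt) hle
  have hae : ∀ᵐ x, M x < ∞ := by
    have hmm : Measurable (fun x => ∑' j : ℕ, (mxSet h (2^j)).indicator (fun _ => ENNReal.ofReal (2^j)) x) :=
      Measurable.ennreal_tsum fun j => measurable_const.indicator (isOpen_mxSet _ _).measurableSet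
    filter_upwards [ae_lt_top hmm hfin] with x hx
    exact ENNReal.add_lt_top.2 ⟨ENNReal.one_lt_top, hx⟩
  refine ⟨fun x => (M x).toReal, ?_, fun x => ENNReal.toReal_nonneg, ?_⟩
  · rw [locallyIntegrable_iff]
    intro S hS
    refine integrable_toReal_of_lintegral_ne_top hMm.aemeasurable ?_
    rw [hM, lintegral_add_left measurable_const]
    refine ENNReal.add_ne_top.2 ⟨?_, ?_⟩
    · simp [hS.measure_lt_top.ne]
    · exact ne_top_of_le_ne_top hfin (setLIntegral_le_lintegral _ _)
  · filter_upwards [hae] with c hcM r hr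
    have hex : ∃ j : ℕ, c ∉ mxSet h (2^j) := by
      by_contra hcon
      push Not at hcon
      apply hcM.ne
      have h1 : ∑' j : ℕ, (mxSet h (2^j)).indicator (fun _ => ENNReal.ofReal (2^j)) c = ∞ := by
        refine top_le_iff.1 ?_
        rw [← ENNReal.tsum_const_eq_top_of_ne_zero (α := ℕ) (c := 1) one_ne_zero]
        refine ENNReal.tsum_le_tsum fun j => ?_
        rw [Set.indicator_of_mem (hcon j), ← ENNReal.ofReal_one]
        exact ENNReal.ofReal_le_ofReal (one_le_pow₀ (by norm_num))
      simp only [hM, h1]; simp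
    classical
    set m := Nat.find hex with hmdef
    have hm1 : c ∉ mxSet h (2^m) := Nat.find_spec hex
    have hm2 : ∀ j < m, c ∈ mxSet h (2^j) := fun j hj => by
      have := Nat.find_min hex hj
      simpa using this
    have hle : ENNReal.ofReal (2^m) ≤ M c := by
      have h1 : ENNReal.ofReal (1 + ∑ j ∈ Finset.range m, 2^j) ≤ M c := by
        rw [ENNReal.ofReal_add zero_le_one (Finset.sum_nonneg fun _ _ => by positivity), ENNReal.ofReal_one,
          ENNReal.ofReal_sum_of_nonneg (fun _ _ => by positivity)]
        simp only [hM]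
        gcongr
        refine le_trans (Finset.sum_le_sum fun j hj => ?_) (ENNReal.sum_le_tsum (Finset.range m))
        rw [Set.indicator_of_mem (hm2 j (Finset.mem_range.1 hj))]
      refine le_trans (ENNReal.ofReal_le_ofReal (le_of_eq ?_)) h1
      rw [geom_sum_eq (by norm_num)]; ring
    have hmr : (2:ℝ)^m ≤ (M c).toReal := by
      rw [← ENNReal.toReal_ofReal (show (0:ℝ) ≤ 2^m by positivity)]
      exact ENNReal.toReal_mono hcM.ne hle
    have hInt : ∫⁻ y in closedBall c r, h y ≤ ENNReal.ofReal (2^m * r^n) := by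
      by_contra hcon
      push Not at hcon
      exact hm1 ⟨r, hr, hcon⟩
    have h3 : ∫ x in closedBall c r, ‖C x‖ ≤ 2^m * r^n := by
      have := ofReal_integral_eq_lintegral_ofReal (hCi.norm.integrableOn (s := closedBall c r)) (Filter.Eventually.of_forall fun x => norm_nonneg _)
      rw [← ENNReal.ofReal_le_ofReal_iff (by positivity), this]
      exact hInt
    refine h3.trans ?_
    gcongr

lemma Sf_split {v : EE n → ℝ} {C : EE n → EE n} (D : GGd v C) {ζ : EE n → ℝ} (hζ : ContDiff ℝ sm ζ) (hc : HasCompactSupport ζ) (a : ℝ) :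
    Sf v C ζ = (∫ x, ζ x * fderiv ℝ v x (C x)) + ∫ x, (v x - a) * fderiv ℝ ζ x (C x) := by
  have h1 := GG_int1 D hζ hc
  have h2 := GG_int2 D hζ hc D.hv.continuous
  have h3 := GG_int2 D hζ hc (continuous_const (y := a))
  have h4 : ∫ x, (v x - a) * fderiv ℝ ζ x (C x) = ∫ x, v x * fderiv ℝ ζ x (C x) := by
    simp_rw [sub_mul]
    rw [integral_sub h2 h3, integral_const_mul, D.hdiv ζ hζ hc]; simp
  rw [h4, Sf, integral_add h1 h2]

lemma div_lin {v : EE n → ℝ} {C : EE n → EE n} (D : GGd v C) {ζ : EE n → ℝ} (hζ : ContDiff ℝ sm ζ) (hc : HasCompactSupport ζ)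
    (L : EE n →L[ℝ] ℝ) (c : EE n) : ∫ x, L (x - c) * fderiv ℝ ζ x (C x) = - ∫ x, ζ x * L (C x) := by
  have hl : ContDiff ℝ sm (fun x => L (x - c)) := L.contDiff.comp (contDiff_id.sub contDiff_const)
  have h0 := D.hdiv (fun x => L (x - c) * ζ x) (hl.mul hζ) hc.mul_left
  have hd : ∀ x, fderiv ℝ (fun x => L (x - c) * ζ x) x (C x) = L (x - c) * fderiv ℝ ζ x (C x) + ζ x * L (C x) := by
    intro x
    have a1 : HasFDerivAt (fun x => L (x - c)) L x := by
      have a := L.hasFDerivAt.comp x ((hasFDerivAt_id x).sub_const c)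
      rw [ContinuousLinearMap.comp_id] at a
      exact a
    have a2 := a1.mul (hζ.differentiable (by simp) x).hasFDerivAt
    have a3 : fderiv ℝ (fun x => L (x - c) * ζ x) x = L (x - c) • fderiv ℝ ζ x + ζ x • L := a2.fderiv
    rw [a3]; simp
  simp_rw [hd] at h0
  rw [integral_add (GG_int2 D hζ hc hl.continuous)] at h0
  · linarith
  · exact int_cs_smul (L.integrable_comp D.hCi) hζ.continuous hc

lemma mol_integrable {E : Type*} [NormedAddCommGroup E] [NormedSpace ℝ E] {g : EE n → E} (hg : Integrable g) (k : ℕ) : Integrable (mol (rho n k) g) :=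
  Integrable.integrable_convolution (ContinuousLinearMap.lsmul ℝ ℝ) ((rho_cont k).integrable_of_hasCompactSupport (rho_cs k)) hg

lemma mol_integral {E : Type*} [NormedAddCommGroup E] [NormedSpace ℝ E] [CompleteSpace E] {g : EE n → E} (hg : Integrable g) (k : ℕ) :
    ∫ x, mol (rho n k) g x = ∫ x, g x := by
  have a1 : ∫ c, mol (rho n k) g c = (ContinuousLinearMap.lsmul ℝ ℝ (∫ x, rho n k x)) (∫ x, g x) :=
      integral_convolution (μ := volume) (ν := volume) (ContinuousLinearMap.lsmul ℝ ℝ) ((rho_cont k).integrable_of_hasCompactSupport (rho_cs k)) hg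
  rw [a1, rho_int]; simp

lemma Sf_pointwise {v : EE n → ℝ} {C : EE n → EE n} (D : GGd v C) {m : EE n → ℝ}
    (hm : ∀ᵐ c, ∀ r, 0 < r → ∫ x in closedBall c r, ‖C x‖ ≤ m c * r^n) (hm0 : ∀ c, 0 ≤ m c)
    {η : EE n → ℝ} (hη : ContDiff ℝ sm η) (hc : HasCompactSupport η) :
    ∀ᵐ c, Filter.Tendsto (fun k => Sf v C (zet η (rho n k) c)) Filter.atTop (nhds 0) := by
  obtain ⟨K, hK0, hK⟩ := zet_bound hη hc
  have i1 := GG_int1 D hη hc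
  have i2 : Integrable (fun x => η x • C x) := int_cs_smul D.hCi hη.continuous hc
  filter_upwards [hm, rho_tendsto i1.locallyIntegrable, rho_tendsto i2.locallyIntegrable] with c hmc t1 t2
  set L := fderiv ℝ v c with hL
  have hLc : Continuous (fun x => L (x - c)) := by fun_prop
  have key : ∀ k, Sf v C (zet η (rho n k) c) = mol (rho n k) (fun x => η x * fderiv ℝ v x (C x)) c
      + (∫ x, (v x - v c - L (x - c)) * fderiv ℝ (zet η (rho n k) c) x (C x)) - L (mol (rho n k) (fun x => η x • C x) c) := by
    intro k
    have z1 := zet_cd hη (rho_contDiff k) c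
    have z2 := zet_cs (ρ := rho n k) hc c
    have e1 : ∫ x, (v x - v c) * fderiv ℝ (zet η (rho n k) c) x (C x) = (∫ x, (v x - v c - L (x - c)) * fderiv ℝ (zet η (rho n k) c) x (C x))
        + ∫ x, L (x - c) * fderiv ℝ (zet η (rho n k) c) x (C x) := by
      have hvc := D.hv.continuous
      have hcc : Continuous (fun x => v x - v c - L (x - c)) := by fun_prop
      rw [← integral_add (GG_int2 D z1 z2 hcc) (GG_int2 D z1 z2 hLc)]
      congr 1; ext x; ring
    rw [Sf_split D z1 z2 (v c), e1, div_lin D z1 z2, mol_swap (rho_symm k), mol_swap (rho_symm k)]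
    have e2 : ∫ x, zet η (rho n k) c x * fderiv ℝ v x (C x) = ∫ x, rho n k (x - c) • (η x * fderiv ℝ v x (C x)) := by
      congr 1; ext x; simp only [zet, smul_eq_mul]; ring
    have e3 : ∫ x, zet η (rho n k) c x * L (C x) = L (∫ x, rho n k (x - c) • η x • C x) := by
      rw [← ContinuousLinearMap.integral_comp_comm]
      · congr 1; ext x; simp only [zet, map_smul, smul_eq_mul]; ring
      · have := int_cs_smul D.hCi z1.continuous z2
        refine this.congr (Filter.Eventually.of_forall fun x => ?_)
        simp only [zet, smul_smul, mul_comm]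
    rw [e2, e3]; ring
  simp_rw [key]
  have t3 : Filter.Tendsto (fun k : ℕ => ∫ x, (v x - v c - L (x - c)) * fderiv ℝ (zet η (rho n k) c) x (C x)) Filter.atTop (nhds 0) := by
    rw [Metric.tendsto_atTop]
    intro ε hε
    have ho := (D.hv c).hasFDerivAt.isLittleO
    set e := ε / (2 * (K * (m c + 1))) with he
    have hmc0 := hm0 c
    have he0 : 0 < e := by positivity
    have ho2 := ho.def he0
    rw [Metric.eventually_nhds_iff] at ho2
    obtain ⟨δ, hδ, hd⟩ := ho2
    obtain ⟨N, hN⟩ := exists_nat_one_div_lt hδ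
    refine ⟨N, fun k hk => ?_⟩
    have hkp : (0:ℝ) < k + 1 := by positivity
    have hkN : 1 / ((k:ℝ)+1) ≤ 1 / ((N:ℝ)+1) := by gcongr
    have hb := zet_est D.hCi hK hK0 (u := fun x => v x - v c - L (x - c)) (b := e * (1 / ((k:ℝ)+1))) (by positivity) k c (fun x hx => by
      have := hd (y := x) (lt_of_le_of_lt hx (lt_of_le_of_lt hkN hN))
      rw [Real.norm_eq_abs] at this
      refine this.trans ?_
      gcongr
      rw [← dist_eq_norm]; exact hx) (hmc _ (by positivity))
    rw [Real.dist_eq, sub_zero]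
    refine lt_of_le_of_lt hb ?_
    have : e * (1 / ((k:ℝ)+1)) * K * ((k:ℝ)+1) * m c = e * K * m c := by field_simp
    rw [this, he]
    have : ε / (2 * (K * (m c + 1))) * K * m c = ε * (m c / (2 * (m c + 1))) := by field_simp
    rw [this]
    have : m c / (2 * (m c + 1)) < 1 := by rw [div_lt_one (by positivity)]; linarith
    nlinarith
  have t4 := (t1.add t3).sub ((L.continuous.tendsto _).comp t2)
  have : η c * (fderiv ℝ v c) (C c) + 0 - L (η c • C c) = 0 := by simp [hL]
  rw [this] at t4
  exact t4

lemma Sf_bound {v : EE n → ℝ} {C : EE n → EE n} (D : GGd v C) {η : EE n → ℝ} (hη : ContDiff ℝ sm η) (hc : HasCompactSupport η)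
    {K : ℝ} (hK : ∀ k c x, ‖fderiv ℝ (zet η (rho n k) c) x‖ ≤ K * ((k:ℝ)+1)^(n+1)) (hK0 : 0 < K)
    {m A : ℝ} (hA : 0 ≤ A) (c : EE n) (hm : ∀ r, 0 < r → ∫ x in closedBall c r, ‖C x‖ ≤ m * r^n) (k : ℕ) (a : EE n) (ha : dist a c ≤ 1/((k:ℝ)+1))
    (hlip : ∀ x ∈ closedBall c (1/((k:ℝ)+1)), |v x - v a| ≤ A * ‖x - a‖) :
    |Sf v C (zet η (rho n k) c)| ≤ mol (rho n k) (fun x => |η x * fderiv ℝ v x (C x)|) c + 2 * A * K * m := by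
  have z1 := zet_cd hη (rho_contDiff k) c
  have z2 := zet_cs (ρ := rho n k) hc c
  have hkp : (0:ℝ) < k + 1 := by positivity
  rw [Sf_split D z1 z2 (v a)]
  refine (abs_add_le _ _).trans (add_le_add ?_ ?_)
  · rw [mol_swap (rho_symm k)]
    refine (abs_integral_le_integral_abs).trans (le_of_eq ?_)
    congr 1; ext x
    simp only [zet, abs_mul, smul_eq_mul, abs_of_nonneg (rho_nonneg k (x - c))]; ring
  · have hb := zet_est D.hCi hK hK0 (u := fun x => v x - v a) (b := A * (2 * (1 / ((k:ℝ)+1)))) (by positivity) k c (fun x hx => by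
      refine (hlip x hx).trans ?_
      gcongr
      rw [← dist_eq_norm]
      have := dist_triangle_right x a c
      rw [mem_closedBall] at hx
      linarith) (hm _ (by positivity))
    refine hb.trans (le_of_eq ?_)
    field_simp

lemma baire_lip {v : EE n → ℝ} (hv : Differentiable ℝ v) {P : Set (EE n)} (hP : IsClosed P) (hne : P.Nonempty) :
    ∃ c0 ∈ P, ∃ ρ > 0, ∃ N : ℕ, ∀ c ∈ P, dist c c0 < ρ → ∀ x, ‖x - c‖ < 1/((N:ℝ)+1) → |v x - v c| ≤ ((N:ℝ)+1) * ‖x - c‖ := by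
  have hcs : CompleteSpace P := hP.completeSpace_coe
  have hnP : Nonempty P := hne.to_subtype
  let E : ℕ → Set P := fun N => {c | ∀ x, ‖x - (c : EE n)‖ < 1/((N:ℝ)+1) → |v x - v c| ≤ ((N:ℝ)+1) * ‖x - (c : EE n)‖}
  have hEc : ∀ N, IsClosed (E N) := by
    intro N
    have : E N = ⋂ x : EE n, ({c : P | 1/((N:ℝ)+1) ≤ ‖x - (c : EE n)‖} ∪ {c : P | |v x - v c| ≤ ((N:ℝ)+1) * ‖x - (c : EE n)‖}) := by
      ext c
      simp only [E, Set.mem_ofPred_eq, Set.mem_iInter, Set.mem_union]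
      refine forall_congr' fun x => ?_
      rw [imp_iff_not_or, not_lt]
    rw [this]
    have hvc := hv.continuous
    refine isClosed_iInter fun x => IsClosed.union (isClosed_le continuous_const ?_) (isClosed_le ?_ ?_)
    · exact (continuous_const.sub continuous_subtype_val).norm
    · exact (continuous_const.sub (hvc.comp continuous_subtype_val)).abs
    · exact continuous_const.mul (continuous_const.sub continuous_subtype_val).norm
  have hU : ⋃ N, E N = Set.univ := by
    refine Set.eq_univ_of_forall fun c => Set.mem_iUnion.2 ?_
    obtain ⟨A, hA⟩ := ((hv (c : EE n)).hasFDerivAt.isBigO_sub).bound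
    rw [Metric.eventually_nhds_iff] at hA
    obtain ⟨δ, hδ, hd⟩ := hA
    obtain ⟨N1, hN1⟩ := exists_nat_one_div_lt hδ
    obtain ⟨N2, hN2⟩ := exists_nat_ge A
    refine ⟨max N1 N2, fun x hx => ?_⟩
    have h1 : (N1:ℝ) ≤ ((max N1 N2 : ℕ):ℝ) := by exact_mod_cast le_max_left _ _
    have h2 : (N2:ℝ) ≤ ((max N1 N2 : ℕ):ℝ) := by exact_mod_cast le_max_right _ _
    have h3 : 1 / (((max N1 N2 : ℕ):ℝ)+1) ≤ 1 / ((N1:ℝ)+1) := by gcongr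
    have := hd (y := x) (by rw [dist_eq_norm]; linarith)
    rw [Real.norm_eq_abs] at this
    refine this.trans ?_
    gcongr
    linarith
  obtain ⟨N, c0, hc0⟩ := nonempty_interior_of_iUnion_of_closed hEc hU
  rw [mem_interior_iff_mem_nhds, Metric.mem_nhds_iff] at hc0
  obtain ⟨ρ, hρ, hb⟩ := hc0
  refine ⟨c0, c0.2, ρ, hρ, N, fun c hc hd => ?_⟩
  have hm : (⟨c, hc⟩ : P) ∈ ball c0 ρ := by
    rw [mem_ball, Subtype.dist_eq]; exact hd
  have h := hb hm
  simp only [E, Set.mem_ofPred_eq] at h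
  exact h

lemma GG_neg {v : EE n → ℝ} {C : EE n → EE n} (D : GGd v C) : GGd v (fun x => - C x) where
  hv := D.hv
  hCm := D.hCm.neg
  hCi := D.hCi.neg
  hdiv := fun η h1 h2 => by
    simp only [map_neg]; rw [integral_neg, D.hdiv η h1 h2, neg_zero]
  hwi := by
    simp only [map_neg]
    exact D.hwi.neg

lemma Sf_neg (v : EE n → ℝ) (C : EE n → EE n) (η : EE n → ℝ) : Sf v (fun x => - C x) η = - Sf v C η := by
  simp only [Sf, map_neg]; rw [← integral_neg]; congr 1; ext x; ring

lemma GG_local {v : EE n → ℝ} {C : EE n → EE n} (D : GGd v C) {m : EE n → ℝ} (hmi : LocallyIntegrable m volume)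
    (hm : ∀ᵐ c, ∀ r, 0 < r → ∫ x in closedBall c r, ‖C x‖ ≤ m c * r^n) (hm0 : ∀ c, 0 ≤ m c) 
    {c0 : EE n} {ρ : ℝ} (hρ : 0 < ρ) (N : ℕ) 
    (hlip : ∀ c ∉ Ogood v C, dist c c0 < ρ → ∀ x, ‖x - c‖ < 1/((N:ℝ)+1) → |v x - v c| ≤ ((N:ℝ)+1) * ‖x - c‖)
    {η : EE n → ℝ} (hη : ContDiff ℝ sm η) (hc : HasCompactSupport η) (hs : tsupport η ⊆ ball c0 (ρ/2)) :
    0 ≤ Sf v C η := by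
  obtain ⟨K, hK0, hK⟩ := zet_bound hη hc
  obtain ⟨k0, hk0⟩ := exists_nat_one_div_lt (show 0 < min (ρ/4) (1/(2*((N:ℝ)+1))) by positivity)
  have i1 := (GG_int1 D hη hc).abs
  set A : ℝ := (N:ℝ)+1 with hA
  have hA0 : 0 < A := by positivity
  have i3 : Integrable ((ball c0 ρ).indicator fun c => 2 * A * K * m c) := by
    rw [integrable_indicator_iff measurableSet_ball]
    exact ((hmi.integrableOn_isCompact (isCompact_closedBall c0 ρ)).mono_set ball_subset_closedBall).const_mul _
  have key := pratt (μ := volume) (a := fun k c => Sf v C (zet η (rho n (k + k0)) c)) (a0 := fun _ => 0) 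
    (G := fun k c => mol (rho n (k+k0)) (fun x => |η x * fderiv ℝ v x (C x)|) c + (ball c0 ρ).indicator (fun c => 2 * A * K * m c) c)
    (G0 := fun c => |η c * fderiv ℝ v c (C c)| + (ball c0 ρ).indicator (fun c => 2 * A * K * m c) c) (c := Sf v C η)
    (fun k => Sf_zet_int D hη hc (rho_contDiff _) (rho_cs _) (rho_symm _))
    (fun k => (mol_integrable i1 _).add i3) (integrable_zero _ _ _) (i1.add i3) ?_ ?_ ?_ ?_ 
    (fun k => Sf_eq_integral D hη hc (rho_contDiff _) (rho_cs _) (rho_symm _) (rho_int _))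
  · simpa using key
  · intro k
    filter_upwards [hm] with c hmc
    have hG0 : 0 ≤ mol (rho n (k+k0)) (fun x => |η x * fderiv ℝ v x (C x)|) c := 
      integral_nonneg fun t => mul_nonneg (rho_nonneg _ _) (abs_nonneg _)
    have hI0 : 0 ≤ (ball c0 ρ).indicator (fun c => 2 * A * K * m c) c := 
      Set.indicator_nonneg (fun c _ => by have := hm0 c; positivity) c
    have hk : 1 / (((k + k0 : ℕ):ℝ)+1) ≤ 1 / ((k0:ℝ)+1) := by
      gcongr; omega
    have hk1 := lt_of_le_of_lt hk hk0
    rw [lt_min_iff] at hk1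
    by_cases hne : (tsupport (zet η (rho n (k+k0)) c)).Nonempty
    swap
    · have : zet η (rho n (k+k0)) c = fun _ => 0 := by
        ext x
        by_contra hx
        exact hne ⟨x, subset_tsupport _ hx⟩
      rw [this, Sf_zero_fun, abs_zero]; positivity
    by_cases hsub : closedBall c (1 / (((k + k0 : ℕ):ℝ)+1)) ⊆ Ogood v C
    · rw [Sf_zero_of_subset D (zet_cd hη (rho_contDiff _) c) (zet_cs hc c) ((tsupport_zet_right _ c).trans hsub), abs_zero]; positivity
    rw [Set.not_subset] at hsub
    obtain ⟨a, ha1, ha2⟩ := hsub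
    obtain ⟨y, hy⟩ := hne
    have hy1 := hs (tsupport_zet_left c hy)
    have hy2 := tsupport_zet_right _ c hy
    rw [mem_ball] at hy1
    rw [mem_closedBall] at hy2 ha1
    have hcc : dist c c0 < ρ/2 + ρ/4 := by
      have := dist_triangle_left c c0 y
      linarith
    have hac : dist a c0 < ρ := by
      have := dist_triangle a c c0
      linarith
    rw [Set.indicator_of_mem (by rw [mem_ball]; linarith)]
    refine Sf_bound D hη hc hK hK0 hA0.le c hmc _ a ha1 fun x hx => hlip a ha2 hac x ?_
    rw [mem_closedBall] at hx
    rw [← dist_eq_norm]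
    have h1 := dist_triangle_right x a c
    have h2 : 1/(2*A) + 1/(2*A) = 1/A := by field_simp; norm_num
    rw [← h2]
    linarith [hk1.2]
  · filter_upwards [Sf_pointwise D hm hm0 hη hc] with c hcc
    exact hcc.comp (Filter.tendsto_add_atTop_nat k0)
  · filter_upwards [rho_tendsto i1.locallyIntegrable] with c hcc
    exact (hcc.comp (Filter.tendsto_add_atTop_nat k0)).add_const _
  · intro k
    rw [integral_add (mol_integrable i1 _) i3, integral_add i1 i3, mol_integral i1]

theorem GG_main (hn : 1 ≤ n) {v : EE n → ℝ} {C : EE n → EE n} (D : GGd v C) {τ : ℝ} (hτ : 1 < τ)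
    (hCt : ∫⁻ x, (ENNReal.ofReal ‖C x‖)^τ ≠ ∞) {η : EE n → ℝ} (hη : ContDiff ℝ sm η) (hc : HasCompactSupport η) : Sf v C η = 0 := by
  suffices h : Ogood v C = Set.univ from Sf_zero_of_subset D hη hc (by rw [h]; exact Set.subset_univ _)
  by_contra hP
  have hne : (Ogood v C)ᶜ.Nonempty := by rwa [Set.nonempty_compl]
  obtain ⟨m, hmi, hm0, hm⟩ := maximal_fn hn D.hCm D.hCi hτ hCt
  obtain ⟨c0, hc0, ρ, hρ, N, hN⟩ := baire_lip D.hv (isOpen_Ogood v C).isClosed_compl hne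
  refine hc0 ⟨ρ/2, by positivity, fun η h1 h2 h3 => le_antisymm ?_ (GG_local D hmi hm hm0 hρ N hN h1 h2 h3)⟩
  have hO : Ogood v (fun x => - C x) = Ogood v C := by
    simp only [Ogood, Sf_neg, neg_eq_zero]
  have := GG_local (GG_neg D) hmi (by simpa only [norm_neg] using hm) hm0 hρ N (by rw [hO]; exact hN) h1 h2 h3
  rw [Sf_neg] at this
  linarith

/-- admissible maps -/
structure Adm (f : EE n → EE n) : Prop where
  hn : 2 ≤ n
  hf : Differentiable ℝ f
  hfi : Integrable (fun x => ‖fderiv ℝ f x‖ ^ (n - 1)) volume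
  hgi : Integrable (fun x => cofNorm f x ^ ((n : ℝ) / (n - 1))) volume

lemma pexp_gt (hn : 2 ≤ n) : 1 < (n:ℝ)/(n-1) := by
  have : (2:ℝ) ≤ n := by exact_mod_cast hn
  rw [lt_div_iff₀ (by linarith)]; linarith

lemma Adm.int_g {f : EE n → EE n} (A : Adm f) : Integrable (cofNorm f) := by
  obtain ⟨c, hc, h⟩ := cofNorm_le (n := n) (by have := A.hn; omega)
  refine (A.hfi.const_mul c).mono' (measurable_cofNorm f).aestronglyMeasurable (Filter.Eventually.of_forall fun x => ?_)
  rw [Real.norm_eq_abs, abs_of_nonneg (cofNorm_nonneg f x)]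
  exact h f x

lemma Adm.int_J {f : EE n → EE n} (A : Adm f) : Integrable (jacDet f) := by
  refine (A.hgi.const_mul (n.factorial : ℝ)).mono' (measurable_jacDet f).aestronglyMeasurable (Filter.Eventually.of_forall fun x => ?_)
  exact abs_jacDet_le A.hn f x

lemma Adm.int_Cf {f : EE n → EE n} (A : Adm f) (i : Fin n) : Integrable (Cf f i) :=
  A.int_g.mono' (measurable_Cf f i).aestronglyMeasurable (Filter.Eventually.of_forall fun x => norm_Cf_le f x i)

lemma fderiv_Cf (f : EE n → EE n) (i : Fin n) (x : EE n) : fderiv ℝ f x (Cf f i x) = jacDet f x • EuclideanSpace.single i 1 := by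
  ext k
  have h1 : fderiv ℝ f x (Cf f i x) k = ∑ j, Cf f i x j * diffMatrix f x k j := by
    have := clm_expand ((EuclideanSpace.proj k : EE n →L[ℝ] ℝ).comp (fderiv ℝ f x)) (Cf f i x)
    simpa [diffMatrix] using this
  have h2 : ∑ j, Cf f i x j * diffMatrix f x k j = (diffMatrix f x * adjugate (diffMatrix f x)) k i := by
    rw [Matrix.mul_apply]
    exact Finset.sum_congr rfl fun j _ => by simp [Cf, mul_comm]
  rw [h1, h2, Matrix.mul_adjugate]
  simp [jacDet, Matrix.smul_apply, Matrix.one_apply]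

lemma GG_f {f : EE n → EE n} (A : Adm f) (i : Fin n) {ψ : EE n → ℝ} (hψ : ContDiff ℝ 1 ψ) (hψc : HasCompactSupport ψ)
    {η : EE n → ℝ} (hη : ContDiff ℝ sm η) (hc : HasCompactSupport η) :
    ∫ x, η x * (fderiv ℝ ψ (f x) (EuclideanSpace.single i 1) * jacDet f x) = - ∫ x, ψ (f x) * fderiv ℝ η x (Cf f i x) := by
  have hn1 : 1 ≤ n := by have := A.hn; omega
  have hDc : Continuous (fderiv ℝ ψ) := hψ.continuous_fderiv (by norm_num)
  have hfc := A.hf.continuous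
  obtain ⟨K, hK⟩ := (hψc.fderiv ℝ).exists_bound_of_continuous hDc
  have hw : ∀ x, fderiv ℝ (fun y => ψ (f y)) x (Cf f i x) = fderiv ℝ ψ (f x) (EuclideanSpace.single i 1) * jacDet f x := by
    intro x
    have a := ((hψ.differentiable (by norm_num) (f x)).hasFDerivAt).comp x (A.hf x).hasFDerivAt
    have b : fderiv ℝ (fun y => ψ (f y)) x = (fderiv ℝ ψ (f x)).comp (fderiv ℝ f x) := a.fderiv
    rw [b, ContinuousLinearMap.comp_apply, fderiv_Cf, map_smul, smul_eq_mul, mul_comm]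
  have D : GGd (fun y => ψ (f y)) (Cf f i) :=
    { hv := (hψ.differentiable (by norm_num)).comp A.hf
      hCm := measurable_Cf f i
      hCi := A.int_Cf i
      hdiv := fun η h1 h2 => divfree A.hn A.hf A.hfi (h1.of_le one_le_sm) h2 i
      hwi := by
        simp_rw [hw]
        refine A.int_J.bdd_mul (c := K) (Continuous.aestronglyMeasurable (by fun_prop)) (Filter.Eventually.of_forall fun x => ?_)
        refine ((fderiv ℝ ψ (f x)).le_opNorm _).trans ?_
        simpa using hK (f x) }
  have h0 := GG_main hn1 D (pexp_gt A.hn) (by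
    refine ne_top_of_le_ne_top A.hgi.lintegral_lt_top.ne (lintegral_mono fun x => ?_)
    rw [ENNReal.ofReal_rpow_of_nonneg (norm_nonneg _) (by have := pexp_gt A.hn; linarith)]
    refine ENNReal.ofReal_le_ofReal (Real.rpow_le_rpow (norm_nonneg _) (norm_Cf_le f x i) (by have := pexp_gt A.hn; linarith))) hη hc
  rw [Sf, integral_add (GG_int1 D hη hc) (GG_int2 D hη hc D.hv.continuous)] at h0
  simp_rw [hw] at h0
  linarith

lemma inj_radius (A : EE n →L[ℝ] EE n) : ∃ r : NNReal, r ≠ 0 ∧ (A.det ≠ 0 → ∀ (f : EE n → EE n) (s : Set (EE n)), ApproximatesLinearOn f A s r → Set.InjOn f s) := by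
  by_cases hA : A.det = 0
  · exact ⟨1, one_ne_zero, fun h => absurd hA h⟩
  set e := A.toContinuousLinearEquivOfDetNeZero hA with he
  have hce : (e : EE n →L[ℝ] EE n) = A := by ext; simp [he]
  rcases e.subsingleton_or_nnnorm_symm_pos with h | h
  · exact ⟨1, one_ne_zero, fun _ f s _ => fun x _ y _ _ => Subsingleton.elim x y⟩
  · refine ⟨‖(e.symm : EE n →L[ℝ] EE n)‖₊⁻¹/2, by positivity, fun _ f s hfs => ?_⟩
    rw [← hce] at hfs
    exact hfs.injOn (Or.inr (half_lt_self (by positivity)))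

lemma inj_pieces {f : EE n → EE n} (hf : Differentiable ℝ f) {S : Set (EE n)} (hS : MeasurableSet S) (hJ : ∀ x ∈ S, jacDet f x ≠ 0) :
    ∃ P : ℕ → Set (EE n), (∀ k, MeasurableSet (P k)) ∧ Pairwise (Function.onFun Disjoint P) ∧ (⋃ k, P k = S) ∧ ∀ k, Set.InjOn f (P k) := by
  choose r hr0 hr using inj_radius (n := n)
  obtain ⟨t, A, hd, hm, hcov, hap, hA⟩ := exists_partition_approximatesLinearOn_of_hasFDerivWithinAt f S (fderiv ℝ f)
    (fun x _ => (hf x).hasFDerivAt.hasFDerivWithinAt) r hr0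
  refine ⟨fun k => S ∩ t k, fun k => hS.inter (hm k), fun i j hij => (hd hij).mono Set.inter_subset_right Set.inter_subset_right, ?_, fun k => ?_⟩
  · rw [← Set.inter_iUnion]; exact Set.inter_eq_left.2 hcov
  · rcases S.eq_empty_or_nonempty with h | h
    · simp [h]
    · obtain ⟨y, hy, hAy⟩ := hA h k
      refine hr (A k) ?_ f _ (hap k)
      rw [hAy, ← jacDet_eq]; exact hJ y hy

lemma mult_area {f : EE n → EE n} (hf : Differentiable ℝ f) {S : Set (EE n)} (hS : MeasurableSet S) (hJ : ∀ x ∈ S, jacDet f x ≠ 0)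
    (hi : IntegrableOn (jacDet f) S) :
    ∃ U : EE n → ℕ, Measurable U ∧ Integrable (fun y => (U y : ℝ)) ∧ (∀ y, U y ≠ 0 → y ∈ f '' S) ∧ 
      ∀ ψ : EE n → ℝ, Continuous ψ → ∫ x in S, |jacDet f x| * ψ (f x) = ∫ y, (U y : ℝ) * ψ y := by
  obtain ⟨P, hPm, hPd, hPS, hPi⟩ := inj_pieces hf hS hJ
  have hPsub : ∀ k, P k ⊆ S := fun k => hPS ▸ Set.subset_iUnion P k
  have hIm : ∀ k, MeasurableSet (f '' P k) := fun k =>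
    measurable_image_of_fderivWithin (hPm k) (fun x _ => (hf x).hasFDerivAt.hasFDerivWithinAt) (hPi k)
  set V : EE n → ℝ≥0∞ := fun y => ∑' k, (f '' P k).indicator (fun _ => 1) y with hV
  have hVm : Measurable V := Measurable.ennreal_tsum fun k => measurable_const.indicator (hIm k)
  have hInt : ∀ ψ : EE n → ℝ≥0∞, Measurable ψ → ∫⁻ x in S, ENNReal.ofReal |jacDet f x| * ψ (f x) = ∫⁻ y, V y * ψ y := by
    intro ψ hψ
    rw [← hPS, lintegral_iUnion hPm hPd]
    have : ∀ y, V y * ψ y = ∑' k, (f '' P k).indicator ψ y := by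
      intro y
      rw [hV, ← ENNReal.tsum_mul_right]
      refine tsum_congr fun k => ?_
      by_cases hy : y ∈ f '' P k <;> simp [hy]
    simp_rw [this]
    rw [lintegral_tsum fun k => (hψ.indicator (hIm k)).aemeasurable]
    refine tsum_congr fun k => ?_
    rw [lintegral_indicator (hIm k), lintegral_image_eq_lintegral_abs_det_fderiv_mul volume (hPm k) (f' := fderiv ℝ f) 
      (fun x _ => (hf x).hasFDerivAt.hasFDerivWithinAt) (hPi k)]
    simp_rw [jacDet_eq]
  have hVfin : ∫⁻ y, V y ≠ ∞ := by
    have h1 := hInt (fun _ => 1) measurable_const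
    simp only [mul_one] at h1
    rw [← h1]
    exact hi.abs.lintegral_lt_top.ne
  have hVae : ∀ᵐ y, V y < ∞ := ae_lt_top hVm hVfin
  have hVnat : ∀ y, V y < ∞ → ∃ N : ℕ, V y = N := by
    intro y hy
    have hfin := ENNReal.finite_const_le_of_tsum_ne_top hy.ne (ε := 1) one_ne_zero
    refine ⟨hfin.toFinset.card, ?_⟩
    rw [hV]
    simp only
    rw [tsum_eq_sum (s := hfin.toFinset)]
    · rw [Finset.sum_congr rfl (g := fun _ => (1:ℝ≥0∞))]
      · simp
      · intro k hk
        rw [Set.Finite.mem_toFinset] at hk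
        by_contra hne
        have : y ∉ f '' P k := fun h => hne (Set.indicator_of_mem h _)
        simp [this] at hk
    · intro k hk
      rw [Set.Finite.mem_toFinset] at hk
      by_contra hne
      have : y ∈ f '' P k := Set.mem_of_indicator_ne_zero hne
      simp [this] at hk
  have hUV : ∀ y, V y < ∞ → ((⌊(V y).toReal⌋₊ : ℕ) : ℝ) = (V y).toReal := by
    intro y hy
    obtain ⟨N, hN⟩ := hVnat y hy
    rw [hN]; simp
  have hUae : ∀ᵐ y, ((⌊(V y).toReal⌋₊ : ℕ) : ℝ) = (V y).toReal := hVae.mono hUV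
  refine ⟨fun y => ⌊(V y).toReal⌋₊, hVm.ennreal_toReal.nat_floor, ?_, ?_, ?_⟩
  · refine (integrable_toReal_of_lintegral_ne_top hVm.aemeasurable hVfin).congr ?_
    filter_upwards [hUae] with y hy using hy.symm
  · intro y hy
    have hne : V y ≠ 0 := by
      intro h; apply hy; simp [h]
    rw [hV] at hne
    simp only [ne_eq, ENNReal.tsum_eq_zero, not_forall] at hne
    obtain ⟨k, hk⟩ := hne
    exact Set.image_mono (hPsub k) (Set.mem_of_indicator_ne_zero hk)
  · intro ψ hψ
    have hJm : Measurable (fun x => ENNReal.ofReal |jacDet f x|) := (measurable_jacDet f).abs.ennreal_ofReal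
    have hfm : Measurable f := hf.continuous.measurable
    have hmeas : Measure.map f ((volume.restrict S).withDensity (fun x => ENNReal.ofReal |jacDet f x|)) = volume.withDensity V := by
      refine Measure.ext fun B hB => ?_
      rw [Measure.map_apply hfm hB, withDensity_apply _ (hfm hB), withDensity_apply _ hB]
      have h1 := hInt (B.indicator fun _ => 1) (measurable_const.indicator hB)
      rw [← lintegral_indicator (hfm hB), ← lintegral_indicator hB]
      have k1 : ∀ x, (f ⁻¹' B).indicator (fun x => ENNReal.ofReal |jacDet f x|) x = ENNReal.ofReal |jacDet f x| * B.indicator (fun _ => 1) (f x) := by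
        intro x
        by_cases hx : f x ∈ B
        · rw [Set.indicator_of_mem hx, Set.indicator_of_mem (show x ∈ f ⁻¹' B from hx), mul_one]
        · rw [Set.indicator_of_notMem hx, Set.indicator_of_notMem (show x ∉ f ⁻¹' B from hx), mul_zero]
      have k2 : ∀ x, B.indicator V x = V x * B.indicator (fun _ => 1) x := by
        intro x
        by_cases hx : x ∈ B <;> simp [hx]
      simp_rw [k1, k2]
      exact h1
    have e1 := integral_map (μ := (volume.restrict S).withDensity (fun x => ENNReal.ofReal |jacDet f x|)) hfm.aemeasurable (f := ψ) hψ.aestronglyMeasurable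
    rw [hmeas, integral_withDensity_eq_integral_toReal_smul hVm hVae, integral_withDensity_eq_integral_toReal_smul hJm (by simp)] at e1
    have e2 : ∫ x in S, |jacDet f x| * ψ (f x) = ∫ x in S, (ENNReal.ofReal |jacDet f x|).toReal • ψ (f x) := by
      congr 1; ext x; rw [ENNReal.toReal_ofReal (abs_nonneg _), smul_eq_mul]
    rw [e2, ← e1]
    refine integral_congr_ae ?_
    filter_upwards [hUae] with y hy
    rw [hy, smul_eq_mul]

/-- signed integer multiplicity -/
lemma multiplicity_signed {f : EE n → EE n} (hf : Differentiable ℝ f) {S : Set (EE n)} (hS : MeasurableSet S) (hi : IntegrableOn (jacDet f) S) :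
    ∃ U : EE n → ℤ, Measurable U ∧ Integrable (fun y => (U y : ℝ)) ∧ (∀ y, U y ≠ 0 → y ∈ f '' S) ∧ 
      ∀ ψ : EE n → ℝ, Continuous ψ → (∃ K, ∀ y, |ψ y| ≤ K) → ∫ x in S, ψ (f x) * jacDet f x = ∫ y, (U y : ℝ) * ψ y := by
  have hJm := measurable_jacDet f
  have hm1 : MeasurableSet (S ∩ {x | 0 < jacDet f x}) := hS.inter (measurableSet_lt measurable_const hJm)
  have hm2 : MeasurableSet (S ∩ {x | jacDet f x < 0}) := hS.inter (measurableSet_lt hJm measurable_const)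
  obtain ⟨U1, a1, b1, c1, d1⟩ := mult_area hf hm1 (fun x hx => ne_of_gt hx.2) (hi.mono_set Set.inter_subset_left)
  obtain ⟨U2, a2, b2, c2, d2⟩ := mult_area hf hm2 (fun x hx => ne_of_lt hx.2) (hi.mono_set Set.inter_subset_left)
  refine ⟨fun y => (U1 y : ℤ) - U2 y, ?_, ?_, ?_, ?_⟩
  · exact (Measurable.comp (measurable_from_nat (f := fun k : ℕ => (k:ℤ))) a1).sub (Measurable.comp (measurable_from_nat (f := fun k : ℕ => (k:ℤ))) a2)
  · push_cast; exact b1.sub b2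
  · intro y hy
    by_cases h : U1 y = 0
    · have : U2 y ≠ 0 := by intro h2; apply hy; simp [h, h2]
      exact Set.image_mono Set.inter_subset_left (c2 y this)
    · exact Set.image_mono Set.inter_subset_left (c1 y h)
  · rintro ψ hψ ⟨K, hK⟩
    push_cast
    simp_rw [sub_mul]
    have bd : ∀ {U : EE n → ℕ}, Integrable (fun y => (U y : ℝ)) → Integrable (fun y => (U y : ℝ) * ψ y) := fun h => 
      h.mul_bdd (c := K) hψ.aestronglyMeasurable (Filter.Eventually.of_forall fun y => hK y)
    rw [integral_sub (bd b1) (bd b2), ← d1 ψ hψ, ← d2 ψ hψ]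
    rw [← integral_indicator hm1, ← integral_indicator hm2, ← integral_indicator hS]
    have hb : IntegrableOn (fun x => |jacDet f x| * ψ (f x)) S := 
      hi.abs.mul_bdd (c := K) (hψ.comp hf.continuous).aestronglyMeasurable (Filter.Eventually.of_forall fun y => hK (f y))
    rw [← integral_sub]
    · congr 1; ext x
      by_cases hx : x ∈ S
      · rcases lt_trichotomy (jacDet f x) 0 with h | h | h
        · simp [Set.indicator, hx, h, h.not_gt, abs_of_neg h, mul_comm]
        · simp [Set.indicator, hx, h]
        · simp [Set.indicator, hx, h, h.not_gt, abs_of_pos h, mul_comm]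
      · simp [Set.indicator, hx]
    · rw [integrable_indicator_iff hm1]; exact hb.mono_set Set.inter_subset_left
    · rw [integrable_indicator_iff hm2]; exact hb.mono_set Set.inter_subset_left

lemma mol_adj {U φ : EE n → ℝ} (hU : Integrable U) (hφ : Integrable φ) (k : ℕ) :
    ∫ x, mol (rho n k) U x * φ x = ∫ y, U y * mol (rho n k) φ y := by
  obtain ⟨K, hK⟩ := (rho_cs (n := n) k).exists_bound_of_continuous (rho_cont k)
  have hi : Integrable (Function.uncurry fun x y => rho n k (y - x) * (φ x * U y)) (volume.prod volume) := by
    have h1 : Integrable (fun z : EE n × EE n => φ z.1 * U z.2) (volume.prod volume) := hφ.mul_prod hU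
    refine h1.bdd_mul (c := K) ?_ (Filter.Eventually.of_forall fun z => hK _)
    exact ((rho_cont k).comp (continuous_snd.sub continuous_fst)).aestronglyMeasurable
  have hs := integral_integral_swap hi
  have e1 : ∀ x, mol (rho n k) U x * φ x = ∫ y, rho n k (y - x) * (φ x * U y) := by
    intro x
    rw [mol_swap (rho_symm k), ← integral_mul_const]
    congr 1; ext y; simp only [smul_eq_mul]; ring
  have e2 : ∀ y, U y * mol (rho n k) φ y = ∫ x, rho n k (y - x) * (φ x * U y) := by
    intro y
    rw [mol_swap (rho_symm k), ← integral_const_mul]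
    congr 1; ext x
    rw [← rho_symm k (x - y), neg_sub]; simp only [smul_eq_mul]; ring
  simp_rw [e1, e2]
  exact hs

lemma mol_fderiv_right {ψ : EE n → ℝ} (hψ : ContDiff ℝ sm ψ) (hc : HasCompactSupport ψ) (k : ℕ) (e x : EE n) :
    fderiv ℝ (mol (rho n k) ψ) x e = mol (rho n k) (fun y => fderiv ℝ ψ y e) x := by
  have h1 := hc.hasFDerivAt_convolution_right (ContinuousLinearMap.lsmul ℝ ℝ) (μ := volume) (rho_cont (n := n) k).locallyIntegrable (hψ.of_le one_le_sm) x
  rw [← mol_eq] at h1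
  rw [h1.fderiv]
  have hI : Integrable (fun t => ((ContinuousLinearMap.lsmul ℝ ℝ).precompR (EE n) (rho n k t) (fderiv ℝ ψ (x - t)) : EE n →L[ℝ] ℝ)) :=
    (hc.fderiv ℝ).convolutionExists_right _ (rho_cont (n := n) k).locallyIntegrable (cont_fd hψ) x
  rw [convolution, ContinuousLinearMap.integral_apply hI]
  rfl

lemma mol_cs' {U : EE n → ℝ} (h1 : HasCompactSupport U) (k : ℕ) : HasCompactSupport (mol (rho n k) U) := by
  rw [mol_eq]
  exact HasCompactSupport.convolution (ContinuousLinearMap.lsmul ℝ ℝ) (rho_cs k) h1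

lemma mol_cs {U : EE n → ℝ} {R : ℝ} (hR : ∀ y, y ∉ closedBall (0 : EE n) R → U y = 0) (k : ℕ) : HasCompactSupport (mol (rho n k) U) := by
  have h1 : HasCompactSupport U := HasCompactSupport.of_support_subset_isCompact (isCompact_closedBall 0 R) (fun y hy => by
    by_contra h; exact hy (hR y h))
  exact mol_cs' h1 k

lemma mol_abs_le {ψ : EE n → ℝ} (hb : ∀ y, |ψ y| ≤ 1) (k : ℕ) (x : EE n) : |mol (rho n k) ψ x| ≤ 1 := by
  rw [mol, ← Real.norm_eq_abs, ← rho_int (n := n) k]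
  refine norm_integral_le_of_norm_le ((rho_cont k).integrable_of_hasCompactSupport (rho_cs k)) (Filter.Eventually.of_forall fun t => ?_)
  rw [norm_smul, Real.norm_eq_abs, Real.norm_eq_abs, abs_of_nonneg (rho_nonneg k t)]
  exact mul_le_of_le_one_right (rho_nonneg k t) (hb _)

lemma sign_aux (t e : ℝ) (he : 0 < e) : |t| ≤ t * (t / Real.sqrt (e^2 + t^2)) + e := by
  have h1 : Real.sqrt (e^2 + t^2) ≤ |t| + e := by
    rw [Real.sqrt_le_left (by positivity)]
    nlinarith [abs_nonneg t, sq_abs t]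
  have h0 : 0 < Real.sqrt (e^2 + t^2) := Real.sqrt_pos.2 (by positivity)
  have h2 : t * (t / Real.sqrt (e^2 + t^2)) = |t|^2 / Real.sqrt (e^2 + t^2) := by rw [sq_abs]; ring
  rw [h2]
  have h3 : |t|^2 / (|t| + e) ≤ |t|^2 / Real.sqrt (e^2 + t^2) := by gcongr
  have h4 : |t| - e ≤ |t|^2 / (|t| + e) := by
    rw [le_div_iff₀ (by positivity)]; nlinarith [abs_nonneg t]
  linarith

lemma L1_of_dual {w : EE n → ℝ} (hw : ContDiff ℝ sm w) (hc : HasCompactSupport w) {T : ℝ}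
    (h : ∀ ψ : EE n → ℝ, ContDiff ℝ sm ψ → HasCompactSupport ψ → (∀ y, |ψ y| ≤ 1) → |∫ x, w x * ψ x| ≤ T) : ∫ x, |w x| ≤ T := by
  refine le_of_forall_pos_le_add fun δ hδ => ?_
  set V : ℝ := volume.real (tsupport w) with hV
  have hV0 : 0 ≤ V := measureReal_nonneg
  set e := δ / (V + 1) with he
  have he0 : 0 < e := by positivity
  set ψ : EE n → ℝ := fun x => w x / Real.sqrt (e^2 + w x^2) with hψ
  have hpos : ∀ x, 0 < e^2 + w x^2 := fun x => by positivity
  have h1 : ContDiff ℝ sm ψ := hw.div ((contDiff_const.add (hw.pow 2)).sqrt fun x => (hpos x).ne') fun x => (Real.sqrt_pos.2 (hpos x)).ne'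
  have h2 : HasCompactSupport ψ := by
    refine hc.mono fun x hx => ?_
    contrapose! hx
    simp only [Function.mem_support, not_not] at hx ⊢
    simp [hψ, hx]
  have h3 : ∀ y, |ψ y| ≤ 1 := by
    intro y
    rw [hψ]; simp only
    rw [abs_div, abs_of_pos (Real.sqrt_pos.2 (hpos y)), div_le_one (Real.sqrt_pos.2 (hpos y))]
    apply Real.abs_le_sqrt
    nlinarith
  have h4 := h ψ h1 h2 h3
  have i1 : Integrable (fun x => w x * ψ x) := (hw.continuous.mul h1.continuous).integrable_of_hasCompactSupport hc.mul_right
  have i2 : Integrable ((tsupport w).indicator fun _ => e) := by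
    rw [integrable_indicator_iff (isClosed_tsupport w).measurableSet]
    exact integrableOn_const hc.isCompact.measure_lt_top.ne
  calc ∫ x, |w x| ≤ ∫ x, (w x * ψ x + (tsupport w).indicator (fun _ => e) x) := by
        refine integral_mono (hw.continuous.integrable_of_hasCompactSupport hc).abs (i1.add i2) fun x => ?_
        by_cases hx : x ∈ tsupport w
        · simp only [Set.indicator_of_mem hx]
          exact sign_aux (w x) e he0
        · have : w x = 0 := image_eq_zero_of_notMem_tsupport hx
          simp [this, Set.indicator_of_notMem hx]
    _ = (∫ x, w x * ψ x) + e * V := by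
        rw [integral_add i1 i2, integral_indicator_const _ (isClosed_tsupport w).measurableSet, smul_eq_mul, mul_comm e]
    _ ≤ T + δ := by
        have : e * V ≤ δ := by
          rw [he, div_mul_eq_mul_div, div_le_iff₀ (by positivity)]; nlinarith
        have := le_abs_self (∫ x, w x * ψ x)
        linarith

lemma clm_norm_le_sum (L : EE n →L[ℝ] ℝ) : ‖L‖ ≤ ∑ i, |L (EuclideanSpace.single i 1)| := by
  refine L.opNorm_le_bound (Finset.sum_nonneg fun _ _ => abs_nonneg _) fun v => ?_
  rw [clm_expand, Finset.sum_mul, Real.norm_eq_abs]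
  refine (Finset.abs_sum_le_sum_abs _ _).trans (Finset.sum_le_sum fun i _ => ?_)
  rw [abs_mul, mul_comm]
  gcongr
  exact PiLp.norm_apply_le v i

lemma BV_hD {U : EE n → ℝ} {R T : ℝ} (hU : Integrable U) (hR : ∀ y, y ∉ closedBall (0 : EE n) R → U y = 0) (k : ℕ) (i : Fin n)
    (H : ∀ (ψ : EE n → ℝ), ContDiff ℝ sm ψ → HasCompactSupport ψ → (∀ y, |ψ y| ≤ 1) → |∫ y, U y * fderiv ℝ ψ y (EuclideanSpace.single i 1)| ≤ T) :
    ∫ x, |fderiv ℝ (mol (rho n k) U) x (EuclideanSpace.single i 1)| ≤ T := by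
  have hUl := hU.locallyIntegrable
  have hsm : ∀ k, ContDiff ℝ sm (mol (rho n k) U) := fun k => mol_contDiff (rho_contDiff k) (rho_cs k) hUl
  have hcs := mol_cs hR k
  refine L1_of_dual ?_ (hcs.fderiv_apply ℝ _) fun ψ h1 h2 h3 => ?_
  · exact ((hsm k).fderiv_right (m := sm) (by simp)).clm_apply contDiff_const
  · have hcd := cont_fd h1
    have hcd' := cont_fd (hsm k)
    have e1 : ∫ x, fderiv ℝ (mol (rho n k) U) x (EuclideanSpace.single i 1) * ψ x = - ∫ x, mol (rho n k) U x * fderiv ℝ ψ x (EuclideanSpace.single i 1) := by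
      rw [integral_mul_fderiv_eq_neg_fderiv_mul_of_integrable, neg_neg]
      · exact Continuous.integrable_of_hasCompactSupport ((hcd'.clm_apply continuous_const).mul h1.continuous) h2.mul_left
      · exact Continuous.integrable_of_hasCompactSupport ((hsm k).continuous.mul (hcd.clm_apply continuous_const)) hcs.mul_right
      · exact Continuous.integrable_of_hasCompactSupport ((hsm k).continuous.mul h1.continuous) h2.mul_left
      · exact fun x _ => (hsm k).differentiable (by simp) x
      · exact fun x _ => h1.differentiable (by simp) x
    rw [e1, mol_adj hU (Continuous.integrable_of_hasCompactSupport (hcd.clm_apply continuous_const) (h2.fderiv_apply ℝ _)), abs_neg]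
    simp_rw [← mol_fderiv_right h1 h2]
    exact H _ (mol_contDiff (rho_contDiff k) (rho_cs k) h1.continuous.locallyIntegrable) (mol_cs' h2 k) (mol_abs_le h3 k)

lemma BV_sobolev (hn : 2 ≤ n) : ∃ C > 0, ∀ (U : EE n → ℝ) (R T : ℝ), Integrable U → (∀ y, y ∉ closedBall (0 : EE n) R → U y = 0) → 0 ≤ T → 
    (∀ i (ψ : EE n → ℝ), ContDiff ℝ sm ψ → HasCompactSupport ψ → (∀ y, |ψ y| ≤ 1) → |∫ y, U y * fderiv ℝ ψ y (EuclideanSpace.single i 1)| ≤ T) → 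
    ∫⁻ y, ENNReal.ofReal |U y| ^ ((n:ℝ)/(n-1)) ≤ ENNReal.ofReal (C * T ^ ((n:ℝ)/(n-1))) := by
  set p : ℝ := (n:ℝ)/(n-1) with hp
  have hp1 : 1 < p := pexp_gt hn
  have hn2 : (2:ℝ) ≤ n := by exact_mod_cast hn
  set c := lintegralPowLePowLIntegralFDerivConst (volume : Measure (EE n)) p with hc
  have hconj : ((Module.finrank ℝ (EE n) : ℕ) : ℝ).HolderConjugate p := by
    rw [finrank_euclideanSpace, Fintype.card_fin, Real.holderConjugate_iff]
    refine ⟨by linarith, ?_⟩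
    rw [hp]; field_simp; ring
  refine ⟨(c + 1) * (n:ℝ)^p, by positivity, fun U R T hU hR hT H => ?_⟩
  have hUl := hU.locallyIntegrable
  have hsm : ∀ k, ContDiff ℝ sm (mol (rho n k) U) := fun k => mol_contDiff (rho_contDiff k) (rho_cs k) hUl
  have hD : ∀ k i, ∫ x, |fderiv ℝ (mol (rho n k) U) x (EuclideanSpace.single i 1)| ≤ T := by
    intro k i
    exact BV_hD hU hR k i (H i)
  have hS : ∀ k, ∫⁻ x, ‖mol (rho n k) U x‖ₑ ^ p ≤ ENNReal.ofReal ((c + 1) * (n:ℝ)^p * T^p) := by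
    intro k
    have h1 := lintegral_pow_le_pow_lintegral_fderiv (volume : Measure (EE n)) ((hsm k).of_le one_le_sm) (mol_cs hR k) hconj
    have hcd' := cont_fd (hsm k)
    have h2 : ∫⁻ x, ‖fderiv ℝ (mol (rho n k) U) x‖ₑ ≤ ENNReal.ofReal (n * T) := by
      have hInt : ∀ i, Integrable (fun x => |fderiv ℝ (mol (rho n k) U) x (EuclideanSpace.single i 1)|) := fun i =>
        (Continuous.integrable_of_hasCompactSupport (hcd'.clm_apply continuous_const) ((mol_cs hR k).fderiv_apply ℝ _)).abs
      calc _ ≤ ∫⁻ x, ENNReal.ofReal (∑ i, |fderiv ℝ (mol (rho n k) U) x (EuclideanSpace.single i 1)|) := by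
            refine lintegral_mono fun x => ?_
            rw [← ofReal_norm]
            exact ENNReal.ofReal_le_ofReal (clm_norm_le_sum _)
        _ = ENNReal.ofReal (∫ x, ∑ i, |fderiv ℝ (mol (rho n k) U) x (EuclideanSpace.single i 1)|) := by
            rw [ofReal_integral_eq_lintegral_ofReal (f := fun x => ∑ i, |fderiv ℝ (mol (rho n k) U) x (EuclideanSpace.single i 1)|)]
            · exact integrable_finsetSum _ fun i _ => hInt i
            · exact Filter.Eventually.of_forall fun x => Finset.sum_nonneg fun _ _ => abs_nonneg _
        _ ≤ _ := by
            apply ENNReal.ofReal_le_ofReal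
            rw [integral_finsetSum _ fun i _ => hInt i]
            refine (Finset.sum_le_sum fun i _ => hD k i).trans ?_
            simp
    refine h1.trans ?_
    calc (c : ℝ≥0∞) * (∫⁻ x, ‖fderiv ℝ (mol (rho n k) U) x‖ₑ)^p ≤ c * (ENNReal.ofReal (n*T))^p := by gcongr
      _ = ENNReal.ofReal (c * (n:ℝ)^p * T^p) := by
          rw [ENNReal.ofReal_rpow_of_nonneg (by positivity) (by linarith), Real.mul_rpow (by positivity) hT, mul_assoc,
            ENNReal.ofReal_mul (p := (c:ℝ)) c.2, ENNReal.ofReal_coe_nnreal, ENNReal.ofReal_mul (by positivity)]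
      _ ≤ _ := by
          apply ENNReal.ofReal_le_ofReal
          gcongr
          simp
  have hlim := rho_tendsto hUl
  calc ∫⁻ y, ENNReal.ofReal |U y| ^ p = ∫⁻ y, Filter.liminf (fun k => ‖mol (rho n k) U y‖ₑ ^ p) Filter.atTop := by
        refine lintegral_congr_ae ?_
        filter_upwards [hlim] with y hy
        have := ((ENNReal.continuous_rpow_const (y := p)).tendsto _).comp (hy.enorm)
        rw [← Real.norm_eq_abs, ofReal_norm]
        exact this.liminf_eq.symm
    _ ≤ Filter.liminf (fun k => ∫⁻ y, ‖mol (rho n k) U y‖ₑ ^ p) Filter.atTop := by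
        refine lintegral_liminf_le fun k => ?_
        exact ((hsm k).continuous.measurable.enorm).pow_const _
    _ ≤ ENNReal.ofReal ((c + 1) * (n:ℝ)^p * T^p) := by
        refine Filter.liminf_le_of_le (by isBoundedDefault) fun b hb => ?_
        obtain ⟨k, hk⟩ := hb.exists
        exact hk.trans (hS k)


lemma isop (hn : 2 ≤ n) : ∃ C > 0, ∀ (f : EE n → EE n) (S : Set (EE n)) (R T : ℝ), Differentiable ℝ f → MeasurableSet S →
    IntegrableOn (jacDet f) S → f '' S ⊆ closedBall 0 R → 0 ≤ T →
    (∀ i (ψ : EE n → ℝ), ContDiff ℝ sm ψ → HasCompactSupport ψ → (∀ y, |ψ y| ≤ 1) →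
      |∫ x in S, fderiv ℝ ψ (f x) (EuclideanSpace.single i 1) * jacDet f x| ≤ T) →
    |∫ x in S, jacDet f x| ≤ C * T ^ ((n:ℝ)/(n-1)) := by
  obtain ⟨C, hC, H⟩ := BV_sobolev hn
  refine ⟨C, hC, fun f S R T hf hS hi hR hT h => ?_⟩
  have hp1 := pexp_gt hn
  obtain ⟨U, hUm, hUi, hU0, hU⟩ := multiplicity_signed hf hS hi
  have h1 := H (fun y => (U y : ℝ)) R T hUi (fun y hy => by
    by_contra h0
    exact hy (hR (hU0 y (by exact_mod_cast h0)))) hT (fun i ψ h1 h2 h3 => by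
    have hb : ∃ K, ∀ y, |fderiv ℝ ψ y (EuclideanSpace.single i 1)| ≤ K := 
      (h2.fderiv_apply ℝ (EuclideanSpace.single i 1)).exists_bound_of_continuous ((cont_fd h1).clm_apply continuous_const)
    have := hU (fun y => fderiv ℝ ψ y (EuclideanSpace.single i 1)) ((cont_fd h1).clm_apply continuous_const) hb
    rw [← this]
    exact h i ψ h1 h2 h3)
  have h2 : ∫ x in S, jacDet f x = ∫ y, (U y : ℝ) := by
    simpa using hU (fun _ => 1) continuous_const ⟨1, by simp⟩
  rw [h2]
  have h3 : |∫ y, (U y : ℝ)| ≤ ∫ y, |(U y : ℝ)| := abs_integral_le_integral_abs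
  refine h3.trans ?_
  rw [← ENNReal.ofReal_le_ofReal_iff (by positivity), ofReal_integral_eq_lintegral_ofReal (f := fun y => |(U y : ℝ)|) hUi.abs (Filter.Eventually.of_forall fun _ => abs_nonneg _)]
  refine (lintegral_mono fun y => ?_).trans h1
  simp only
  rcases eq_or_ne (U y) 0 with h0 | h0
  · simp [h0]
  · have : (1:ℝ) ≤ |(U y : ℝ)| := by exact_mod_cast Int.one_le_abs h0
    have h5 : (1:ℝ≥0∞) ≤ ENNReal.ofReal |(U y : ℝ)| := by rwa [ENNReal.one_le_ofReal]
    calc ENNReal.ofReal |(U y : ℝ)| = ENNReal.ofReal |(U y : ℝ)| ^ (1:ℝ) := by simp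
      _ ≤ _ := ENNReal.rpow_le_rpow_of_exponent_le h5 hp1.le

lemma smTr_bound : ∃ K > 0, (∀ t, |deriv Real.smoothTransition t| ≤ K) ∧ ∀ t, ¬ (0 < t ∧ t < 1) → deriv Real.smoothTransition t = 0 := by
  have h0 : ∀ t, ¬ (0 < t ∧ t < 1) → deriv Real.smoothTransition t = 0 := by
    intro t ht
    rcases le_or_gt t 0 with h | h
    · apply IsLocalMin.deriv_eq_zero
      refine Filter.Eventually.of_forall fun y => ?_
      rw [Real.smoothTransition.zero_of_nonpos h]; exact Real.smoothTransition.nonneg y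
    · have h1 : 1 ≤ t := by by_contra h1; exact ht ⟨h, not_le.1 h1⟩
      apply IsLocalMax.deriv_eq_zero
      refine Filter.Eventually.of_forall fun y => ?_
      rw [Real.smoothTransition.one_of_one_le h1]; exact Real.smoothTransition.le_one y
  have hc : Continuous (deriv Real.smoothTransition) :=
    (Real.smoothTransition.contDiff (n := 1)).continuous_deriv (by norm_num)
  obtain ⟨K, hK⟩ := (HasCompactSupport.of_support_subset_isCompact (isCompact_Icc (a := (0:ℝ)) (b := 1)) (fun t ht => by
    by_contra h
    refine ht (h0 t fun h' => h ⟨h'.1.le, h'.2.le⟩)) : HasCompactSupport (deriv Real.smoothTransition)).exists_bound_of_continuous hc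
  refine ⟨|K| + 1, by positivity, fun t => ?_, h0⟩
  have := hK t
  rw [Real.norm_eq_abs] at this
  linarith [le_abs_self K]

/-- cutoff of level sets -/
def lcut (u : EE n → ℝ) (s : ℝ) (k : ℕ) (x : EE n) : ℝ := Real.smoothTransition ((u x - s) * (k + 1))

/-- normalized mass of a level strip -/
def lstrip (g : EE n → ℝ) (u : EE n → ℝ) (s : ℝ) (k : ℕ) : ℝ≥0∞ :=
  ENNReal.ofReal (k + 1) * ∫⁻ x in {x | 0 < (u x - s) * (k + 1) ∧ (u x - s) * (k + 1) < 1}, ENNReal.ofReal (g x)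

lemma lcut_contDiff {u : EE n → ℝ} (hu : ContDiff ℝ sm u) (s : ℝ) (k : ℕ) : ContDiff ℝ sm (lcut u s k) :=
  Real.smoothTransition.contDiff.comp ((hu.sub contDiff_const).mul contDiff_const)

lemma lcut_cs {u : EE n → ℝ} {s R : ℝ} (hR : {x | s < u x} ⊆ closedBall (0 : EE n) R) (k : ℕ) : HasCompactSupport (lcut u s k) := by
  refine HasCompactSupport.of_support_subset_isCompact (isCompact_closedBall 0 R) fun x hx => hR ?_
  by_contra h
  refine hx (Real.smoothTransition.zero_of_nonpos ?_)
  have : u x ≤ s := not_lt.1 h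
  exact mul_nonpos_of_nonpos_of_nonneg (by linarith) (by positivity)

lemma lcut_fderiv {u : EE n → ℝ} (hu : ContDiff ℝ sm u) (s : ℝ) (k : ℕ) (x v : EE n) :
    fderiv ℝ (lcut u s k) x v = deriv Real.smoothTransition ((u x - s) * (k + 1)) * ((k + 1) * fderiv ℝ u x v) := by
  have h1 : HasFDerivAt (fun x => (u x - s) * ((k:ℝ) + 1)) (((k:ℝ) + 1) • fderiv ℝ u x) x :=
    (((hu.differentiable (by simp)) x).hasFDerivAt.sub_const s).mul_const ((k:ℝ) + 1)
  have h2 : HasDerivAt Real.smoothTransition (deriv Real.smoothTransition ((u x - s) * (k + 1))) ((u x - s) * (k + 1)) :=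
    ((Real.smoothTransition.contDiff (n := 1)).differentiable (by norm_num) _).hasDerivAt
  have h3 := h2.comp_hasFDerivAt x h1
  have h4 : HasFDerivAt (lcut u s k) (deriv Real.smoothTransition ((u x - s) * (k + 1)) • (((k:ℝ) + 1) • fderiv ℝ u x)) x := h3
  rw [h4.fderiv]
  simp [mul_assoc]

lemma lcut_tendsto (u : EE n → ℝ) (s : ℝ) (F : EE n → ℝ) (x : EE n) :
    Filter.Tendsto (fun k => lcut u s k x * F x) Filter.atTop (nhds ({x | s < u x}.indicator F x)) := by
  by_cases hx : s < u x
  · rw [Set.indicator_of_mem (show x ∈ {x | s < u x} from hx)]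
    refine tendsto_const_nhds.congr' ?_
    have : Filter.Tendsto (fun k : ℕ => (u x - s) * ((k:ℝ) + 1)) Filter.atTop Filter.atTop :=
      (Filter.tendsto_atTop_add_const_right _ _ tendsto_natCast_atTop_atTop).const_mul_atTop (by linarith)
    filter_upwards [this.eventually_ge_atTop 1] with k hk
    rw [lcut, Real.smoothTransition.one_of_one_le hk, one_mul]
  · rw [Set.indicator_of_notMem (show x ∉ {x | s < u x} from hx)]
    refine tendsto_const_nhds.congr fun k => ?_
    rw [lcut, Real.smoothTransition.zero_of_nonpos, zero_mul]
    exact mul_nonpos_of_nonpos_of_nonneg (by linarith [not_lt.1 hx]) (by positivity)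

lemma lcut_bound {f : EE n → EE n} (i : Fin n) {ψ : EE n → ℝ} (hψ1 : ∀ y, |ψ y| ≤ 1) {u : EE n → ℝ} (hu : ContDiff ℝ sm u) {s K D : ℝ}
    (hK0 : 0 < K) (hK : ∀ t, |deriv Real.smoothTransition t| ≤ K) (hKz : ∀ t, ¬ (0 < t ∧ t < 1) → deriv Real.smoothTransition t = 0)
    (hD0 : 0 ≤ D) (hD : ∀ x, s < u x → ‖fderiv ℝ u x‖ ≤ D) (k : ℕ) :
    ‖∫ x, ψ (f x) * fderiv ℝ (lcut u s k) x (Cf f i x)‖ₑ ≤ ENNReal.ofReal (K * D) * lstrip (cofNorm f) u s k := by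
  refine (enorm_integral_le_lintegral_enorm _).trans ?_
  have hms : MeasurableSet {x | 0 < (u x - s) * ((k:ℝ) + 1) ∧ (u x - s) * ((k:ℝ) + 1) < 1} := by
    have hc : Continuous (fun x => (u x - s) * ((k:ℝ) + 1)) := (hu.continuous.sub continuous_const).mul continuous_const
    exact ((isOpen_lt continuous_const hc).inter (isOpen_lt hc continuous_const)).measurableSet
  rw [lstrip, ← mul_assoc, ← ENNReal.ofReal_mul (by positivity), ← lintegral_const_mul _ (measurable_cofNorm f).ennreal_ofReal, ← lintegral_indicator hms]
  refine lintegral_mono fun x => ?_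
  simp only
  by_cases hx : 0 < (u x - s) * ((k:ℝ) + 1) ∧ (u x - s) * ((k:ℝ) + 1) < 1
  · rw [Set.indicator_of_mem (by exact hx), ← ENNReal.ofReal_mul (by positivity), ← ofReal_norm, lcut_fderiv hu]
    apply ENNReal.ofReal_le_ofReal
    rw [norm_mul, norm_mul, norm_mul, Real.norm_eq_abs, Real.norm_eq_abs, Real.norm_of_nonneg (by positivity : (0:ℝ) ≤ (k:ℝ)+1)]
    have hs : s < u x := by
      by_contra h
      exact absurd hx.1 (not_lt.2 (mul_nonpos_of_nonpos_of_nonneg (by linarith [not_lt.1 h]) (by positivity)))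
    have h1 : ‖fderiv ℝ u x (Cf f i x)‖ ≤ D * cofNorm f x :=
      ((fderiv ℝ u x).le_opNorm _).trans (mul_le_mul (hD x hs) (norm_Cf_le f x i) (norm_nonneg _) hD0)
    calc _ ≤ 1 * (K * ((k+1) * (D * cofNorm f x))) := by
          gcongr
          · exact hψ1 _
          · exact hK _
      _ = _ := by ring
  · rw [Set.indicator_of_notMem (by exact hx), lcut_fderiv hu, hKz _ hx]
    simp

lemma level_est (hn : 2 ≤ n) : ∃ C > 0, ∀ (f : EE n → EE n), Adm f → ∀ (u : EE n → ℝ) (s R D : ℝ), ContDiff ℝ sm u →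
    {x | s < u x} ⊆ closedBall (0 : EE n) R → 0 ≤ D → (∀ x, s < u x → ‖fderiv ℝ u x‖ ≤ D) →
    ENNReal.ofReal |∫ x in {x | s < u x}, jacDet f x| ≤
      ENNReal.ofReal (C * D ^ ((n:ℝ)/(n-1))) * Filter.liminf (fun k => lstrip (cofNorm f) u s k ^ ((n:ℝ)/(n-1))) Filter.atTop := by
  obtain ⟨C, hC, H⟩ := isop hn
  obtain ⟨K, hK0, hK, hKz⟩ := smTr_bound
  have hp1 := pexp_gt hn
  set p : ℝ := (n:ℝ)/(n-1) with hp
  refine ⟨C * K^p, by positivity, fun f A u s R D hu hR hD0 hD => ?_⟩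
  have hS : MeasurableSet {x | s < u x} := (isOpen_lt continuous_const hu.continuous).measurableSet
  obtain ⟨R', hR'⟩ := ((isCompact_closedBall (0 : EE n) R).image A.hf.continuous).isBounded.subset_closedBall 0
  set X := Filter.liminf (fun k => ENNReal.ofReal (K * D) * lstrip (cofNorm f) u s k) Filter.atTop with hX
  have key : ∀ i (ψ : EE n → ℝ), ContDiff ℝ sm ψ → HasCompactSupport ψ → (∀ y, |ψ y| ≤ 1) →
      ENNReal.ofReal |∫ x in {x | s < u x}, fderiv ℝ ψ (f x) (EuclideanSpace.single i 1) * jacDet f x| ≤ X := by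
    intro i ψ h1 h2 h3
    have hcd := (cont_fd h1).clm_apply (continuous_const (y := (EuclideanSpace.single i 1 : EE n)))
    obtain ⟨B, hB⟩ := (h2.fderiv_apply ℝ (EuclideanSpace.single i 1)).exists_bound_of_continuous hcd
    have hlim : Filter.Tendsto (fun k => ∫ x, lcut u s k x * (fderiv ℝ ψ (f x) (EuclideanSpace.single i 1) * jacDet f x)) Filter.atTop
        (nhds (∫ x, {x | s < u x}.indicator (fun x => fderiv ℝ ψ (f x) (EuclideanSpace.single i 1) * jacDet f x) x)) := by
      refine tendsto_integral_of_dominated_convergence (fun x => B * |jacDet f x|) (fun k => ?_) (A.int_J.abs.const_mul B) (fun k => ?_) ?_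
      · exact (lcut_contDiff hu s k).continuous.aestronglyMeasurable.mul
          ((hcd.comp A.hf.continuous).aestronglyMeasurable.mul (measurable_jacDet f).aestronglyMeasurable)
      · refine Filter.Eventually.of_forall fun x => ?_
        have hB' := hB (f x)
        rw [norm_mul, norm_mul, Real.norm_eq_abs (jacDet f x)]
        have : ‖lcut u s k x‖ ≤ 1 := by
          rw [lcut, Real.norm_of_nonneg (Real.smoothTransition.nonneg _)]; exact Real.smoothTransition.le_one _
        calc _ ≤ 1 * (B * |jacDet f x|) := by gcongr
          _ = _ := one_mul _
      · exact Filter.Eventually.of_forall fun x => lcut_tendsto u s _ x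
    rw [integral_indicator hS] at hlim
    have h5 := (ENNReal.continuous_ofReal.tendsto _).comp hlim.abs
    rw [← h5.liminf_eq, hX]
    refine Filter.liminf_le_liminf (Filter.Eventually.of_forall fun k => ?_)
    simp only [Function.comp]
    rw [GG_f A i (h1.of_le one_le_sm) h2 (lcut_contDiff hu s k) (lcut_cs hR k), abs_neg, ← Real.norm_eq_abs, ofReal_norm]
    exact lcut_bound i h3 hu hK0 hK hKz hD0 hD k
  have hX2 : ENNReal.ofReal (C * K^p * D^p) * Filter.liminf (fun k => lstrip (cofNorm f) u s k ^ p) Filter.atTop = ENNReal.ofReal C * X ^ p := by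
    have e1 : X ^ p = Filter.liminf (fun k => (ENNReal.ofReal (K * D) * lstrip (cofNorm f) u s k)^p) Filter.atTop := by
      have := (ENNReal.orderIsoRpow p (by linarith)).liminf_apply (f := Filter.atTop) (u := fun k => ENNReal.ofReal (K * D) * lstrip (cofNorm f) u s k)
      simpa [ENNReal.orderIsoRpow] using this
    rw [e1]
    simp_rw [ENNReal.mul_rpow_of_nonneg _ _ (by linarith : (0:ℝ) ≤ p), ENNReal.ofReal_rpow_of_nonneg (by positivity : 0 ≤ K * D) (by linarith : (0:ℝ) ≤ p)]
    rw [ENNReal.liminf_const_mul_of_ne_top ENNReal.ofReal_ne_top, ← mul_assoc, ← ENNReal.ofReal_mul hC.le, Real.mul_rpow hK0.le hD0, mul_assoc]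
  rw [hX2]
  by_cases hXt : X = ∞
  · rw [hXt, ENNReal.top_rpow_of_pos (by linarith), ENNReal.mul_top (by simpa using hC)]; exact le_top
  have := H f {x | s < u x} R' X.toReal A.hf hS A.int_J.integrableOn ((Set.image_mono hR).trans hR') ENNReal.toReal_nonneg (fun i ψ h1 h2 h3 => by
    rw [← ENNReal.ofReal_le_iff_le_toReal hXt]
    exact key i ψ h1 h2 h3)
  refine (ENNReal.ofReal_le_ofReal this).trans ?_
  rw [ENNReal.ofReal_mul hC.le, ← ENNReal.ofReal_rpow_of_nonneg ENNReal.toReal_nonneg (by linarith), ENNReal.ofReal_toReal hXt]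

lemma slab (κ δ : ℝ) (v : EE n) (hδ : 0 < δ) :
    volume {a : EE n | a ∈ ball (0 : EE n) 1 ∧ |κ + inner ℝ a v| < δ} ≤ ENNReal.ofReal (2 * δ) * volume (ball (0 : EE n) 2) * (‖v‖ₑ)⁻¹ := by
  have hb2 : volume (ball (0 : EE n) 2) ≠ 0 := (measure_ball_pos _ _ (by norm_num)).ne'
  rcases eq_or_ne v 0 with rfl | hv
  · rw [enorm_zero, ENNReal.inv_zero, ENNReal.mul_top (mul_ne_zero (by simpa using hδ) hb2)]; exact le_top
  have hv0 : 0 < ‖v‖ := norm_pos_iff.2 hv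
  set S := {a : EE n | a ∈ ball (0 : EE n) 1 ∧ |κ + inner ℝ a v| < δ} with hS
  have hSm : MeasurableSet S := by
    have hc : Continuous (fun a : EE n => |κ + inner ℝ a v|) := by fun_prop
    exact (isOpen_ball.inter (isOpen_lt hc continuous_const)).measurableSet
  set c := 2 * δ / ‖v‖^2 with hc
  have hc0 : 0 < c := by positivity
  set N := ⌊‖v‖ / (2 * δ)⌋₊ + 1 with hN
  set T : ℕ → Set (EE n) := fun m => (fun a => a - ((m : ℝ) * c) • v) ⁻¹' S with hT
  have hTm : ∀ m, MeasurableSet (T m) := fun m => hSm.preimage (measurable_id.sub_const _)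
  have hTv : ∀ m, volume (T m) = volume S := fun m => (measurePreserving_sub_right volume (((m : ℝ) * c) • v)).measure_preimage hSm.nullMeasurableSet
  have hin : ∀ m (a : EE n), a ∈ T m → |κ + inner ℝ a v - 2 * m * δ| < δ := by
    intro m a ha
    have := ha.2
    rw [inner_sub_left, inner_smul_left, real_inner_self_eq_norm_sq] at this
    have e : (m : ℝ) * c * ‖v‖^2 = 2 * m * δ := by rw [hc]; field_simp
    simp only [conj_trivial] at this
    rw [e] at this
    convert this using 2; ring
  have hdis : Set.PairwiseDisjoint (↑(Finset.range N)) T := by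
    intro i _ j _ hij
    refine Set.disjoint_left.2 fun a h1 h2 => ?_
    have h1 := abs_lt.1 (hin i a h1)
    have h2 := abs_lt.1 (hin j a h2)
    rcases lt_or_gt_of_ne hij with h | h
    · have : (i : ℝ) + 1 ≤ j := by exact_mod_cast h
      nlinarith
    · have : (j : ℝ) + 1 ≤ i := by exact_mod_cast h
      nlinarith
  have hsub : (⋃ m ∈ Finset.range N, T m) ⊆ ball (0 : EE n) 2 := by
    intro a ha
    simp only [Set.mem_iUnion, Finset.mem_range, exists_prop] at ha
    obtain ⟨m, hm, ha⟩ := ha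
    have h1 : ‖a - ((m : ℝ) * c) • v‖ < 1 := by simpa using ha.1
    have h2 : ‖((m : ℝ) * c) • v‖ ≤ 1 := by
      rw [norm_smul, Real.norm_of_nonneg (by positivity)]
      have h3 : (m : ℝ) ≤ ‖v‖ / (2 * δ) := by
        have : m ≤ ⌊‖v‖ / (2 * δ)⌋₊ := by omega
        exact (Nat.cast_le.2 this).trans (Nat.floor_le (by positivity))
      calc (m : ℝ) * c * ‖v‖ ≤ ‖v‖ / (2 * δ) * c * ‖v‖ := by gcongr
        _ = 1 := by rw [hc]; field_simp
    rw [mem_ball_zero_iff]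
    calc ‖a‖ = ‖(a - ((m : ℝ) * c) • v) + ((m : ℝ) * c) • v‖ := by rw [sub_add_cancel]
      _ ≤ _ := norm_add_le _ _
      _ < 2 := by linarith
  have h1 : (N : ℝ≥0∞) * volume S ≤ volume (ball (0 : EE n) 2) := by
    refine le_trans (le_of_eq ?_) (measure_mono hsub)
    rw [measure_biUnion_finset hdis fun m _ => hTm m]
    simp [hTv]
  have h2 : ENNReal.ofReal (‖v‖ / (2 * δ)) ≤ N := by
    rw [← ENNReal.ofReal_natCast]
    apply ENNReal.ofReal_le_ofReal
    rw [hN]; push_cast; exact (Nat.lt_floor_add_one _).le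
  have h3 : ENNReal.ofReal (‖v‖ / (2 * δ)) * volume S ≤ volume (ball (0 : EE n) 2) := le_trans (by gcongr) h1
  have e1 : (‖v‖ₑ)⁻¹ = ENNReal.ofReal (‖v‖⁻¹) := by rw [← ofReal_norm, ENNReal.ofReal_inv_of_pos hv0]
  calc volume S = ENNReal.ofReal (2 * δ * ‖v‖⁻¹) * (ENNReal.ofReal (‖v‖ / (2 * δ)) * volume S) := by
        rw [← mul_assoc, ← ENNReal.ofReal_mul (by positivity)]
        have : 2 * δ * ‖v‖⁻¹ * (‖v‖ / (2 * δ)) = 1 := by field_simp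
        rw [this]; simp
    _ ≤ ENNReal.ofReal (2 * δ * ‖v‖⁻¹) * volume (ball (0 : EE n) 2) := by gcongr
    _ = _ := by rw [e1, ENNReal.ofReal_mul (by positivity)]; ring

lemma kern_fin (hn : 2 ≤ n) {q : ℝ} (hq : q < n) (r : ℝ) : ∫⁻ w in ball (0 : EE n) r, ((‖w‖ₑ)⁻¹) ^ q ≠ ∞ := by
  have hne : Nonempty (Fin n) := ⟨⟨0, by omega⟩⟩
  have hnt : Nontrivial (EE n) := inferInstance
  have h1 : IntegrableOn (fun w : EE n => ‖w‖ ^ (-q)) (ball 0 r) := by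
    refine integrableOn_ball_of_norm_le_rpow (C := 1) (α := q) ?_ ?_ ?_ ?_
    · rw [finrank_euclideanSpace, Fintype.card_fin]; omega
    · rw [finrank_euclideanSpace, Fintype.card_fin]; exact hq
    · refine Filter.Eventually.of_forall fun x => ?_
      rw [one_mul, Real.norm_of_nonneg (by positivity)]
    · exact (measurable_norm.pow_const _).aestronglyMeasurable
  have h2 := h1.lintegral_lt_top
  refine ne_of_lt (lt_of_eq_of_lt ?_ h2)
  refine lintegral_congr_ae (ae_restrict_of_ae ?_)
  filter_upwards [Measure.ae_ne volume (0 : EE n)] with w hw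
  have h0 : 0 < ‖w‖ := norm_pos_iff.2 hw
  rw [← ofReal_norm, ← ENNReal.ofReal_inv_of_pos h0, ENNReal.ofReal_rpow_of_pos (by positivity), Real.inv_rpow h0.le, Real.rpow_neg h0.le]

lemma kern_sup (hn : 2 ≤ n) {q : ℝ} (hq : q < n) : ∃ M : ℝ, 0 < M ∧ ∀ y ∈ closedBall (0 : EE n) 4,
    ∫⁻ z in closedBall (0 : EE n) 4, ((‖y - z‖ₑ)⁻¹) ^ q ≤ ENNReal.ofReal M := by
  set I := ∫⁻ w in ball (0 : EE n) 9, ((‖w‖ₑ)⁻¹) ^ q with hI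
  have hIf : I ≠ ∞ := kern_fin hn hq 9
  refine ⟨I.toReal + 1, by positivity, fun y hy => ?_⟩
  have h1 : ∫⁻ z in closedBall (0 : EE n) 4, ((‖y - z‖ₑ)⁻¹) ^ q ≤ I := by
    have e1 : I = ∫⁻ w, (ball (0 : EE n) 9).indicator (fun w => ((‖w‖ₑ)⁻¹) ^ q) w := by rw [lintegral_indicator measurableSet_ball]
    rw [e1, ← lintegral_sub_left_eq_self (μ := volume) ((ball (0 : EE n) 9).indicator (fun w => ((‖w‖ₑ)⁻¹) ^ q)) y, ← lintegral_indicator measurableSet_closedBall]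
    refine lintegral_mono fun z => ?_
    by_cases hz : z ∈ closedBall (0 : EE n) 4
    swap
    · rw [Set.indicator_of_notMem hz]; exact bot_le
    rw [Set.indicator_of_mem hz]
    rw [Set.indicator_of_mem]
    rw [mem_closedBall_zero_iff] at hy hz
    rw [mem_ball_zero_iff]
    have := norm_sub_le y z
    linarith
  refine h1.trans ?_
  rw [ENNReal.ofReal_add ENNReal.toReal_nonneg zero_le_one, ENNReal.ofReal_toReal hIf]
  exact le_self_add

lemma riesz (hn : 2 ≤ n) : ∃ M : ℝ, 0 < M ∧ ∀ G : EE n → ℝ≥0∞, Measurable G →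
    ∫⁻ y in closedBall (0 : EE n) 4, ∫⁻ z in closedBall (0 : EE n) 4, G y * G z * (‖y - z‖ₑ)⁻¹
      ≤ ENNReal.ofReal M * (∫⁻ y in closedBall (0 : EE n) 4, G y ^ (3 * n / (3 * n - 2) : ℝ)) ^ (2 / (3 * n / (3 * n - 2)) : ℝ) := by
  have hn2 : (2:ℝ) ≤ n := by exact_mod_cast hn
  set q : ℝ := 3 * n / 4 with hq
  obtain ⟨M, hM, H⟩ := kern_sup hn (q := q) (by rw [hq]; linarith)
  set s : ℝ := 3 * n / (3 * n - 2) with hs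
  set a : ℝ := 1 / (2 * q) with ha
  set b : ℝ := 1 - 1 / q with hb
  have hq1 : 1 ≤ q := by rw [hq]; linarith
  have hq0 : 0 < q := by linarith
  have hs0 : 0 < s := by rw [hs]; apply div_pos <;> linarith
  have ha0 : 0 ≤ a := by positivity
  have hb0 : 0 ≤ b := by rw [hb, sub_nonneg, div_le_one hq0]; exact hq1
  have hab : s * a + s * b = 1 := by
    have h3 : (3 * (n:ℝ) - 2) ≠ 0 := by linarith
    have h4 : (n:ℝ) ≠ 0 := by linarith
    rw [hs, ha, hb, hq]; field_simp; ring
  have hqa : q * a + q * a = 1 := by rw [ha]; field_simp; ring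
  have hsum : a + (a + b) = 1 := by rw [ha, hb]; field_simp; ring
  refine ⟨M ^ (2 * a), by positivity, fun G hG => ?_⟩
  set μ : Measure (EE n) := volume.restrict (closedBall (0 : EE n) 4) with hμ
  have hk : Measurable fun w : EE n × EE n => (‖w.1 - w.2‖ₑ)⁻¹ := (measurable_fst.sub measurable_snd).enorm.inv
  have hG1 : Measurable fun w : EE n × EE n => G w.1 := hG.comp measurable_fst
  have hG2 : Measurable fun w : EE n × EE n => G w.2 := hG.comp measurable_snd
  set F1 : EE n × EE n → ℝ≥0∞ := fun w => G w.1 ^ s * ((‖w.1 - w.2‖ₑ)⁻¹)^q with hF1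
  set F2 : EE n × EE n → ℝ≥0∞ := fun w => G w.2 ^ s * ((‖w.1 - w.2‖ₑ)⁻¹)^q with hF2
  set F3 : EE n × EE n → ℝ≥0∞ := fun w => G w.1 ^ s * G w.2 ^ s with hF3
  have m1 : Measurable F1 := (hG1.pow_const _).mul (hk.pow_const _)
  have m2 : Measurable F2 := (hG2.pow_const _).mul (hk.pow_const _)
  have m3 : Measurable F3 := (hG1.pow_const _).mul (hG2.pow_const _)
  set I := ∫⁻ y, G y ^ s ∂μ with hI
  have i1 : ∫⁻ w, F1 w ∂(μ.prod μ) ≤ ENNReal.ofReal M * I := by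
    rw [lintegral_prod _ m1.aemeasurable, hI, ← lintegral_const_mul _ (hG.pow_const _), hμ]
    refine setLIntegral_mono' measurableSet_closedBall fun y hy => ?_
    simp only [hF1]
    rw [lintegral_const_mul _ (by fun_prop), mul_comm]
    gcongr
    exact H y hy
  have i2 : ∫⁻ w, F2 w ∂(μ.prod μ) ≤ ENNReal.ofReal M * I := by
    rw [lintegral_prod_symm _ m2.aemeasurable, hI, ← lintegral_const_mul _ (hG.pow_const _), hμ]
    refine setLIntegral_mono' measurableSet_closedBall fun y hy => ?_
    simp only [hF2]
    rw [lintegral_const_mul _ (by fun_prop), mul_comm]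
    gcongr
    simp_rw [fun x : EE n => enorm_sub_rev x y]
    exact H y hy
  have i3 : ∫⁻ w, F3 w ∂(μ.prod μ) = I * I := lintegral_prod_mul (hG.pow_const _).aemeasurable (hG.pow_const _).aemeasurable
  calc ∫⁻ y, ∫⁻ z, G y * G z * (‖y - z‖ₑ)⁻¹ ∂μ ∂μ = ∫⁻ w, G w.1 * G w.2 * (‖w.1 - w.2‖ₑ)⁻¹ ∂(μ.prod μ) := by
        rw [lintegral_prod (fun w : EE n × EE n => G w.1 * G w.2 * (‖w.1 - w.2‖ₑ)⁻¹) ((hG1.mul hG2).mul hk).aemeasurable]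
    _ = ∫⁻ w, ∏ i, (![F1, F2, F3] i w) ^ (![a, a, b] i) ∂(μ.prod μ) := by
        refine lintegral_congr fun w => ?_
        rw [Fin.prod_univ_three]
        simp only [Matrix.cons_val_zero, Matrix.cons_val_one, Matrix.cons_val, hF1, hF2, hF3]
        rw [ENNReal.mul_rpow_of_nonneg _ _ ha0, ENNReal.mul_rpow_of_nonneg _ _ ha0, ENNReal.mul_rpow_of_nonneg _ _ hb0]
        simp_rw [← ENNReal.rpow_mul]
        have e : ∀ (t : ℝ≥0∞) (x y : ℝ), 0 ≤ x → 0 ≤ y → x + y = 1 → t = t^x * t^y := by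
          intro t x y hx hy hxy
          rw [← ENNReal.rpow_add_of_nonneg _ _ hx hy, hxy, ENNReal.rpow_one]
        conv_lhs => rw [e (G w.1) _ _ (by positivity) (by positivity) hab, e (G w.2) _ _ (by positivity) (by positivity) hab,
          e (‖w.1 - w.2‖ₑ)⁻¹ _ _ (by positivity) (by positivity) hqa]
        ring
    _ ≤ ∏ i, (∫⁻ w, ![F1, F2, F3] i w ∂(μ.prod μ)) ^ (![a, a, b] i) := by
        refine ENNReal.lintegral_prod_norm_pow_le Finset.univ (fun i _ => ?_) ?_ fun i _ => ?_
        · fin_cases i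
          exacts [m1.aemeasurable, m2.aemeasurable, m3.aemeasurable]
        · rw [Fin.sum_univ_three]; simp; linarith
        · fin_cases i <;> simpa
    _ ≤ (ENNReal.ofReal M * I)^a * (ENNReal.ofReal M * I)^a * (I * I)^b := by
        rw [Fin.prod_univ_three]
        simp only [Matrix.cons_val_zero, Matrix.cons_val_one, Matrix.cons_val]
        rw [i3]
        gcongr
    _ = _ := by
        rw [ENNReal.mul_rpow_of_nonneg _ _ ha0, ENNReal.mul_rpow_of_nonneg _ _ hb0]
        have e1 : (2 / s) = (a + b) + (a + b) := by
          field_simp; nlinarith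
        rw [e1, ENNReal.rpow_add_of_nonneg _ _ (by positivity) (by positivity), ENNReal.rpow_add_of_nonneg _ _ (by positivity) (by positivity),
          ← ENNReal.ofReal_rpow_of_pos hM, two_mul, ENNReal.rpow_add_of_nonneg _ _ (by positivity) (by positivity)]
        ring

/-- parabolic perturbation -/
def parab (θ : EE n → ℝ) (a x : EE n) : ℝ := θ x - ‖x - a‖ ^ 2

/-- strip indicator -/
def chi (θ : EE n → ℝ) (k : ℕ) (w : EE n × ℝ) (x : EE n) : ℝ≥0∞ :=
  {x | 0 < (parab θ w.1 x - w.2) * ((k:ℝ) + 1) ∧ (parab θ w.1 x - w.2) * ((k:ℝ) + 1) < 1}.indicator (fun _ => 1) x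

/-- parameter measure -/
def parM (n : ℕ) : Measure (EE n × ℝ) := (volume.restrict (ball (0 : EE n) 1)).prod (volume.restrict (Set.Ioo (-6 : ℝ) 2))

instance : IsFiniteMeasure (volume.restrict (ball (0 : EE n) 1)) := ⟨by simpa using measure_ball_lt_top⟩
instance : IsFiniteMeasure (parM n) := by unfold parM; infer_instance

lemma parab_cont {θ : EE n → ℝ} (hθ : Continuous θ) : Continuous (fun v : EE n × EE n => parab θ v.1 v.2) := by
  unfold parab; fun_prop

lemma chi_meas {θ : EE n → ℝ} (hθ : Continuous θ) (k : ℕ) : Measurable (fun v : (EE n × ℝ) × EE n => chi θ k v.1 v.2) := by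
  have hc : Continuous (fun v : (EE n × ℝ) × EE n => (parab θ v.1.1 v.2 - v.1.2) * ((k:ℝ) + 1)) := by
    have := (parab_cont hθ).comp ((continuous_fst.comp continuous_fst).prodMk continuous_snd : Continuous (fun v : (EE n × ℝ) × EE n => (v.1.1, v.2)))
    exact (this.sub (continuous_snd.comp continuous_fst)).mul continuous_const
  have hm : MeasurableSet {v : (EE n × ℝ) × EE n | 0 < (parab θ v.1.1 v.2 - v.1.2) * ((k:ℝ) + 1) ∧ (parab θ v.1.1 v.2 - v.1.2) * ((k:ℝ) + 1) < 1} :=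
    ((isOpen_lt continuous_const hc).inter (isOpen_lt hc continuous_const)).measurableSet
  exact (measurable_const (a := (1 : ℝ≥0∞))).indicator hm

lemma chi_strip {θ : EE n → ℝ} (hθ : Continuous θ) (g : EE n → ℝ) (k : ℕ) (w : EE n × ℝ) :
    lstrip g (parab θ w.1) w.2 k = ENNReal.ofReal (k + 1) * ∫⁻ x, chi θ k w x * ENNReal.ofReal (g x) := by
  rw [lstrip, ← lintegral_indicator]
  · congr 2; ext x
    by_cases hx : x ∈ {x | 0 < (parab θ w.1 x - w.2) * ((k:ℝ) + 1) ∧ (parab θ w.1 x - w.2) * ((k:ℝ) + 1) < 1}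
    · rw [chi, Set.indicator_of_mem hx, Set.indicator_of_mem hx, one_mul]
    · rw [chi, Set.indicator_of_notMem hx, Set.indicator_of_notMem hx, zero_mul]
  · have hc : Continuous (fun x => (parab θ w.1 x - w.2) * ((k:ℝ) + 1)) := by
      unfold parab; fun_prop
    exact ((isOpen_lt continuous_const hc).inter (isOpen_lt hc continuous_const)).measurableSet

lemma lstrip_meas {θ : EE n → ℝ} (hθ : Continuous θ) {g : EE n → ℝ} (hg : Measurable g) (k : ℕ) :
    Measurable (fun w : EE n × ℝ => lstrip g (parab θ w.1) w.2 k) := by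
  simp_rw [chi_strip hθ]
  refine Measurable.const_mul ?_ _
  exact Measurable.lintegral_prod_right' (f := fun v : (EE n × ℝ) × EE n => chi θ k v.1 v.2 * ENNReal.ofReal (g v.2))
    ((chi_meas hθ k).mul (hg.comp measurable_snd).ennreal_ofReal)

lemma parab_super {θ : EE n → ℝ} (hθ : ∀ x, |θ x| ≤ 2) {a : EE n} (ha : a ∈ ball (0 : EE n) 1) {s : ℝ} (hs : -6 < s) {x : EE n} (hx : s < parab θ a x) :
    ‖x - a‖ < 3 ∧ x ∈ closedBall (0 : EE n) 4 := by
  have h1 := (abs_le.1 (hθ x)).2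
  rw [parab] at hx
  have h2 : ‖x - a‖ < 3 := by nlinarith [norm_nonneg (x - a)]
  refine ⟨h2, ?_⟩
  rw [mem_closedBall_zero_iff]
  rw [mem_ball_zero_iff] at ha
  have := norm_add_le (x - a) a
  rw [sub_add_cancel] at this
  linarith

lemma chi_zero {θ : EE n → ℝ} (hθ : ∀ x, |θ x| ≤ 2) {a : EE n} (ha : a ∈ ball (0 : EE n) 1) {s : ℝ} (hs : -6 < s) (k : ℕ) {x : EE n} 
    (hx : x ∉ closedBall (0 : EE n) 4) : chi θ k (a, s) x = 0 := by
  rw [chi, Set.indicator_of_notMem]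
  intro h
  refine hx (parab_super hθ ha hs ?_).2
  by_contra h1
  exact absurd h.1 (not_lt.2 (mul_nonpos_of_nonpos_of_nonneg (by linarith [not_lt.1 h1]) (by positivity)))

lemma chi_le (θ : EE n → ℝ) (k : ℕ) (a y z : EE n) :
    ∫⁻ s, chi θ k (a, s) y * chi θ k (a, s) z ≤ {a | |(θ y - θ z - ‖y‖^2 + ‖z‖^2) + inner ℝ a ((2:ℝ) • (y - z))| < 1 / ((k:ℝ)+1)}.indicator (fun _ => ENNReal.ofReal (1 / ((k:ℝ)+1))) a := by
  have hk : (0:ℝ) < (k:ℝ) + 1 := by positivity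
  have e : (θ y - θ z - ‖y‖^2 + ‖z‖^2) + inner ℝ a ((2:ℝ) • (y - z)) = parab θ a y - parab θ a z := by
    rw [parab, parab, @norm_sub_sq_real, @norm_sub_sq_real, inner_smul_right, inner_sub_right, real_inner_comm y a, real_inner_comm z a]; ring
  have hchi : ∀ s x, chi θ k (a, s) x = (Set.Ioo (parab θ a x - 1 / ((k:ℝ)+1)) (parab θ a x)).indicator (fun _ => (1:ℝ≥0∞)) s := by
    intro s x
    have : x ∈ {x | 0 < (parab θ a x - s) * ((k:ℝ) + 1) ∧ (parab θ a x - s) * ((k:ℝ) + 1) < 1} ↔ s ∈ Set.Ioo (parab θ a x - 1 / ((k:ℝ)+1)) (parab θ a x) := by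
      rw [Set.mem_Ioo, sub_lt_comm, lt_div_iff₀ hk]
      constructor
      · rintro ⟨h1, h2⟩; exact ⟨h2, by
          have := (mul_pos_iff_of_pos_right hk).1 h1
          linarith⟩
      · rintro ⟨h1, h2⟩; exact ⟨mul_pos (by linarith) hk, h1⟩
    rw [chi]
    by_cases h : s ∈ Set.Ioo (parab θ a x - 1 / ((k:ℝ)+1)) (parab θ a x)
    · rw [Set.indicator_of_mem h, Set.indicator_of_mem (this.2 h)]
    · rw [Set.indicator_of_notMem h, Set.indicator_of_notMem (fun h' => h (this.1 h'))]
  simp_rw [hchi]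
  by_cases h : |parab θ a y - parab θ a z| < 1 / ((k:ℝ)+1)
  · rw [Set.indicator_of_mem (by rw [Set.mem_ofPred_eq, e]; exact h)]
    calc _ ≤ ∫⁻ s, (Set.Ioo (parab θ a y - 1 / ((k:ℝ)+1)) (parab θ a y)).indicator (fun _ => (1:ℝ≥0∞)) s := by
          refine lintegral_mono fun s => ?_
          refine mul_le_of_le_one_right bot_le ?_
          exact Set.indicator_le_self _ _ _
      _ = _ := by
          rw [lintegral_indicator_const measurableSet_Ioo, Real.volume_Ioo, one_mul]; congr 1; ring
  · refine le_of_eq_of_le (b := (0:ℝ≥0∞)) ?_ bot_le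
    rw [← lintegral_zero (μ := (volume : Measure ℝ))]
    refine lintegral_congr fun s => ?_
    by_cases h1 : s ∈ Set.Ioo (parab θ a y - 1 / ((k:ℝ)+1)) (parab θ a y)
    · by_cases h2 : s ∈ Set.Ioo (parab θ a z - 1 / ((k:ℝ)+1)) (parab θ a z)
      · exfalso
        apply h
        rw [abs_lt]
        constructor <;> linarith [h1.1, h1.2, h2.1, h2.2]
      · rw [Set.indicator_of_notMem h2, mul_zero]
    · rw [Set.indicator_of_notMem h1, zero_mul]

attribute [irreducible] chi

lemma chi_ml {θ : EE n → ℝ} (hθ : Continuous θ) (k : ℕ) (y : EE n) : Measurable fun w : EE n × ℝ => chi θ k w y := by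
  have h : Measurable (fun w : EE n × ℝ => (w, y)) := measurable_id.prodMk measurable_const
  exact (chi_meas hθ k).comp h

lemma chi_mr {θ : EE n → ℝ} (hθ : Continuous θ) (k : ℕ) (w : EE n × ℝ) : Measurable fun y : EE n => chi θ k w y := by
  have h : Measurable (fun y : EE n => (w, y)) := measurable_const.prodMk measurable_id
  exact (chi_meas hθ k).comp h

lemma chi_m1 {θ : EE n → ℝ} (hθ : Continuous θ) (k : ℕ) : Measurable (fun v : (EE n × ℝ) × (EE n × EE n) => chi θ k v.1 v.2.1) := by
  have h : Measurable (fun v : (EE n × ℝ) × (EE n × EE n) => (v.1, v.2.1)) := (measurable_fst.prodMk (measurable_fst.comp measurable_snd))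
  exact (chi_meas hθ k).comp h

lemma chi_m2 {θ : EE n → ℝ} (hθ : Continuous θ) (k : ℕ) : Measurable (fun v : (EE n × ℝ) × (EE n × EE n) => chi θ k v.1 v.2.2) := by
  have h : Measurable (fun v : (EE n × ℝ) × (EE n × EE n) => (v.1, v.2.2)) := (measurable_fst.prodMk (measurable_snd.comp measurable_snd))
  exact (chi_meas hθ k).comp h

lemma chi_inner {θ : EE n → ℝ} (hθ : Continuous θ) (k : ℕ) (y z : EE n) :
    ENNReal.ofReal (k+1)^2 * ∫⁻ w, chi θ k w y * chi θ k w z ∂(parM n) ≤ 2 * volume (ball (0 : EE n) 2) * (‖y - z‖ₑ)⁻¹ := by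
  have hk : (0:ℝ) < (k:ℝ) + 1 := by positivity
  set κ := (θ y - θ z - ‖y‖^2 + ‖z‖^2) with hκ
  have hm : Measurable fun w : EE n × ℝ => chi θ k w y * chi θ k w z :=
    (chi_ml hθ k _).mul (chi_ml hθ k _)
  have hms : MeasurableSet {a : EE n | |κ + inner ℝ a ((2:ℝ) • (y - z))| < 1 / ((k:ℝ)+1)} := by
    have hc : Continuous (fun a : EE n => |κ + inner ℝ a ((2:ℝ) • (y - z))|) := by fun_prop
    exact (isOpen_lt hc continuous_const).measurableSet
  have h1 : ∫⁻ w, chi θ k w y * chi θ k w z ∂(parM n) ≤ ENNReal.ofReal (1 / ((k:ℝ)+1)) * volume {a : EE n | a ∈ ball (0 : EE n) 1 ∧ |κ + inner ℝ a ((2:ℝ) • (y - z))| < 1 / ((k:ℝ)+1)} := by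
    rw [parM, lintegral_prod _ hm.aemeasurable]
    calc _ ≤ ∫⁻ a in ball (0 : EE n) 1, {a : EE n | |κ + inner ℝ a ((2:ℝ) • (y - z))| < 1 / ((k:ℝ)+1)}.indicator (fun _ => ENNReal.ofReal (1 / ((k:ℝ)+1))) a :=
          lintegral_mono fun a => (setLIntegral_le_lintegral _ _).trans (chi_le θ k a y z)
      _ = _ := by
          rw [lintegral_indicator_const hms, Measure.restrict_apply hms]
          congr 2
          ext a; exact and_comm
  have h2 := slab κ (1 / ((k:ℝ)+1)) ((2:ℝ) • (y - z)) (by positivity)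
  have h3 : (‖(2:ℝ) • (y - z)‖ₑ)⁻¹ ≤ (‖y - z‖ₑ)⁻¹ := by
    rw [ENNReal.inv_le_inv, enorm_smul]
    refine le_mul_of_one_le_left bot_le ?_
    rw [← ofReal_norm]; simp
  calc _ ≤ ENNReal.ofReal (k+1)^2 * (ENNReal.ofReal (1 / ((k:ℝ)+1)) * (ENNReal.ofReal (2 * (1 / ((k:ℝ)+1))) * volume (ball (0 : EE n) 2) * (‖y - z‖ₑ)⁻¹)) := by
        gcongr
        refine h1.trans ?_
        gcongr
        refine h2.trans ?_
        gcongr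
    _ = (ENNReal.ofReal (k+1)^2 * ENNReal.ofReal (1 / ((k:ℝ)+1)) * ENNReal.ofReal (2 * (1 / ((k:ℝ)+1)))) * volume (ball (0 : EE n) 2) * (‖y - z‖ₑ)⁻¹ := by ring
    _ = _ := by
        congr 2
        rw [← ENNReal.ofReal_pow hk.le, ← ENNReal.ofReal_mul (by positivity), ← ENNReal.ofReal_mul (by positivity)]
        have : ((k:ℝ)+1)^2 * (1 / ((k:ℝ)+1)) * (2 * (1 / ((k:ℝ)+1))) = 2 := by field_simp
        rw [this]; simp

lemma strip_sq {θ : EE n → ℝ} (hθ : Continuous θ) (hθ2 : ∀ x, |θ x| ≤ 2) {g : EE n → ℝ} (hg : Measurable g) (k : ℕ) :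
    ∫⁻ w, lstrip g (parab θ w.1) w.2 k ^ 2 ∂(parM n) ≤ 2 * volume (ball (0 : EE n) 2) *
      ∫⁻ y in closedBall (0 : EE n) 4, ∫⁻ z in closedBall (0 : EE n) 4, ENNReal.ofReal (g y) * ENNReal.ofReal (g z) * (‖y - z‖ₑ)⁻¹ := by
  set G : EE n → ℝ≥0∞ := fun y => ENNReal.ofReal (g y) with hG
  have hGm : Measurable G := hg.ennreal_ofReal
  set μ : Measure (EE n) := volume.restrict (closedBall (0 : EE n) 4) with hμ
  have mχ : ∀ w, Measurable (chi θ k w) := fun w => chi_mr hθ k w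
  have mχ1 : Measurable (fun v : (EE n × ℝ) × (EE n × EE n) => chi θ k v.1 v.2.1) := chi_m1 hθ k
  have mχ2 : Measurable (fun v : (EE n × ℝ) × (EE n × EE n) => chi θ k v.1 v.2.2) := chi_m2 hθ k
  have mG : Measurable (fun v : EE n × EE n => G v.1 * G v.2) := (hGm.comp measurable_fst).mul (hGm.comp measurable_snd)
  have mF : Measurable (Function.uncurry fun (w : EE n × ℝ) (v : EE n × EE n) => (G v.1 * G v.2) * (chi θ k w v.1 * chi θ k w v.2)) :=
    (mG.comp measurable_snd).mul (mχ1.mul mχ2)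
  have hae : ∀ᵐ w ∂(parM n), lstrip g (parab θ w.1) w.2 k ^ 2 = ENNReal.ofReal (k+1)^2 * ∫⁻ v, (G v.1 * G v.2) * (chi θ k w v.1 * chi θ k w v.2) ∂(μ.prod μ) := by
    have hw : ∀ᵐ w ∂(parM n), w ∈ ball (0 : EE n) 1 ×ˢ Set.Ioo (-6 : ℝ) 2 := by
      rw [parM, Measure.prod_restrict]
      exact ae_restrict_mem (measurableSet_ball.prod measurableSet_Ioo)
    filter_upwards [hw] with w hw
    rw [chi_strip hθ, mul_pow]
    congr 1
    have e1 : ∫⁻ x, chi θ k w x * G x = ∫⁻ x, chi θ k w x * G x ∂μ := by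
      rw [hμ, ← lintegral_indicator measurableSet_closedBall]
      refine lintegral_congr fun x => ?_
      by_cases hx : x ∈ closedBall (0 : EE n) 4
      · rw [Set.indicator_of_mem hx]
      · rw [Set.indicator_of_notMem hx, show w = (w.1, w.2) from rfl, chi_zero hθ2 hw.1 hw.2.1 k hx, zero_mul]
    have m1 : Measurable fun x => chi θ k w x * G x := (mχ w).mul hGm
    rw [e1, sq, ← lintegral_prod_mul m1.aemeasurable m1.aemeasurable]
    refine lintegral_congr fun v => ?_
    ring
  have mFr : Measurable fun w : EE n × ℝ => ∫⁻ v, (G v.1 * G v.2) * (chi θ k w v.1 * chi θ k w v.2) ∂(μ.prod μ) := mF.lintegral_prod_right'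
  rw [lintegral_congr_ae hae, lintegral_const_mul _ mFr, lintegral_lintegral_swap mF.aemeasurable]
  have e2 : ∀ v : EE n × EE n, ∫⁻ w, G v.1 * G v.2 * (chi θ k w v.1 * chi θ k w v.2) ∂(parM n) = G v.1 * G v.2 * ∫⁻ w, (chi θ k w v.1 * chi θ k w v.2) ∂(parM n) := by
    intro v
    rw [lintegral_const_mul]
    exact (chi_ml hθ k _).mul (chi_ml hθ k _)
  simp_rw [e2]
  have mi : Measurable fun v : EE n × EE n => ∫⁻ w, (chi θ k w v.1 * chi θ k w v.2) ∂(parM n) :=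
    Measurable.lintegral_prod_left' (mχ1.mul mχ2)
  have mGi : Measurable fun v : EE n × EE n => G v.1 * G v.2 * ∫⁻ w, (chi θ k w v.1 * chi θ k w v.2) ∂(parM n) := mG.mul mi
  rw [← lintegral_const_mul _ mGi]
  have mk : Measurable fun v : EE n × EE n => G v.1 * G v.2 * (‖v.1 - v.2‖ₑ)⁻¹ := mG.mul (measurable_fst.sub measurable_snd).enorm.inv
  rw [← lintegral_prod (fun v : EE n × EE n => G v.1 * G v.2 * (‖v.1 - v.2‖ₑ)⁻¹) mk.aemeasurable, ← lintegral_const_mul _ mk]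
  refine lintegral_mono fun v => ?_
  calc _ = G v.1 * G v.2 * (ENNReal.ofReal (k+1)^2 * ∫⁻ w, (chi θ k w v.1 * chi θ k w v.2) ∂(parM n)) := by ring
    _ ≤ G v.1 * G v.2 * (2 * volume (ball (0 : EE n) 2) * (‖v.1 - v.2‖ₑ)⁻¹) := mul_le_mul' le_rfl (chi_inner hθ k _ _)
    _ = _ := by ring

/-- the exponent `s` -/
def sE (n : ℕ) : ℝ := 3 * n / (3 * n - 2)
/-- the exponent `τ` -/
def tE (n : ℕ) : ℝ := ((n:ℝ)/(n-1)) / sE n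

lemma sE_gt (hn : 2 ≤ n) : 1 < sE n := by
  have hn2 : (2:ℝ) ≤ n := by exact_mod_cast hn
  rw [sE, one_lt_div (by linarith)]; linarith

lemma strip_p (hn : 2 ≤ n) : ∃ C : ℝ, 0 < C ∧ ∀ (θ : EE n → ℝ) (g : EE n → ℝ) (k : ℕ), Continuous θ → (∀ x, |θ x| ≤ 2) → Measurable g →
    ∫⁻ w, lstrip g (parab θ w.1) w.2 k ^ ((n:ℝ)/(n-1)) ∂(parM n) ≤
      ENNReal.ofReal C * (∫⁻ y in closedBall (0 : EE n) 4, ENNReal.ofReal (g y) ^ sE n) ^ tE n := by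
  obtain ⟨M, hM, H⟩ := riesz hn
  have hn2 : (2:ℝ) ≤ n := by exact_mod_cast hn
  have hp1 := pexp_gt hn
  have hs1 := sE_gt hn
  set p : ℝ := (n:ℝ)/(n-1) with hp
  have hp2 : p ≤ 2 := by rw [hp, div_le_iff₀ (by linarith)]; linarith
  set V := volume (ball (0 : EE n) 2) with hV
  have hVt : V ≠ ∞ := measure_ball_lt_top.ne
  set W := (2 * V * ENNReal.ofReal M) ^ (p/2) * (parM n Set.univ) ^ (1 - p/2) with hW
  have hWt : W ≠ ∞ := by
    refine ENNReal.mul_ne_top (ENNReal.rpow_ne_top_of_nonneg (by linarith) ?_) (ENNReal.rpow_ne_top_of_nonneg (by linarith) (measure_ne_top _ _))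
    exact ENNReal.mul_ne_top (ENNReal.mul_ne_top (by simp) hVt) ENNReal.ofReal_ne_top
  refine ⟨W.toReal + 1, by positivity, fun θ g k hθ hθ2 hg => ?_⟩
  have hm := lstrip_meas hθ hg k
  set I := ∫⁻ y in closedBall (0 : EE n) 4, ENNReal.ofReal (g y) ^ sE n with hI
  have h1 : ∫⁻ w, lstrip g (parab θ w.1) w.2 k ^ 2 ∂(parM n) ≤ 2 * V * (ENNReal.ofReal M * I ^ (2 / sE n)) := by
    refine (strip_sq hθ hθ2 hg k).trans ?_
    exact mul_le_mul' le_rfl (H _ hg.ennreal_ofReal)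
  calc ∫⁻ w, lstrip g (parab θ w.1) w.2 k ^ p ∂(parM n) = ∫⁻ w, (lstrip g (parab θ w.1) w.2 k ^ 2) ^ (p/2) * (1:ℝ≥0∞)^(1-p/2) ∂(parM n) := by
        refine lintegral_congr fun w => ?_
        rw [ENNReal.one_rpow, mul_one, ← ENNReal.rpow_natCast, ← ENNReal.rpow_mul]
        congr 1; push_cast; ring
    _ ≤ (∫⁻ w, lstrip g (parab θ w.1) w.2 k ^ 2 ∂(parM n)) ^ (p/2) * (∫⁻ w, 1 ∂(parM n))^(1-p/2) :=
        ENNReal.lintegral_mul_norm_pow_le (hm.pow_const 2).aemeasurable aemeasurable_const (by linarith) (by linarith) (by ring)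
    _ ≤ (2 * V * (ENNReal.ofReal M * I ^ (2 / sE n))) ^ (p/2) * (parM n Set.univ)^(1-p/2) := by
        rw [lintegral_one]
        exact mul_le_mul' (ENNReal.rpow_le_rpow h1 (by linarith)) le_rfl
    _ = W * I ^ tE n := by
        rw [← mul_assoc, ENNReal.mul_rpow_of_nonneg _ _ (by linarith : 0 ≤ p/2), ← ENNReal.rpow_mul, hW]
        have : 2 / sE n * (p/2) = tE n := by rw [tE, ← hp]; ring
        rw [this]; ring
    _ ≤ _ := by
        refine mul_le_mul' ?_ le_rfl
        rw [ENNReal.ofReal_add ENNReal.toReal_nonneg zero_le_one, ENNReal.ofReal_toReal hWt]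
        exact le_self_add

lemma parab_contDiff {θ : EE n → ℝ} (hθ : ContDiff ℝ sm θ) (a : EE n) : ContDiff ℝ sm (parab θ a) := by
  have : ContDiff ℝ sm (fun x : EE n => ‖x - a‖^2) := (contDiff_id.sub contDiff_const).norm_sq ℝ
  exact hθ.sub this

lemma parab_fderiv {θ : EE n → ℝ} (hθ : ContDiff ℝ sm θ) (h1 : ∀ x, ‖fderiv ℝ θ x‖ ≤ 1) {a x : EE n} (hx : ‖x - a‖ < 3) : ‖fderiv ℝ (parab θ a) x‖ ≤ 7 := by
  have h2 : HasFDerivAt (fun x : EE n => ‖x - a‖^2) (2 • (innerSL ℝ (x - a))) x := by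
    have := ((hasStrictFDerivAt_norm_sq (x - a)).hasFDerivAt).comp x ((hasFDerivAt_id x).sub_const a)
    rw [ContinuousLinearMap.comp_id] at this
    exact this
  have h3 : HasFDerivAt (parab θ a) (fderiv ℝ θ x - 2 • (innerSL ℝ (x - a))) x := ((hθ.differentiable (by simp)) x).hasFDerivAt.sub h2
  rw [h3.fderiv]
  refine (norm_sub_le _ _).trans ?_
  have h4 : ‖(2 • (innerSL ℝ (x - a)) : EE n →L[ℝ] ℝ)‖ ≤ 2 * ‖x - a‖ := by
    refine (norm_nsmul_le).trans ?_
    rw [innerSL_apply_norm]; simp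
  linarith [h1 x]

lemma theta_le_two (hn : 2 ≤ n) {θ : EE n → ℝ} (hθ : ContDiff ℝ sm θ) (h0 : ∀ x, x ∉ ball (0 : EE n) 1 → θ x = 0) (h1 : ∀ x, ‖fderiv ℝ θ x‖ ≤ 1) (x : EE n) : |θ x| ≤ 2 := by
  by_cases hx : x ∈ ball (0 : EE n) 1
  swap
  · rw [h0 x hx]; simp
  set e : EE n := EuclideanSpace.single ⟨0, by omega⟩ (2:ℝ) with he
  have hne : ‖e‖ = 2 := by rw [he]; simp
  have h2 := (convex_univ (𝕜 := ℝ) (E := EE n)).norm_image_sub_le_of_norm_fderiv_le (f := θ) (C := 1) (x := x + e) (y := x) (fun y _ => (hθ.differentiable (by simp)) y) (fun y _ => h1 y) (Set.mem_univ _) (Set.mem_univ _)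
  have h3 : θ (x + e) = 0 := by
    apply h0
    rw [mem_ball_zero_iff] at hx ⊢
    have := norm_sub_le (x + e) x
    rw [add_sub_cancel_left, hne] at this
    linarith
  rw [h3, sub_zero, Real.norm_eq_abs] at h2
  have : ‖x - (x + e)‖ = 2 := by rw [sub_add_cancel_left, norm_neg, hne]
  rw [this] at h2
  linarith

lemma layer_aux {c : ℝ} (h1 : -6 ≤ c) (h2 : c ≤ 2) : ∫ s in Set.Ioo (-6:ℝ) 2, (Set.Iio c).indicator (fun _ => (1:ℝ)) s = c + 6 := by
  rw [integral_indicator measurableSet_Iio, Measure.restrict_restrict measurableSet_Iio]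
  have : Set.Iio c ∩ Set.Ioo (-6:ℝ) 2 = Set.Ioo (-6) c := by
    ext s; simp only [Set.mem_inter_iff, Set.mem_Iio, Set.mem_Ioo]; constructor
    · rintro ⟨h3, h4, h5⟩; exact ⟨h4, h3⟩
    · rintro ⟨h3, h4⟩; exact ⟨h4, h3, by linarith⟩
  rw [this]
  simp [Measure.real, Real.volume_Ioo]
  linarith

lemma layer {θ : EE n → ℝ} (hθ : Continuous θ) (h0 : ∀ x, x ∉ ball (0 : EE n) 1 → θ x = 0) (hθ2 : ∀ x, |θ x| ≤ 2) {J : EE n → ℝ} (hJ : Integrable J)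
    {a : EE n} (ha : a ∈ ball (0 : EE n) 1) :
    ‖∫ x, θ x * J x‖ₑ ≤ ∫⁻ s in Set.Ioo (-6:ℝ) 2, (ENNReal.ofReal |∫ x in {x | s < parab θ a x}, J x| + ENNReal.ofReal |∫ x in {x | s < parab (fun _ => 0) a x}, J x|) := by
  have cu : Continuous (parab θ a) := by unfold parab; fun_prop
  have cv : Continuous (parab (fun _ => 0) a) := by unfold parab; fun_prop
  set F : EE n → ℝ → ℝ := fun x s => ((Set.Iio (parab θ a x)).indicator (fun _ => (1:ℝ)) s - (Set.Iio (parab (fun _ => 0) a x)).indicator (fun _ => (1:ℝ)) s) * J x with hF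
  have hFi : Integrable (Function.uncurry F) (volume.prod (volume.restrict (Set.Ioo (-6:ℝ) 2))) := by
    have i1 : Integrable (fun v : EE n × ℝ => J v.1 * (1:ℝ)) (volume.prod (volume.restrict (Set.Ioo (-6:ℝ) 2))) := hJ.mul_prod (integrable_const 1)
    simp only [mul_one] at i1
    refine i1.bdd_mul (c := 2) ?_ (Filter.Eventually.of_forall fun v => ?_)
    · have m1 : ∀ u : EE n → ℝ, Continuous u → Measurable (fun v : EE n × ℝ => (Set.Iio (u v.1)).indicator (fun _ => (1:ℝ)) v.2) := fun u hu =>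
        (measurable_const (a := (1:ℝ))).indicator (isOpen_lt continuous_snd (hu.comp continuous_fst)).measurableSet
      exact ((m1 _ cu).sub (m1 _ cv)).aestronglyMeasurable
    · have m1 : ∀ (c s : ℝ), ‖(Set.Iio c).indicator (fun _ => (1:ℝ)) s‖ ≤ 1 := fun c s => by
        refine (norm_indicator_le_norm_self _ _).trans ?_; simp
      refine (norm_sub_le _ _).trans ?_
      linarith [m1 (parab θ a v.1) v.2, m1 (parab (fun _ => 0) a v.1) v.2]
  have e1 : ∀ x, θ x * J x = ∫ s in Set.Ioo (-6:ℝ) 2, F x s := by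
    intro x
    rw [hF]; simp only
    rw [integral_mul_const]
    congr 1
    have ii : ∀ c : ℝ, IntegrableOn ((Set.Iio c).indicator (fun _ => (1:ℝ))) (Set.Ioo (-6:ℝ) 2) := fun c =>
      (integrable_const (1:ℝ)).indicator measurableSet_Iio
    rw [integral_sub (ii _) (ii _)]
    by_cases hx : x ∈ ball (0 : EE n) 1
    · have h3 := abs_le.1 (hθ2 x)
      have h4 : ‖x - a‖ < 2 := by
        rw [mem_ball_zero_iff] at hx ha
        linarith [norm_sub_le x a]
      have h5 : ‖x - a‖^2 ≤ 4 := by nlinarith [norm_nonneg (x - a)]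
      have h6 : 0 ≤ ‖x - a‖^2 := by positivity
      rw [layer_aux, layer_aux] <;> simp only [parab] <;> linarith
    · rw [parab, parab, h0 x hx, sub_self]
  have e2 : ∀ s, ∫ x, F x s = (∫ x in {x | s < parab θ a x}, J x) - ∫ x in {x | s < parab (fun _ => 0) a x}, J x := by
    intro s
    have mu : MeasurableSet {x | s < parab θ a x} := (isOpen_lt continuous_const cu).measurableSet
    have mv : MeasurableSet {x | s < parab (fun _ => 0) a x} := (isOpen_lt continuous_const cv).measurableSet
    rw [← integral_indicator mu, ← integral_indicator mv, ← integral_sub (hJ.indicator mu) (hJ.indicator mv)]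
    congr 1; ext x
    rw [hF]; simp only [sub_mul]
    congr 1
    · by_cases h : s < parab θ a x
      · rw [Set.indicator_of_mem (by exact h), Set.indicator_of_mem (by exact h), one_mul]
      · rw [Set.indicator_of_notMem (by exact h), Set.indicator_of_notMem (by exact h), zero_mul]
    · by_cases h : s < parab (fun _ => 0) a x
      · rw [Set.indicator_of_mem (by exact h), Set.indicator_of_mem (by exact h), one_mul]
      · rw [Set.indicator_of_notMem (by exact h), Set.indicator_of_notMem (by exact h), zero_mul]
  simp_rw [e1]
  rw [integral_integral_swap hFi]
  simp_rw [e2]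
  refine (enorm_integral_le_lintegral_enorm _).trans (lintegral_mono fun s => ?_)
  simp only
  rw [← Real.norm_eq_abs, ← Real.norm_eq_abs, ofReal_norm, ofReal_norm]
  exact enorm_sub_le

lemma unit_est (hn : 2 ≤ n) : ∃ C : ℝ, 0 < C ∧ ∀ (f : EE n → EE n) (θ : EE n → ℝ), Adm f → ContDiff ℝ sm θ →
    (∀ x, x ∉ ball (0 : EE n) 1 → θ x = 0) → (∀ x, ‖fderiv ℝ θ x‖ ≤ 1) →
    ENNReal.ofReal |∫ x, θ x * jacDet f x| ≤ ENNReal.ofReal C * (∫⁻ y in closedBall (0 : EE n) 4, ENNReal.ofReal (cofNorm f y) ^ sE n) ^ tE n := by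
  obtain ⟨C1, hC1, H1⟩ := level_est hn
  obtain ⟨C2, hC2, H2⟩ := strip_p hn
  set p : ℝ := (n:ℝ)/(n-1) with hp
  set V := volume (ball (0 : EE n) 1) with hV
  have hVt : V ≠ ∞ := measure_ball_lt_top.ne
  have hV0 : V ≠ 0 := (measure_ball_pos _ _ one_pos).ne'
  have hVr : 0 < V.toReal := ENNReal.toReal_pos hV0 hVt
  set C3 : ℝ := C1 * 7 ^ p with hC3
  have hC30 : 0 < C3 := by positivity
  refine ⟨V.toReal⁻¹ * (2 * C3 * C2), by positivity, fun f θ A hθ h0 h1 => ?_⟩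
  have hθ2 := theta_le_two hn hθ h0 h1
  have hg := measurable_cofNorm f
  set I := (∫⁻ y in closedBall (0 : EE n) 4, ENNReal.ofReal (cofNorm f y) ^ sE n) ^ tE n with hI
  have key : ∀ ϑ : EE n → ℝ, ContDiff ℝ sm ϑ → (∀ x, ‖fderiv ℝ ϑ x‖ ≤ 1) → (∀ x, |ϑ x| ≤ 2) → ∀ a ∈ ball (0 : EE n) 1, ∀ s ∈ Set.Ioo (-6:ℝ) 2,
      ENNReal.ofReal |∫ x in {x | s < parab ϑ a x}, jacDet f x| ≤ ENNReal.ofReal C3 * Filter.liminf (fun k => lstrip (cofNorm f) (parab ϑ a) s k ^ p) Filter.atTop := by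
    intro ϑ k1 k2 k3 a ha s hs
    exact H1 f A (parab ϑ a) s 4 7 (parab_contDiff k1 a) (fun x hx => (parab_super k3 ha hs.1 hx).2) (by norm_num)
      (fun x hx => parab_fderiv k1 k2 (parab_super k3 ha hs.1 hx).1)
  set L : (EE n → ℝ) → EE n × ℝ → ℝ≥0∞ := fun ϑ w => Filter.liminf (fun k => lstrip (cofNorm f) (parab ϑ w.1) w.2 k ^ p) Filter.atTop with hL
  have mL : ∀ ϑ : EE n → ℝ, Continuous ϑ → Measurable (L ϑ) := fun ϑ hϑ => Measurable.liminf fun k => (lstrip_meas hϑ hg k).pow_const p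
  have iL : ∀ ϑ : EE n → ℝ, Continuous ϑ → (∀ x, |ϑ x| ≤ 2) → ∫⁻ w, L ϑ w ∂(parM n) ≤ ENNReal.ofReal C2 * I := by
    intro ϑ k1 k3
    refine (lintegral_liminf_le fun k => (lstrip_meas k1 hg k).pow_const p).trans ?_
    refine Filter.liminf_le_of_le (by isBoundedDefault) fun b hb => ?_
    obtain ⟨k, hk⟩ := hb.exists
    exact hk.trans (H2 ϑ (cofNorm f) k k1 k3 hg)
  set z : EE n → ℝ := fun _ => 0 with hz
  have z1 : ContDiff ℝ sm z := contDiff_const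
  have z2 : ∀ x, ‖fderiv ℝ z x‖ ≤ 1 := fun x => by rw [hz]; simp
  have z3 : ∀ x, |z x| ≤ 2 := fun x => by rw [hz]; simp
  have m1 := mL θ hθ.continuous
  have m2 := mL z z1.continuous
  have main : V * ENNReal.ofReal |∫ x, θ x * jacDet f x| ≤ ENNReal.ofReal (2 * C3 * C2) * I := by
    calc V * ENNReal.ofReal |∫ x, θ x * jacDet f x| = ∫⁻ a in ball (0 : EE n) 1, ENNReal.ofReal |∫ x, θ x * jacDet f x| := by
          rw [setLIntegral_const, mul_comm]
      _ ≤ ∫⁻ a in ball (0 : EE n) 1, ∫⁻ s in Set.Ioo (-6:ℝ) 2, ENNReal.ofReal C3 * (L θ (a, s) + L z (a, s)) := by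
          refine setLIntegral_mono' measurableSet_ball fun a ha => ?_
          rw [← Real.norm_eq_abs, ofReal_norm]
          refine (layer hθ.continuous h0 hθ2 A.int_J ha).trans ?_
          refine setLIntegral_mono' measurableSet_Ioo fun s hs => ?_
          rw [mul_add]
          exact add_le_add (key θ hθ h1 hθ2 a ha s hs) (key z z1 z2 z3 a ha s hs)
      _ = ∫⁻ w, ENNReal.ofReal C3 * (L θ w + L z w) ∂(parM n) := by
          rw [parM, lintegral_prod]
          exact (((m1.add m2).const_mul _)).aemeasurable
      _ = ENNReal.ofReal C3 * ((∫⁻ w, L θ w ∂(parM n)) + ∫⁻ w, L z w ∂(parM n)) := by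
          rw [lintegral_const_mul, lintegral_add_left m1]
          exact m1.add m2
      _ ≤ ENNReal.ofReal C3 * (ENNReal.ofReal C2 * I + ENNReal.ofReal C2 * I) :=
          mul_le_mul' le_rfl (add_le_add (iL θ hθ.continuous hθ2) (iL z z1.continuous z3))
      _ = _ := by
          rw [ENNReal.ofReal_mul (by positivity : 0 ≤ 2 * C3), ENNReal.ofReal_mul zero_le_two, ENNReal.ofReal_ofNat]; ring
  calc ENNReal.ofReal |∫ x, θ x * jacDet f x| = ENNReal.ofReal (V.toReal⁻¹) * (V * ENNReal.ofReal |∫ x, θ x * jacDet f x|) := by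
        rw [← mul_assoc, ENNReal.ofReal_inv_of_pos hVr, ENNReal.ofReal_toReal hVt, ENNReal.inv_mul_cancel hV0 hVt, one_mul]
    _ ≤ ENNReal.ofReal (V.toReal⁻¹) * (ENNReal.ofReal (2 * C3 * C2) * I) := mul_le_mul' le_rfl main
    _ = _ := by rw [← mul_assoc, ← ENNReal.ofReal_mul (by positivity)]

lemma integral_scale (F : EE n → ℝ) (x0 : EE n) {r : ℝ} (hr : 0 < r) : ∫ y, F y = r ^ n * ∫ x, F (x0 + r • x) := by
  have h1 := Measure.integral_comp_smul_of_nonneg (volume : Measure (EE n)) (fun x => F (x0 + x)) r (hR := hr.le)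
  rw [h1, finrank_euclideanSpace, Fintype.card_fin, integral_add_left_eq_self (fun x => F x) x0, smul_eq_mul, ← mul_assoc, mul_inv_cancel₀ (by positivity), one_mul]

lemma integrable_scale {E : Type*} [NormedAddCommGroup E] {F : EE n → E} (hF : Integrable F) (x0 : EE n) {r : ℝ} (hr : 0 < r) : Integrable (fun x => F (x0 + r • x)) := by
  exact (hF.comp_add_left x0).comp_smul hr.ne'

lemma lintegral_scale {F : EE n → ℝ≥0∞} (hF : Measurable F) (x0 : EE n) {r : ℝ} (hr : 0 < r) :
    ∫⁻ x, F (x0 + r • x) = ENNReal.ofReal ((r ^ n)⁻¹) * ∫⁻ y, F y := by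
  have hm : Measurable (fun x : EE n => F (x0 + x)) := hF.comp (measurable_const_add x0)
  have h1 : ∫⁻ x, F (x0 + r • x) = ∫⁻ y, F (x0 + y) ∂(Measure.map (r • ·) (volume : Measure (EE n))) := by
    rw [lintegral_map hm (measurable_const_smul r)]
  rw [h1, Measure.map_addHaar_smul _ hr.ne', lintegral_smul_measure, lintegral_add_left_eq_self (fun x => F x) x0, finrank_euclideanSpace, Fintype.card_fin, abs_of_pos (by positivity), smul_eq_mul]

/-- rescaled map -/
def scl (f : EE n → EE n) (x0 : EE n) (r : ℝ) (x : EE n) : EE n := r⁻¹ • f (x0 + r • x)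

lemma hasFDerivAt_aff (x0 : EE n) (r : ℝ) (x : EE n) : HasFDerivAt (fun x : EE n => x0 + r • x) (r • ContinuousLinearMap.id ℝ (EE n)) x :=
  ((hasFDerivAt_id x).const_smul r).const_add x0

lemma scl_hasFDerivAt {f : EE n → EE n} (hf : Differentiable ℝ f) (x0 : EE n) {r : ℝ} (hr : 0 < r) (x : EE n) :
    HasFDerivAt (scl f x0 r) (fderiv ℝ f (x0 + r • x)) x := by
  have h1 := ((hf (x0 + r • x)).hasFDerivAt.comp x (hasFDerivAt_aff x0 r x)).const_smul r⁻¹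
  rw [ContinuousLinearMap.comp_smul, ContinuousLinearMap.comp_id, smul_smul, inv_mul_cancel₀ hr.ne', one_smul] at h1
  exact h1

lemma scl_fderiv {f : EE n → EE n} (hf : Differentiable ℝ f) (x0 : EE n) {r : ℝ} (hr : 0 < r) (x : EE n) :
    fderiv ℝ (scl f x0 r) x = fderiv ℝ f (x0 + r • x) := (scl_hasFDerivAt hf x0 hr x).fderiv

lemma scl_diffMatrix {f : EE n → EE n} (hf : Differentiable ℝ f) (x0 : EE n) {r : ℝ} (hr : 0 < r) (x : EE n) :
    diffMatrix (scl f x0 r) x = diffMatrix f (x0 + r • x) := by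
  ext i j; rw [diffMatrix, diffMatrix, scl_fderiv hf x0 hr]

lemma scl_jac {f : EE n → EE n} (hf : Differentiable ℝ f) (x0 : EE n) {r : ℝ} (hr : 0 < r) (x : EE n) :
    jacDet (scl f x0 r) x = jacDet f (x0 + r • x) := by
  rw [jacDet, scl_diffMatrix hf x0 hr, ← jacDet]

lemma scl_cof {f : EE n → EE n} (hf : Differentiable ℝ f) (x0 : EE n) {r : ℝ} (hr : 0 < r) (x : EE n) :
    cofNorm (scl f x0 r) x = cofNorm f (x0 + r • x) := by
  rw [cofNorm, scl_diffMatrix hf x0 hr, ← cofNorm]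

lemma scl_adm {f : EE n → EE n} (A : Adm f) (x0 : EE n) {r : ℝ} (hr : 0 < r) : Adm (scl f x0 r) where
  hn := A.hn
  hf := fun x => (scl_hasFDerivAt A.hf x0 hr x).differentiableAt
  hfi := by
    simp_rw [scl_fderiv A.hf x0 hr]
    exact integrable_scale A.hfi x0 hr
  hgi := by
    simp_rw [scl_cof A.hf x0 hr]
    exact integrable_scale A.hgi x0 hr

lemma smooth_est (hn : 2 ≤ n) : ∃ C : ℝ, 0 < C ∧ ∀ (f : EE n → EE n), Adm f → ∀ (x0 : EE n) (r L l : ℝ) (θ : EE n → ℝ), 0 < r → 0 < L → 0 < l →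
    ContDiff ℝ sm θ → (∀ x, x ∉ ball x0 r → θ x = 0) → (∀ x, ‖fderiv ℝ θ x‖ ≤ L) →
    ∫⁻ y in closedBall x0 (4 * r), ENNReal.ofReal (cofNorm f y) ^ sE n ≤ ENNReal.ofReal (l * r ^ n) →
    |∫ x, θ x * jacDet f x| ≤ C * L * r ^ (n + 1) * l ^ tE n := by
  obtain ⟨C, hC, H⟩ := unit_est hn
  refine ⟨C, hC, fun f A x0 r L l θ hr hL hl hθ h0 h1 hl2 => ?_⟩
  have ht : 0 ≤ tE n := by
    have := pexp_gt hn; have := sE_gt hn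
    rw [tE]; apply div_nonneg <;> linarith
  set ϑ : EE n → ℝ := fun x => (r * L)⁻¹ * θ (x0 + r • x) with hϑ
  have d1 : ContDiff ℝ sm ϑ := by
    have : ContDiff ℝ sm (fun x : EE n => x0 + r • x) := contDiff_const.add (contDiff_id.const_smul r)
    exact contDiff_const.mul (hθ.comp this)
  have d2 : ∀ x, x ∉ ball (0 : EE n) 1 → ϑ x = 0 := by
    intro x hx
    rw [hϑ]; simp only
    rw [h0, mul_zero]
    rw [mem_ball_zero_iff, not_lt] at hx
    rw [mem_ball_iff_norm, add_sub_cancel_left, norm_smul, Real.norm_of_nonneg hr.le, not_lt]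
    nlinarith
  have d3 : ∀ x, ‖fderiv ℝ ϑ x‖ ≤ 1 := by
    intro x
    have h2 := (((hθ.differentiable (by simp)) (x0 + r • x)).hasFDerivAt.comp x (hasFDerivAt_aff x0 r x)).const_mul (r * L)⁻¹
    rw [ContinuousLinearMap.comp_smul, ContinuousLinearMap.comp_id, smul_smul] at h2
    have h3 : HasFDerivAt ϑ (((r * L)⁻¹ * r) • fderiv ℝ θ (x0 + r • x)) x := h2
    rw [h3.fderiv, norm_smul, Real.norm_of_nonneg (by positivity)]
    calc (r * L)⁻¹ * r * ‖fderiv ℝ θ (x0 + r • x)‖ ≤ (r * L)⁻¹ * r * L := by gcongr; exact h1 _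
      _ = 1 := by field_simp
  have key := H (scl f x0 r) ϑ (scl_adm A x0 hr) d1 d2 d3
  simp_rw [scl_jac A.hf x0 hr, scl_cof A.hf x0 hr] at key
  have hI : ∫⁻ y in closedBall (0 : EE n) 4, ENNReal.ofReal (cofNorm f (x0 + r • y)) ^ sE n ≤ ENNReal.ofReal l := by
    have mh : Measurable fun y => ENNReal.ofReal (cofNorm f y) ^ sE n := (measurable_cofNorm f).ennreal_ofReal.pow_const _
    have := lintegral_scale (mh.indicator (measurableSet_closedBall (x := x0) (ε := 4 * r))) x0 hr
    rw [lintegral_indicator measurableSet_closedBall] at this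
    calc _ = ∫⁻ x, (closedBall x0 (4*r)).indicator (fun y => ENNReal.ofReal (cofNorm f y) ^ sE n) (x0 + r • x) := by
          rw [← lintegral_indicator measurableSet_closedBall]
          refine lintegral_congr fun x => ?_
          have hiff : x0 + r • x ∈ closedBall x0 (4*r) ↔ x ∈ closedBall (0 : EE n) 4 := by
            rw [mem_closedBall_iff_norm, add_sub_cancel_left, norm_smul, Real.norm_of_nonneg hr.le, mem_closedBall_zero_iff, mul_comm 4 r]
            exact mul_le_mul_iff_right₀ hr
          by_cases hx : x ∈ closedBall (0 : EE n) 4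
          · rw [Set.indicator_of_mem hx, Set.indicator_of_mem (hiff.2 hx)]
          · rw [Set.indicator_of_notMem hx, Set.indicator_of_notMem (fun h => hx (hiff.1 h))]
      _ ≤ ENNReal.ofReal ((r^n)⁻¹) * ENNReal.ofReal (l * r^n) := by
          rw [this]; exact mul_le_mul' le_rfl hl2
      _ = ENNReal.ofReal l := by
          rw [← ENNReal.ofReal_mul (by positivity)]; congr 1; field_simp
  have key2 : |∫ x, ϑ x * jacDet f (x0 + r • x)| ≤ C * l ^ tE n := by
    rw [← ENNReal.ofReal_le_ofReal_iff (by positivity)]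
    refine key.trans ?_
    rw [ENNReal.ofReal_mul hC.le, ← ENNReal.ofReal_rpow_of_nonneg hl.le ht]
    exact mul_le_mul' le_rfl (ENNReal.rpow_le_rpow hI ht)
  have e : ∫ x, θ x * jacDet f x = r ^ n * ((r * L) * ∫ x, ϑ x * jacDet f (x0 + r • x)) := by
    have hp : ∀ x, θ (x0 + r • x) * jacDet f (x0 + r • x) = (r * L) * (ϑ x * jacDet f (x0 + r • x)) := by
      intro x
      rw [hϑ]; simp only
      field_simp
    rw [integral_scale _ x0 hr, ← integral_const_mul (r * L)]
    congr 1
    exact integral_congr_ae (Filter.Eventually.of_forall hp)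
  rw [e, abs_mul, abs_mul, abs_of_pos (by positivity : 0 < r^n), abs_of_pos (by positivity : 0 < r * L)]
  calc _ ≤ r ^ n * (r * L * (C * l ^ tE n)) := by gcongr
    _ = _ := by ring

lemma mol_abs_le' {ψ : EE n → ℝ} {B : ℝ} (hb : ∀ y, |ψ y| ≤ B) (k : ℕ) (x : EE n) : |mol (rho n k) ψ x| ≤ B := by
  have e : B = ∫ t, rho n k t * B := by rw [integral_mul_const, rho_int, one_mul]
  rw [mol, ← Real.norm_eq_abs, e]
  refine norm_integral_le_of_norm_le (((rho_cont k).integrable_of_hasCompactSupport (rho_cs k)).mul_const _) (Filter.Eventually.of_forall fun t => ?_)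
  rw [norm_smul, Real.norm_eq_abs, Real.norm_eq_abs, abs_of_nonneg (rho_nonneg k t)]
  exact mul_le_mul_of_nonneg_left (hb _) (rho_nonneg k t)

lemma mol_lip {θ : EE n → ℝ} {L : ℝ} (hc : Continuous θ) (hL : ∀ y z, |θ y - θ z| ≤ L * ‖y - z‖) (k : ℕ) (y z : EE n) :
    |mol (rho n k) θ y - mol (rho n k) θ z| ≤ L * ‖y - z‖ := by
  have hi : ∀ y, Integrable fun t => rho n k t • θ (y - t) := fun y => mol_integrand (rho_cont k) (rho_cs k) hc.locallyIntegrable y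
  have e : L * ‖y - z‖ = ∫ t, rho n k t * (L * ‖y - z‖) := by rw [integral_mul_const, rho_int, one_mul]
  rw [mol, mol, ← integral_sub (hi y) (hi z), ← Real.norm_eq_abs, e]
  refine norm_integral_le_of_norm_le (((rho_cont k).integrable_of_hasCompactSupport (rho_cs k)).mul_const _) (Filter.Eventually.of_forall fun t => ?_)
  rw [← smul_sub, norm_smul, Real.norm_eq_abs, Real.norm_eq_abs, abs_of_nonneg (rho_nonneg k t)]
  refine mul_le_mul_of_nonneg_left ((hL _ _).trans (le_of_eq ?_)) (rho_nonneg k t)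
  rw [sub_sub_sub_cancel_right]

lemma loc_est (hn : 2 ≤ n) : ∃ C : ℝ, 0 < C ∧ ∀ (f : EE n → EE n), Adm f → LocEst (jacDet f) (fun y => ENNReal.ofReal (cofNorm f y) ^ sE n) (tE n) C := by
  obtain ⟨C, hC, H⟩ := smooth_est hn
  refine ⟨C * 2^(n+1), by positivity, fun f A x r L l θ hr hL hl h1 h2 h3 => ?_⟩
  have hlip : LipschitzWith L.toNNReal θ := LipschitzWith.of_dist_le_mul fun y z => by
    rw [Real.dist_eq, dist_eq_norm, Real.coe_toNNReal L hL]; exact h1 y z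
  have hc := hlip.continuous
  rcases hL.eq_or_lt with hL0 | hL0
  · have hz : ∀ y, θ y = 0 := by
      intro y
      set e : EE n := EuclideanSpace.single ⟨0, by omega⟩ r with he
      have hx : θ (x + e) = 0 := by
        apply h2; rw [mem_ball_iff_norm, add_sub_cancel_left, he]; simp [abs_of_pos hr]
      have := h1 y (x + e)
      rw [← hL0, zero_mul, hx, sub_zero] at this
      exact abs_nonpos_iff.1 this
    simp [hz, ← hL0]
  have hcs : HasCompactSupport θ := HasCompactSupport.of_support_subset_isCompact (isCompact_closedBall x r) (fun y hy => by
    by_contra h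
    exact hy (h2 y fun h' => h (ball_subset_closedBall h')))
  obtain ⟨B, hB⟩ := hcs.exists_bound_of_continuous hc
  have hlim : Filter.Tendsto (fun k => ∫ y, mol (rho n k) θ y * jacDet f y) Filter.atTop (nhds (∫ y, θ y * jacDet f y)) := by
    refine tendsto_integral_of_dominated_convergence (fun y => B * |jacDet f y|) (fun k => ?_) (A.int_J.abs.const_mul B) (fun k => ?_) ?_
    · exact (mol_contDiff (rho_contDiff k) (rho_cs k) hc.locallyIntegrable).continuous.aestronglyMeasurable.mul (measurable_jacDet f).aestronglyMeasurable
    · refine Filter.Eventually.of_forall fun y => ?_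
      rw [norm_mul, Real.norm_eq_abs, Real.norm_eq_abs]
      exact mul_le_mul_of_nonneg_right (mol_abs_le' hB k y) (abs_nonneg _)
    · filter_upwards [rho_tendsto hc.locallyIntegrable] with y hy
      exact hy.mul_const _
  refine le_of_tendsto hlim.abs ?_
  have hev : ∀ᶠ k : ℕ in Filter.atTop, 1 / ((k:ℝ)+1) < r := (tendsto_one_div_add_atTop_nhds_zero_nat (𝕜 := ℝ)).eventually_lt_const hr
  filter_upwards [hev] with k hk
  have hcd := mol_contDiff (rho_contDiff (n := n) k) (rho_cs k) hc.locallyIntegrable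
  have := H f A x (2 * r) L l (mol (rho n k) θ) (by linarith) hL0 hl hcd (fun y hy => ?_) (fun y => ?_) ?_
  · refine this.trans (le_of_eq ?_); rw [mul_pow]; ring
  · rw [mol]
    refine integral_eq_zero_of_ae (Filter.Eventually.of_forall fun t => ?_)
    simp only [Pi.zero_apply, smul_eq_mul]
    rcases le_or_gt (1 / ((k:ℝ)+1)) ‖t‖ with ht | ht
    · rw [rho_zero k t ht, zero_mul]
    · rw [h2, mul_zero]
      rw [mem_ball_iff_norm, not_lt] at hy ⊢
      have := norm_add_le (y - t - x) t
      rw [show y - t - x + t = y - x by abel] at this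
      linarith
  · refine (norm_fderiv_le_of_lipschitz ℝ (C := L.toNNReal) (LipschitzWith.of_dist_le_mul fun u v => ?_)).trans (le_of_eq (Real.coe_toNNReal L hL))
    rw [Real.dist_eq, dist_eq_norm, Real.coe_toNNReal L hL]; exact mol_lip hc h1 k u v
  · refine (lintegral_mono_set (closedBall_subset_closedBall (by linarith))).trans (h3.trans (ENNReal.ofReal_le_ofReal ?_))
    gcongr
    linarith

lemma tE_gt (hn : 2 ≤ n) : 1 < tE n := by
  have hn2 : (2:ℝ) ≤ n := by exact_mod_cast hn
  have h1 : (0:ℝ) < n - 1 := by linarith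
  have h2 : (0:ℝ) < 3 * n - 2 := by linarith
  have hs : sE n < (n:ℝ)/(n-1) := by
    rw [sE, div_lt_div_iff₀ h2 h1]; nlinarith
  have := sE_gt hn
  rw [tE, one_lt_div (by linarith)]; exact hs

lemma sE_mul_tE (hn : 2 ≤ n) : sE n * tE n = (n:ℝ)/(n-1) := by
  have := sE_gt hn
  rw [tE]; exact mul_div_cancel₀ _ (by linarith)

lemma LocEst.mono {J : EE n → ℝ} {h : EE n → ℝ≥0∞} {τ C C' : ℝ} (H : LocEst J h τ C) (hC : C ≤ C') :
    LocEst J h τ C' := by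
  intro x r L l θ hr hL hl h1 h2 h3
  refine (H x r L l θ hr hL hl h1 h2 h3).trans ?_
  gcongr

/-- BMO pairing with Jacobians: if `f ∈ W^{1,n-1}(ℝ^n,ℝ^n)` with `|D^♯f| ∈ L^{n/(n-1)}`,
then for every `φ ∈ BMO(ℝ^n)` (with BMO seminorm at most `M`),
`|∫ φ J(x,f)| ≤ C(n) M ∫ |D^♯f|^{n/(n-1)}`. -/
theorem bmo_pairing_with_jacobian (hn : 2 ≤ n) :
    ∃ C : ℝ, 0 < C ∧
      ∀ f : EuclideanSpace ℝ (Fin n) → EuclideanSpace ℝ (Fin n),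
        Differentiable ℝ f →
        Integrable (fun x => ‖fderiv ℝ f x‖ ^ (n - 1)) volume →
        Integrable (fun x => cofNorm f x ^ ((n : ℝ) / (n - 1))) volume →
        ∀ (φ : EuclideanSpace ℝ (Fin n) → ℝ), LocallyIntegrable φ volume →
          ∀ M : ℝ,
            (∀ (x : EuclideanSpace ℝ (Fin n)) (r : ℝ), 0 < r →
              ⨍ y in Metric.ball x r, |φ y - ⨍ z in Metric.ball x r, φ z| ≤ M) →
            Integrable (fun x => φ x * jacDet f x) volume →
              |∫ x, φ x * jacDet f x| ≤
                C * M * ∫ x, cofNorm f x ^ ((n : ℝ) / (n - 1)) := by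
  obtain ⟨C1, hC1, H1⟩ := loc_est hn
  obtain ⟨C2, hC2, H2⟩ := duality (n := n) (by omega) (tE_gt hn)
  have hC0 : 0 < C1 + (Nat.factorial n : ℝ) := by positivity
  refine ⟨C2 * (C1 + (Nat.factorial n : ℝ)), by positivity, ?_⟩
  intro f hf hfi hgi φ hφ M hM hφJ
  have A : Adm f := ⟨hn, hf, hfi, hgi⟩
  have hs := sE_gt hn
  have hp := pexp_gt hn
  have hsp : sE n ≤ (n:ℝ)/(n-1) := by
    rw [← sE_mul_tE hn]; nlinarith [tE_gt hn]
  have mh : Measurable fun y => ENNReal.ofReal (cofNorm f y) ^ sE n :=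
    (measurable_cofNorm f).ennreal_ofReal.pow_const _
  have hpow : ∀ x, (ENNReal.ofReal (cofNorm f x) ^ sE n) ^ tE n = ENNReal.ofReal (cofNorm f x ^ ((n:ℝ)/(n-1))) := by
    intro x
    rw [← ENNReal.rpow_mul, sE_mul_tE hn, ENNReal.ofReal_rpow_of_nonneg (cofNorm_nonneg f x) (by linarith)]
  have hInt : ∫⁻ x, (ENNReal.ofReal (cofNorm f x) ^ sE n) ^ tE n = ENNReal.ofReal (∫ x, cofNorm f x ^ ((n:ℝ)/(n-1))) := by
    simp_rw [hpow]
    rw [ofReal_integral_eq_lintegral_ofReal hgi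
      (Filter.Eventually.of_forall fun x => Real.rpow_nonneg (cofNorm_nonneg f x) _)]
  have hfin : ∫⁻ x, ENNReal.ofReal (cofNorm f x) ^ sE n ≠ ∞ := by
    have hi : Integrable fun x => cofNorm f x + cofNorm f x ^ ((n:ℝ)/(n-1)) := A.int_g.add hgi
    refine ne_top_of_le_ne_top hi.lintegral_lt_top.ne (lintegral_mono fun x => ?_)
    rw [ENNReal.ofReal_rpow_of_nonneg (cofNorm_nonneg f x) (by linarith)]
    apply ENNReal.ofReal_le_ofReal
    have h0 := cofNorm_nonneg f x
    have h1 : 0 ≤ cofNorm f x ^ ((n:ℝ)/(n-1)) := Real.rpow_nonneg h0 _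
    rcases le_total (cofNorm f x) 1 with h | h
    · have := Real.rpow_le_rpow_of_exponent_ge' h0 h zero_le_one hs.le
      rw [Real.rpow_one] at this
      linarith
    · have := Real.rpow_le_rpow_of_exponent_le h hsp
      linarith
  have main := H2 (jacDet f) (fun y => ENNReal.ofReal (cofNorm f y) ^ sE n) (C1 + (Nat.factorial n : ℝ)) mh hfin
    (by rw [hInt]; exact ENNReal.ofReal_ne_top) hC0.le A.int_J
    (Filter.Eventually.of_forall fun x => by
      rw [hpow, ← ENNReal.ofReal_mul hC0.le]
      apply ENNReal.ofReal_le_ofReal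
      refine (abs_jacDet_le hn f x).trans ?_
      exact mul_le_mul_of_nonneg_right (by linarith) (Real.rpow_nonneg (cofNorm_nonneg f x) _))
    ((H1 f A).mono (by
      have : (0:ℝ) ≤ (Nat.factorial n : ℝ) := by positivity
      linarith)) φ M hφ hM hφJ
  rw [hInt, ENNReal.toReal_ofReal
    (integral_nonneg fun x => Real.rpow_nonneg (cofNorm_nonneg f x) _)] at main
  exact main
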